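/- arXiv:2503.18176 — 3 statements merged into one kernel-verified Lean document; each statement's English description precedes it below -/
import Mathlib

section
/- Let K be a field, V a finite-dimensional K-vector space, and N : V → V a nilpotent K-linear endomorphism. Then there exists a family of subspaces W : ℤ → Submodule K V which is monotone (W_j ⊆ W_k for j ≤ k), satisfies W_k = 0 for all sufficiently small k and W_k = V for all sufficiently large k, satisfies N(W_k) ⊆ W_{k−2} for every k ∈ ℤ, and such that for every k ≥ 0 the linear map from W_k/W_{k−1} to W_{−k}/W_{−k−1} induced by N^k (well defined because N^k(W_k) ⊆ W_{−k} and N^k(W_{k−1}) ⊆ W_{−k−1}) is bijective. -/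
/-- The map `W_k/W_{k-1} → W_{-k}/W_{-k-1}` induced by `N^k`, well defined thanks to the
hypotheses `h1` and `h2`. -/
noncomputable def gradedMap {K V : Type*} [Field K] [AddCommGroup V] [Module K V]
    (N : V →ₗ[K] V) (W : ℤ → Submodule K V) (k : ℕ)
    (h1 : ∀ x ∈ W (k : ℤ), (N ^ k) x ∈ W (-(k : ℤ)))
    (h2 : ∀ x ∈ W ((k : ℤ) - 1), (N ^ k) x ∈ W (-(k : ℤ) - 1)) :
    (↥(W (k : ℤ)) ⧸ Submodule.comap (W (k : ℤ)).subtype (W ((k : ℤ) - 1))) →ₗ[K]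
      (↥(W (-(k : ℤ))) ⧸ Submodule.comap (W (-(k : ℤ))).subtype (W (-(k : ℤ) - 1))) :=
  Submodule.mapQ _ _ ((N ^ k).restrict h1) (fun x hx => h2 x hx)

/-- `W` is a weight filtration of the nilpotent endomorphism `N` centered at `0`:
it is monotone, exhaustive, satisfies `N(W_k) ⊆ W_{k-2}` and `N^k` induces isomorphisms
`W_k/W_{k-1} ≅ W_{-k}/W_{-k-1}` for `k ≥ 0`. -/
def IsWeightFiltration {K V : Type*} [Field K] [AddCommGroup V] [Module K V]
    (N : V →ₗ[K] V) (W : ℤ → Submodule K V) : Prop :=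
  Monotone W ∧
  (∃ a : ℤ, ∀ k ≤ a, W k = ⊥) ∧
  (∃ b : ℤ, ∀ k, b ≤ k → W k = ⊤) ∧
  (∀ k : ℤ, (W k).map N ≤ W (k - 2)) ∧
  ∀ k : ℕ, ∃ (h1 : ∀ x ∈ W (k : ℤ), (N ^ k) x ∈ W (-(k : ℤ)))
    (h2 : ∀ x ∈ W ((k : ℤ) - 1), (N ^ k) x ∈ W (-(k : ℤ) - 1)),
    Function.Bijective (gradedMap N W k h1 h2)

namespace Module.End

variable {R M : Type*} [Ring R] [AddCommGroup M] [Module R M]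

/-- The convolution of the kernel filtration of `N` with its image filtration: the `m`-th step is
the sum of the submodules `ker N^(i+1) ∩ im N^j` with `i - j ≤ m`. -/
def kernelImageFiltration (N : M →ₗ[R] M) (m : ℤ) : Submodule R M :=
  ⨆ (i : ℕ) (j : ℕ) (_ : (i : ℤ) - j ≤ m), LinearMap.ker (N ^ (i + 1)) ⊓ LinearMap.range (N ^ j)

variable {N : M →ₗ[R] M}

theorem ker_inf_range_le_kernelImageFiltration {m : ℤ} {i j : ℕ} (h : (i : ℤ) - j ≤ m) :
    LinearMap.ker (N ^ (i + 1)) ⊓ LinearMap.range (N ^ j) ≤ kernelImageFiltration N m :=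
  le_iSup_of_le i (le_iSup_of_le j (le_iSup_of_le h le_rfl))

theorem kernelImageFiltration_le {m : ℤ} {P : Submodule R M}
    (h : ∀ i j : ℕ, (i : ℤ) - j ≤ m →
      LinearMap.ker (N ^ (i + 1)) ⊓ LinearMap.range (N ^ j) ≤ P) :
    kernelImageFiltration N m ≤ P :=
  iSup_le fun i => iSup_le fun j => iSup_le fun hij => h i j hij

theorem monotone_kernelImageFiltration : Monotone (kernelImageFiltration N) := fun _ _ hmn =>
  kernelImageFiltration_le fun _ _ hij => ker_inf_range_le_kernelImageFiltration (hij.trans hmn)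

theorem kernelImageFiltration_eq_bot {n : ℕ} (hn : N ^ n = 0) {m : ℤ} (hm : m ≤ -n) :
    kernelImageFiltration N m = ⊥ := by
  refine le_bot_iff.mp (kernelImageFiltration_le fun i j hij => inf_le_right.trans ?_)
  rw [pow_eq_zero_of_le (by lia) hn, LinearMap.range_zero]

theorem kernelImageFiltration_eq_top {n : ℕ} (hn : N ^ n = 0) {m : ℤ} (hm : n ≤ m) :
    kernelImageFiltration N m = ⊤ := by
  refine top_le_iff.mp (le_trans ?_
    (ker_inf_range_le_kernelImageFiltration (i := n) (j := 0) (by simpa using hm)))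
  simp [pow_succ, hn, Module.End.one_eq_id]

theorem map_kernelImageFiltration_le (m : ℤ) :
    (kernelImageFiltration N m).map N ≤ kernelImageFiltration N (m - 2) := by
  refine Submodule.map_le_iff_le_comap.mpr (kernelImageFiltration_le ?_)
  rintro i j hij _ ⟨hker, y, rfl⟩
  rw [SetLike.mem_coe, LinearMap.mem_ker] at hker
  rw [Submodule.mem_comap]
  rcases i with _ | i
  · have h0 : N ((N ^ j) y) = 0 := by simpa using hker
    rw [h0]
    exact zero_mem _
  · refine ker_inf_range_le_kernelImageFiltration (i := i) (j := j + 1) (by push_cast at *; lia)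
      ⟨?_, y, by rw [pow_succ', Module.End.mul_apply]⟩
    rwa [SetLike.mem_coe, LinearMap.mem_ker, ← Module.End.mul_apply, ← pow_succ]

theorem pow_apply_mem_kernelImageFiltration (k : ℕ) {m n : ℤ} (hn : n = m - 2 * k) {x : M}
    (hx : x ∈ kernelImageFiltration N m) : (N ^ k) x ∈ kernelImageFiltration N n := by
  subst hn
  induction k with
  | zero => simpa using hx
  | succ k ih =>
    rw [pow_succ', Module.End.mul_apply]
    convert map_kernelImageFiltration_le _ (Submodule.mem_map_of_mem ih) using 2
    push_cast
    ring

theorem kernelImageFiltration_le_map_pow (k : ℕ) {m n : ℤ} (hm : m ≤ -k) (hn : n = m + 2 * k) :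
    kernelImageFiltration N m ≤ (kernelImageFiltration N n).map (N ^ k) := by
  refine kernelImageFiltration_le ?_
  rintro i j hij _ ⟨hker, y, rfl⟩
  rw [SetLike.mem_coe, LinearMap.mem_ker, ← Module.End.mul_apply, ← pow_add] at hker
  refine ⟨(N ^ (j - k)) y, ker_inf_range_le_kernelImageFiltration (i := i + k) (j := j - k)
    (by lia) ⟨?_, y, rfl⟩, ?_⟩
  · rw [SetLike.mem_coe, LinearMap.mem_ker, ← Module.End.mul_apply, ← pow_add]
    convert hker using 3
    lia
  · rw [← Module.End.mul_apply, ← pow_add, Nat.add_sub_cancel' (by lia)]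

theorem ker_pow_le_kernelImageFiltration (k : ℕ) :
    LinearMap.ker (N ^ k) ≤ kernelImageFiltration N ((k : ℤ) - 1) := by
  intro x hx
  rcases k with _ | k
  · have h0 : x = 0 := by simpa using hx
    rw [h0]
    exact zero_mem _
  · exact ker_inf_range_le_kernelImageFiltration (i := k) (j := 0) (by simp) ⟨hx, x, by simp⟩

end Module.End

theorem gradedMap_mk_eq_zero_iff {K V : Type*} [Field K] [AddCommGroup V] [Module K V]
    {N : V →ₗ[K] V} {W : ℤ → Submodule K V} {k : ℕ}
    (h1 : ∀ x ∈ W (k : ℤ), (N ^ k) x ∈ W (-(k : ℤ)))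
    (h2 : ∀ x ∈ W ((k : ℤ) - 1), (N ^ k) x ∈ W (-(k : ℤ) - 1)) (x : W (k : ℤ)) :
    gradedMap N W k h1 h2 (Submodule.Quotient.mk x) = 0 ↔ (N ^ k) x ∈ W (-(k : ℤ) - 1) :=
  Submodule.Quotient.mk_eq_zero ((W (-(k : ℤ) - 1)).comap (W (-(k : ℤ))).subtype)
    (x := (N ^ k).restrict h1 x)

open Module.End in
theorem isWeightFiltration_kernelImageFiltration {K V : Type*} [Field K] [AddCommGroup V]
    [Module K V] {N : V →ₗ[K] V} (hN : IsNilpotent N) :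
    IsWeightFiltration N (kernelImageFiltration N) := by
  obtain ⟨n, hn⟩ := hN
  refine ⟨monotone_kernelImageFiltration, ⟨-n, fun _ => kernelImageFiltration_eq_bot hn⟩,
    ⟨n, fun _ => kernelImageFiltration_eq_top hn⟩, map_kernelImageFiltration_le, fun k =>
    ⟨fun _ => pow_apply_mem_kernelImageFiltration k (by ring),
      fun _ => pow_apply_mem_kernelImageFiltration k (by ring), ?_, ?_⟩⟩
  · rw [← LinearMap.ker_eq_bot, LinearMap.ker_eq_bot']
    intro q hq
    obtain ⟨⟨x, hx⟩, rfl⟩ := Submodule.Quotient.mk_surjective _ q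
    rw [gradedMap_mk_eq_zero_iff] at hq
    obtain ⟨z, hz, hzx⟩ := kernelImageFiltration_le_map_pow k (by lia)
      (show (k : ℤ) - 1 = -(k : ℤ) - 1 + 2 * k by ring) hq
    have hxz : x - z ∈ LinearMap.ker (N ^ k) := by
      rw [LinearMap.mem_ker, map_sub, sub_eq_zero]
      exact hzx.symm
    rw [Submodule.Quotient.mk_eq_zero]
    simpa using add_mem (ker_pow_le_kernelImageFiltration k hxz) hz
  · intro q
    obtain ⟨⟨x, hx⟩, rfl⟩ := Submodule.Quotient.mk_surjective _ q
    obtain ⟨z, hz, rfl⟩ := kernelImageFiltration_le_map_pow k le_rfl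
      (show (k : ℤ) = -(k : ℤ) + 2 * k by ring) hx
    exact ⟨Submodule.Quotient.mk ⟨z, hz⟩, rfl⟩

/-- Every nilpotent endomorphism of a finite-dimensional vector space
admits a weight filtration centered at `0`. -/
theorem exists_weight_filtration {K V : Type*} [Field K] [AddCommGroup V] [Module K V]
    [FiniteDimensional K V] (N : V →ₗ[K] V) (hN : IsNilpotent N) :
    ∃ W : ℤ → Submodule K V, IsWeightFiltration N W :=
  ⟨_, isWeightFiltration_kernelImageFiltration hN⟩
end

section
/- Let K be a field, V a finite-dimensional K-vector space, and N : V → V a nilpotent K-linear endomorphism. Suppose W and W' are two families of subspaces ℤ → Submodule K V, each monotone, each equal to 0 for all sufficiently small indices and to V for all sufficiently large indices, each satisfying N(W_k) ⊆ W_{k−2} (resp. N(W'_k) ⊆ W'_{k−2}) for every k ∈ ℤ, and each such that for every k ≥ 0 the map induced by N^k from the k-th graded piece to the (−k)-th graded piece (W_k/W_{k−1} → W_{−k}/W_{−k−1}, resp. for W') is bijective. Then W_k = W'_k for every k ∈ ℤ. -/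
namespace IsWeightFiltration

variable {K V : Type*} [Field K] [AddCommGroup V] [Module K V]
  {N : V →ₗ[K] V} {W W' : ℤ → Submodule K V}

theorem pow_apply_mem (hW : IsWeightFiltration N W) (n : ℕ) {k : ℤ} {x : V} (hx : x ∈ W k) :
    (N ^ n) x ∈ W (k - 2 * n) := by
  induction n with
  | zero => simpa using hx
  | succ n ih =>
    have h := hW.2.2.2.1 _ (Submodule.mem_map_of_mem ih)
    rw [pow_succ', Module.End.mul_apply]
    convert h using 2
    push_cast
    ring

theorem mem_pred_of_pow_apply_mem (hW : IsWeightFiltration N W) (k : ℕ) {x : V}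
    (hx : x ∈ W k) (hNx : (N ^ k) x ∈ W (-k - 1)) : x ∈ W (k - 1) := by
  obtain ⟨h1, h2, hb⟩ := hW.2.2.2.2 k
  have h : gradedMap N W k h1 h2 (Submodule.Quotient.mk ⟨x, hx⟩) = 0 :=
    (Submodule.Quotient.mk_eq_zero _).2 hNx
  have h' := hb.1 (h.trans (map_zero _).symm)
  rwa [Submodule.Quotient.mk_eq_zero] at h'

theorem exists_pow_apply_sub_mem (hW : IsWeightFiltration N W) (k : ℕ) {y : V}
    (hy : y ∈ W (-k)) : ∃ x ∈ W k, (N ^ k) x - y ∈ W (-k - 1) := by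
  obtain ⟨h1, h2, hb⟩ := hW.2.2.2.2 k
  obtain ⟨q, hq⟩ := hb.2 (Submodule.Quotient.mk ⟨y, hy⟩)
  obtain ⟨⟨x, hx⟩, rfl⟩ := Submodule.Quotient.mk_surjective _ q
  have hq' : Submodule.Quotient.mk ((N ^ k).restrict h1 ⟨x, hx⟩) =
      (Submodule.Quotient.mk ⟨y, hy⟩ : _ ⧸ (W (-k - 1)).comap (W (-k)).subtype) := hq
  rw [Submodule.Quotient.eq] at hq'
  exact ⟨x, hx, hq'⟩

/-- The negative part of a weight filtration is determined by the nonnegative part. -/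
theorem map_pow_eq (hW : IsWeightFiltration N W) (k : ℕ) :
    (W k).map (N ^ k) = W (-k) := by
  apply le_antisymm
  · rintro _ ⟨x, hx, rfl⟩
    exact (hW.2.2.2.2 k).1 x hx
  obtain ⟨a, ha⟩ := hW.2.1
  have key : ∀ d k : ℕ, -a ≤ k + d → W (-k) ≤ (W k).map (N ^ k) := by
    intro d
    induction d with
    | zero =>
      intro k hk
      rw [ha (-k) (by push_cast at hk; lia)]
      exact bot_le
    | succ d ih =>
      intro k hk y hy
      obtain ⟨x, hx, hxy⟩ := hW.exists_pow_apply_sub_mem k hy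
      have hxy' : (N ^ k) x - y ∈ W (-((k + 1 : ℕ) : ℤ)) := by
        convert hxy using 2
        push_cast
        ring
      obtain ⟨z, hz, hzy⟩ := ih (k + 1) (by push_cast at hk ⊢; lia) hxy'
      have hNz : N z ∈ W k :=
        hW.1 (by push_cast; lia) (hW.2.2.2.1 _ (Submodule.mem_map_of_mem hz))
      refine ⟨x - N z, sub_mem hx hNz, ?_⟩
      rw [pow_succ, Module.End.mul_apply] at hzy
      rw [map_sub, hzy, sub_sub_cancel]
  exact key (-a).toNat k (by lia)

/-- The nonnegative part of a weight filtration is determined by the lower steps. -/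
theorem comap_pow_eq (hW : IsWeightFiltration N W) (k : ℕ) :
    (W (-k - 2)).comap (N ^ (k + 1)) = W k := by
  apply le_antisymm
  · intro x hx
    obtain ⟨b, hb⟩ := hW.2.2.1
    have key : ∀ d : ℕ, x ∈ W (k + d : ℕ) → x ∈ W k := by
      intro d
      induction d with
      | zero => exact id
      | succ d ih =>
        intro hd
        refine ih ?_
        have h := hW.pow_apply_mem d (Submodule.mem_comap.1 hx)
        rw [← Module.End.mul_apply, ← pow_add, show d + (k + 1) = k + (d + 1) by ring] at h
        have h' := hW.mem_pred_of_pow_apply_mem _ hd (hW.1 (by push_cast; lia) h)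
        convert h' using 2
        push_cast
        ring
    refine key b.toNat ?_
    rw [hb _ (by push_cast; lia)]
    trivial
  · intro x hx
    have h := hW.pow_apply_mem (k + 1) hx
    rw [Submodule.mem_comap]
    convert h using 2
    push_cast
    ring

theorem eq_and_eq_neg (hW : IsWeightFiltration N W) (hW' : IsWeightFiltration N W') (k : ℕ) :
    W k = W' k ∧ W (-k) = W' (-k) := by
  obtain ⟨a, ha⟩ := hW.2.1
  obtain ⟨a', ha'⟩ := hW'.2.1
  have key : ∀ d k : ℕ, -a ≤ k + d → -a' ≤ k + d → W k = W' k ∧ W (-k) = W' (-k) := by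
    intro d
    induction d with
    | zero =>
      intro k hk hk'
      push_cast at hk hk'
      refine ⟨?_, by rw [ha _ (by lia), ha' _ (by lia)]⟩
      rw [← hW.comap_pow_eq, ← hW'.comap_pow_eq, ha _ (by lia), ha' _ (by lia)]
    | succ d ih =>
      intro k hk hk'
      have h := (ih (k + 2) (by push_cast at hk ⊢; lia) (by push_cast at hk' ⊢; lia)).2
      rw [show -((k + 2 : ℕ) : ℤ) = -k - 2 by push_cast; ring] at h
      have hk : W k = W' k := by rw [← hW.comap_pow_eq, ← hW'.comap_pow_eq, h]
      exact ⟨hk, by rw [← hW.map_pow_eq, ← hW'.map_pow_eq, hk]⟩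
  exact key ((-a).toNat + (-a').toNat) k (by push_cast; lia) (by push_cast; lia)

end IsWeightFiltration

/-- The weight filtration of a nilpotent endomorphism of a
finite-dimensional vector space is unique. -/
theorem weight_filtration_unique {K V : Type*} [Field K] [AddCommGroup V] [Module K V]
    [FiniteDimensional K V] (N : V →ₗ[K] V) (hN : IsNilpotent N)
    (W W' : ℤ → Submodule K V)
    (hW : IsWeightFiltration N W) (hW' : IsWeightFiltration N W') :
    ∀ k : ℤ, W k = W' k := by
  intro k
  obtain ⟨n, rfl | rfl⟩ := k.eq_nat_or_neg
  · exact (hW.eq_and_eq_neg hW' n).1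
  · exact (hW.eq_and_eq_neg hW' n).2
end

section
/- Let f ∈ ℂ[x₀,x₁,x₂] (MvPolynomial (Fin 3) ℂ) be a squarefree homogeneous polynomial which factors as f = f₁ ⋯ f_r into irreducible homogeneous polynomials f₁, …, f_r of degrees d₁, …, d_r ≥ 1 that are pairwise non-associated. Let ℙ² denote the complex projective plane, realized as the quotient Projectivization ℂ (Fin 3 → ℂ) of (Fin 3 → ℂ) ∖ {0} with its quotient topology, and let U = {P ∈ ℙ² : f(v) ≠ 0 for every representative v of P}. Then for every basepoint x₀ ∈ U, the abelianization of the fundamental group π₁(U, x₀) is isomorphic (as a group) to ℤ^{r−1} × ℤ/gcd(d₁,…,d_r)ℤ. -/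
open scoped LinearAlgebra.Projectivization

/-- The quotient topology on the projectivization of a topological vector space. -/
noncomputable instance projectivizationTopology :
    TopologicalSpace (Projectivization ℂ (Fin 3 → ℂ)) :=
  inferInstanceAs (TopologicalSpace (Quotient _))

/-- The complement in `ℙ²` of the curve defined by a homogeneous polynomial `f`. -/
def curveComplement (f : MvPolynomial (Fin 3) ℂ) : Set (Projectivization ℂ (Fin 3 → ℂ)) :=
  {P | ∀ (v : Fin 3 → ℂ) (hv : v ≠ 0), Projectivization.mk ℂ v hv = P →
    MvPolynomial.eval v f ≠ 0}

section

open Set Topology Filter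
open scoped unitInterval

/-- An additive, homotopy invariant functional on the paths of a space, with values in an
abelian group. -/
structure PathCocycle (X A : Type*) [TopologicalSpace X] [AddCommGroup A] where
  /-- The value on a path. -/
  val : ∀ {p q : X}, Path p q → A
  val_trans : ∀ {p q s : X} (γ : Path p q) (δ : Path q s), val (γ.trans δ) = val γ + val δ
  val_homotopic : ∀ {p q : X} {γ δ : Path p q}, γ.Homotopic δ → val γ = val δ

namespace PathCocycle

variable {X Y A : Type*} [TopologicalSpace X] [TopologicalSpace Y] [AddCommGroup A]
  (c : PathCocycle X A)

lemma val_refl (p : X) : c.val (Path.refl p) = 0 := by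
  have := c.val_trans (Path.refl p) (Path.refl p)
  rw [Path.refl_trans_refl] at this
  simpa using this

lemma val_symm {p q : X} (γ : Path p q) : c.val γ.symm = - c.val γ := by
  have h : (Path.refl p).Homotopic (γ.trans γ.symm) := ⟨Path.Homotopy.reflTransSymm γ⟩
  have := c.val_homotopic h
  rw [c.val_trans, c.val_refl] at this
  exact (neg_eq_of_add_eq_zero_right this.symm).symm

lemma val_congr {p q p' q' : X} (γ : Path p q) (δ : Path p' q') (h : ∀ t, γ t = δ t) :
    c.val γ = c.val δ := by
  obtain rfl : p = p' := by simpa using h 0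
  obtain rfl : q = q' := by simpa using h 1
  obtain rfl : γ = δ := by ext t; exact h t
  rfl

/-- Pullback of a path cocycle along a continuous map. -/
def comap (φ : C(Y, X)) : PathCocycle Y A where
  val γ := c.val (γ.map φ.continuous)
  val_trans γ δ := by rw [Path.map_trans, c.val_trans]
  val_homotopic h := c.val_homotopic (h.map φ)

lemma comap_val (φ : C(Y, X)) {p q : Y} (γ : Path p q) :
    (c.comap φ).val γ = c.val (γ.map φ.continuous) := rfl

lemma val_eq_of_simplyConnected [SimplyConnectedSpace X] {p q : X} (γ δ : Path p q) :
    c.val γ = c.val δ :=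
  c.val_homotopic (SimplyConnectedSpace.paths_homotopic γ δ)

lemma val_map_eq_of_simplyConnected [SimplyConnectedSpace Y] (φ : C(Y, X)) {p q : Y}
    (γ δ : Path p q) : c.val (γ.map φ.continuous) = c.val (δ.map φ.continuous) :=
  (c.comap φ).val_eq_of_simplyConnected γ δ

lemma exists_primitive_of_simplyConnected [SimplyConnectedSpace X] :
    ∃ Φ : X → A, ∀ {p q : X} (γ : Path p q), c.val γ = Φ q - Φ p := by
  obtain ⟨x⟩ : Nonempty X := inferInstance
  refine ⟨fun p ↦ c.val (PathConnectedSpace.somePath x p), fun {p q} γ ↦ ?_⟩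
  rw [eq_sub_iff_add_eq', ← c.val_trans]
  exact c.val_eq_of_simplyConnected _ _

lemma val_square {p₀ q₀ p₁ q₁ : X} (F : C(I × I, X)) (γ₀ : Path p₀ q₀) (γ₁ : Path p₁ q₁)
    (α : Path p₀ p₁) (β : Path q₀ q₁) (h₀ : ∀ t, F (0, t) = γ₀ t) (h₁ : ∀ t, F (1, t) = γ₁ t)
    (hα : ∀ s, F (s, 0) = α s) (hβ : ∀ s, F (s, 1) = β s) :
    c.val γ₀ + c.val β = c.val α + c.val γ₁ := by
  let e : Path (0 : I) 1 := ⟨ContinuousMap.id I, rfl, rfl⟩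
  let z (i : I) : Path i i := Path.refl i
  have : c.val ((((z 0).prod e).trans (e.prod (z 1))).map F.continuous) =
      c.val (((e.prod (z 0)).trans ((z 1).prod e)).map F.continuous) := by
    have : ContractibleSpace I := (convex_Icc (0 : ℝ) 1).contractibleSpace ⟨0, by simp⟩
    exact c.val_map_eq_of_simplyConnected F _ _
  rw [Path.map_trans, Path.map_trans, c.val_trans, c.val_trans] at this
  rw [← c.val_congr (((z 0).prod e).map F.continuous) γ₀ h₀,
    ← c.val_congr (((z 1).prod e).map F.continuous) γ₁ h₁,
    ← c.val_congr ((e.prod (z 0)).map F.continuous) α hα,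
    ← c.val_congr ((e.prod (z 1)).map F.continuous) β hβ]
  exact this

/-- Invariance under free homotopy of loops. -/
lemma val_loop_eq {p q : X} (F : C(I × I, X)) (γ₀ : Path p p) (γ₁ : Path q q)
    (h₀ : ∀ t, F (0, t) = γ₀ t) (h₁ : ∀ t, F (1, t) = γ₁ t) (h : ∀ s, F (s, 0) = F (s, 1)) :
    c.val γ₀ = c.val γ₁ := by
  let α : Path p q := ⟨F.comp ⟨fun s ↦ (s, 0), by fun_prop⟩, by simp [h₀], by simp [h₁]⟩
  have := c.val_square F γ₀ γ₁ α α h₀ h₁ (fun s ↦ rfl) (fun s ↦ (h s).symm)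
  rwa [add_comm, add_left_cancel_iff] at this

/-- `Φ` is a primitive of `c` near every point of `V`. -/
def IsLocalPrimitive (Φ : X → A) (V : Set X) : Prop :=
  ∀ x ∈ V, ∃ N ∈ 𝓝 x, ∀ {p q : X} (γ : Path p q), range γ ⊆ N → c.val γ = Φ q - Φ p

variable {c}

lemma IsLocalPrimitive.val_eq {Φ : X → A} {V : Set X} (h : c.IsLocalPrimitive Φ V) {p q : X}
    (γ : Path p q) (hγ : range γ ⊆ V) : c.val γ = Φ q - Φ p := by
  obtain ⟨φ, hφ⟩ := (c.comap ⟨γ.extend, γ.continuous_extend⟩).exists_primitive_of_simplyConnected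
  have key : IsLocallyConstant fun t : ℝ ↦ φ t - Φ (γ.extend t) := by
    rw [IsLocallyConstant.iff_eventually_eq]
    intro t
    obtain ⟨N, hN, hN'⟩ := h (γ.extend t) (hγ (by rw [← γ.extend_range]; exact ⟨t, rfl⟩))
    have := γ.continuous_extend.continuousAt.preimage_mem_nhds hN
    obtain ⟨ε, hε, hb⟩ := Metric.mem_nhds_iff.1 this
    filter_upwards [Metric.ball_mem_nhds t hε] with t' ht'
    have hj : JoinedIn (Metric.ball t ε) t t' :=
      ((convex_ball t ε).isPathConnected ⟨t, Metric.mem_ball_self hε⟩).joinedIn _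
        (Metric.mem_ball_self hε) _ ht'
    have h1 := hφ hj.somePath
    rw [comap_val, hN' _ (by rintro _ ⟨s, rfl⟩; exact hb (hj.somePath_mem s))] at h1
    simp only [ContinuousMap.coe_mk] at h1
    rw [sub_eq_sub_iff_sub_eq_sub]
    exact h1.symm
  have h2 : φ 0 - Φ (γ.extend 0) = φ 1 - Φ (γ.extend 1) := key.apply_eq_of_preconnectedSpace 0 1
  let e : Path (0 : ℝ) 1 := ⟨⟨fun t : I ↦ (t : ℝ), by fun_prop⟩, rfl, rfl⟩
  have h3 := hφ e
  rw [comap_val, c.val_congr _ γ (by intro t; simp [e])] at h3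
  simp only [Path.extend_zero, Path.extend_one] at h2
  rw [h3, ← sub_eq_sub_iff_sub_eq_sub.1 h2.symm]

variable (c) in
/-- `c` admits a local primitive on `V`. -/
def ExactOn (V : Set X) : Prop := ∃ Φ, c.IsLocalPrimitive Φ V

lemma ExactOn.mono {V W : Set X} (h : c.ExactOn W) (hVW : V ⊆ W) : c.ExactOn V :=
  h.imp fun _ h x hx ↦ h x (hVW hx)

lemma ExactOn.val_eq_zero {V : Set X} (h : c.ExactOn V) {p : X} (γ : Path p p)
    (hγ : range γ ⊆ V) : c.val γ = 0 := by
  obtain ⟨Φ, h⟩ := h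
  rw [h.val_eq γ hγ, sub_self]

lemma ExactOn.of_loops {V : Set X} (hV : IsOpen V)
    (h : ∀ (p : X) (γ : Path p p), range γ ⊆ V → c.val γ = 0) : c.ExactOn V := by
  classical
  let r (p : X) : X := if hp : (pathComponentIn V p).Nonempty then hp.some else p
  have hr : ∀ p ∈ V, JoinedIn V p (r p) := fun p hp ↦ by
    have hne : (pathComponentIn V p).Nonempty := ⟨p, mem_pathComponentIn_self hp⟩
    simp only [r, dif_pos hne]
    exact hne.some_mem
  have hrr : ∀ p q, JoinedIn V p q → r p = r q := fun p q hpq ↦ by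
    have : pathComponentIn V p = pathComponentIn V q :=
      (pathComponentIn_congr hpq).symm
    simp only [r, this]
    have hne : (pathComponentIn V q).Nonempty := ⟨q, mem_pathComponentIn_self hpq.target_mem⟩
    simp only [dif_pos hne]
  refine ⟨fun p ↦ if hp : p ∈ V then - c.val (hr p hp).somePath else 0, fun y hy ↦
    ⟨V, hV.mem_nhds hy, fun {p q} γ hγ ↦ ?_⟩⟩
  have hp : p ∈ V := hγ ⟨0, by simp⟩
  have hq : q ∈ V := hγ ⟨1, by simp⟩
  have hpq : r p = r q := hrr p q ⟨γ, fun t ↦ hγ ⟨t, rfl⟩⟩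
  have := h p ((γ.trans (hr q hq).somePath).trans ((hr p hp).somePath.symm.cast hpq.symm rfl)) (by
    rw [Path.trans_range, Path.trans_range]
    refine union_subset (union_subset hγ ?_) ?_ <;> rintro _ ⟨t, rfl⟩
    · exact JoinedIn.somePath_mem _ t
    · exact JoinedIn.somePath_mem (hr p hp) _)
  rw [c.val_trans, c.val_trans, c.val_congr (Path.cast _ _ _) (hr p hp).somePath.symm
    (fun t ↦ rfl), c.val_symm] at this
  simp only [dif_pos hp, dif_pos hq]
  rw [← sub_eq_zero, ← this]
  abel

lemma ExactOn.union [LocallyPathConnectedSpace X] {V W : Set X} (hV : IsOpen V) (hW : IsOpen W)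
    (h : IsPreconnected (V ∩ W)) (h₁ : c.ExactOn V) (h₂ : c.ExactOn W) : c.ExactOn (V ∪ W) := by
  classical
  obtain ⟨Φ, hΦ⟩ := h₁
  obtain ⟨Ψ, hΨ⟩ := h₂
  obtain ⟨a, ha⟩ : ∃ a, ∀ x ∈ V ∩ W, Φ x - Ψ x = a := by
    rcases (V ∩ W).eq_empty_or_nonempty with h0 | ⟨x, hx⟩
    · exact ⟨0, by simp [h0]⟩
    refine ⟨Φ x - Ψ x, fun y hy ↦ ?_⟩
    have hloc : ∀ z ∈ V ∩ W, ∀ᶠ w in 𝓝[V ∩ W] z, Φ w - Ψ w = Φ z - Ψ z := by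
      intro z hz
      obtain ⟨N, hN, hN'⟩ := hΦ z hz.1
      obtain ⟨M, hM, hM'⟩ := hΨ z hz.2
      obtain ⟨P, hP, hP'⟩ := (path_connected_basis z).mem_iff.1 (inter_mem hN hM)
      filter_upwards [nhdsWithin_le_nhds hP.1] with w hw
      have hj := hP.2.joinedIn z (mem_of_mem_nhds hP.1) w hw
      have hr : range hj.somePath ⊆ N ∩ M := by
        rintro _ ⟨t, rfl⟩; exact hP' (hj.somePath_mem t)
      have e1 := hN' hj.somePath (hr.trans inter_subset_left)
      rw [hM' hj.somePath (hr.trans inter_subset_right)] at e1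
      rw [sub_eq_sub_iff_sub_eq_sub]
      exact e1.symm
    exact h.induction₂ (fun z w ↦ Φ w - Ψ w = Φ z - Ψ z) hloc
      (fun _ _ _ _ _ _ h1 h2 ↦ h2.trans h1) (fun _ _ _ _ h ↦ h.symm) hx hy
  refine ⟨fun x ↦ if x ∈ V then Φ x else Ψ x + a, fun x hx ↦ ?_⟩
  have hΨV : ∀ y ∈ W, (if y ∈ V then Φ y else Ψ y + a) = Ψ y + a := fun y hy ↦ by
    split_ifs with hyV
    · rw [← ha y ⟨hyV, hy⟩]; abel
    · rfl
  by_cases hxV : x ∈ V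
  · obtain ⟨N, hN, hN'⟩ := hΦ x hxV
    refine ⟨N ∩ V, inter_mem hN (hV.mem_nhds hxV), fun {p q} γ hγ ↦ ?_⟩
    have hp : p ∈ V := (hγ ⟨0, by simp⟩).2
    have hq : q ∈ V := (hγ ⟨1, by simp⟩).2
    rw [hN' γ (hγ.trans inter_subset_left)]
    simp only [if_pos hp, if_pos hq]
  · have hxW : x ∈ W := hx.resolve_left hxV
    obtain ⟨N, hN, hN'⟩ := hΨ x hxW
    refine ⟨N ∩ W, inter_mem hN (hW.mem_nhds hxW), fun {p q} γ hγ ↦ ?_⟩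
    have hp : p ∈ W := (hγ ⟨0, by simp⟩).2
    have hq : q ∈ W := (hγ ⟨1, by simp⟩).2
    rw [hN' γ (hγ.trans inter_subset_left)]
    simp only [hΨV p hp, hΨV q hq, add_sub_add_right_eq_sub]

end PathCocycle

namespace PathCocycle

variable {A : Type*} [AddCommGroup A] {Y : Set ℂ} (c : PathCocycle Y A)

lemma val_eq_zero_of_range_subset_convex {K : Set ℂ} (hK : Convex ℝ K) (hKY : K ⊆ Y)
    {p : Y} (γ : Path p p) (hγ : ∀ t, (γ t : ℂ) ∈ K) : c.val γ = 0 := by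
  have hp : (p : ℂ) ∈ K := by simpa using hγ 0
  have : ContractibleSpace K := hK.contractibleSpace ⟨p, hp⟩
  let ι : C(K, Y) := ⟨inclusion hKY, continuous_inclusion hKY⟩
  let δ : Path (⟨p, hp⟩ : K) ⟨p, hp⟩ :=
    ⟨⟨fun t ↦ ⟨γ t, hγ t⟩, by fun_prop⟩, by simp, by simp⟩
  have h := (c.comap ι).val_eq_of_simplyConnected δ (Path.refl _)
  rw [val_refl, comap_val] at h
  rw [← h]
  exact c.val_congr _ _ (fun t ↦ rfl)

/-- Every loop around `s` in the complex plane has a continuous logarithm. -/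
lemma _root_.Path.exists_log {X : Type*} [TopologicalSpace X] {p q : X} (γ : Path p q) (g : C(X, ℂ))
    (hg : ∀ x, g x ≠ 0) : ∃ l : C(I, ℂ), ∀ t, Complex.exp (l t) = g (γ t) := by
  let δ : C(I, {z : ℂ // z ≠ 0}) := ⟨fun t ↦ ⟨g (γ t), hg _⟩, by fun_prop⟩
  obtain ⟨l, hl, -⟩ := Complex.isCoveringMap_exp.exists_path_lifts δ (Complex.log (g (γ 0)))
    (Subtype.ext (by simp [δ, Complex.exp_log (hg p)]))
  exact ⟨l, fun t ↦ congrArg Subtype.val (congrFun hl t)⟩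

lemma val_eq_zero_of_punctured {K : Set ℂ} (hK : Convex ℝ K) (hKo : IsOpen K) {s : ℂ}
    (hs : s ∈ K) (hsY : s ∉ Y) (hKY : ∀ z ∈ K, z ≠ s → z ∈ Y) {ρ : ℝ} (hρ : 0 < ρ)
    (hc : ∀ ε : ℂ, ε ≠ 0 → ‖ε‖ < ρ → ∀ (p : Y) (γ : Path p p),
      (∀ t : I, (γ t : ℂ) = s + ε * Complex.exp (2 * Real.pi * Complex.I * (t : ℝ))) → c.val γ = 0)
    {p : Y} (γ : Path p p) (hγ : ∀ t, (γ t : ℂ) ∈ K) : c.val γ = 0 := by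
  classical
  obtain ⟨ρ', hρ', hb⟩ : ∃ ρ' > 0, ρ' ≤ ρ ∧ Metric.ball s ρ' ⊆ K := by
    obtain ⟨r, hr, hr'⟩ := Metric.isOpen_iff.1 hKo s hs
    exact ⟨min r ρ, lt_min hr hρ, min_le_right _ _,
      (Metric.ball_subset_ball (min_le_left _ _)).trans hr'⟩
  obtain ⟨l, hl⟩ := γ.exists_log ⟨fun x : Y ↦ (x : ℂ) - s, by fun_prop⟩
    (fun x ↦ sub_ne_zero.2 fun h ↦ hsY (h ▸ x.2))
  simp only [ContinuousMap.coe_mk] at hl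
  obtain ⟨B, hB⟩ : ∃ B, ∀ t, (l t).re ≤ B := by
    obtain ⟨t, ht⟩ := (Complex.continuous_re.comp l.continuous).exists_forall_ge_of_hasCompactSupport
      (HasCompactSupport.of_compactSpace _)
    exact ⟨_, ht⟩
  obtain ⟨N, hN0, hN⟩ : ∃ N : ℝ, 0 ≤ N ∧ ∀ t, (l t).re - N < Real.log ρ' := by
    refine ⟨max 0 (B - Real.log ρ' + 1), le_max_left _ _, fun t ↦ ?_⟩
    have := le_max_right 0 (B - Real.log ρ' + 1)
    linarith [hB t]
  let H : Set ℂ := {ζ | ζ.re < Real.log ρ'}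
  have hHmem : ∀ ζ : ℂ, ζ ∈ H → ‖Complex.exp ζ‖ < ρ' := fun ζ hζ ↦ by
    rw [Complex.norm_exp]; exact (Real.lt_log_iff_exp_lt hρ').1 hζ
  have hHY : ∀ ζ : ℂ, ζ ∈ H → s + Complex.exp ζ ∈ Y := fun ζ hζ ↦
    hKY _ (hb.2 (by simpa using hHmem ζ hζ)) (by simp)
  have : ContractibleSpace H := Convex.contractibleSpace
    (convex_halfSpace_lt Complex.reLm.isLinear _) ⟨l 0 - N, by simpa [H] using hN 0⟩
  let E : C(H, Y) := ⟨fun ζ ↦ ⟨s + Complex.exp ζ, hHY ζ ζ.2⟩, by fun_prop⟩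
  obtain ⟨φ, hφ⟩ := (c.comap E).exists_primitive_of_simplyConnected
  let ψ : ℂ → A := fun ζ ↦ if h : ζ ∈ H then φ ⟨ζ, h⟩ else 0
  have hψ : Function.Periodic ψ (2 * Real.pi * Complex.I) := by
    intro ζ
    by_cases h : ζ ∈ H
    · have h' : ∀ x : ℝ, ζ + x * (2 * Real.pi * Complex.I) ∈ H := by
        intro x; simpa [H] using h
      have h1 : ζ + 2 * Real.pi * Complex.I ∈ H := by simpa using h' 1
      simp only [ψ, dif_pos h, dif_pos h1]
      let δ : Path (⟨ζ, h⟩ : H) ⟨_, h1⟩ :=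
        ⟨⟨fun t ↦ ⟨ζ + (t : ℝ) * (2 * Real.pi * Complex.I), h' t⟩, by fun_prop⟩,
          by simp, by simp⟩
      have e1 := hφ δ
      have e2 : E ⟨_, h1⟩ = E ⟨ζ, h⟩ := Subtype.ext (by simp [E, Complex.exp_add])
      have e3 : c.val (δ.map E.continuous) = c.val ((δ.map E.continuous).cast rfl e2.symm) :=
        c.val_congr _ _ fun t ↦ rfl
      have e4 := e1.symm.trans (e3.trans (hc (Complex.exp ζ) (Complex.exp_ne_zero _)
        ((hHmem _ h).trans_le hb.1) _ _ fun t ↦ by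
          simp [δ, E, Complex.exp_add, mul_comm]))
      exact sub_eq_zero.1 e4
    · have h1 : ζ + 2 * Real.pi * Complex.I ∉ H := by simpa [H] using h
      simp only [ψ, dif_neg h, dif_neg h1]
  have hlH : ∀ t, l t - N ∈ H := fun t ↦ by simpa [H] using hN t
  let δ : Path (⟨_, hlH 0⟩ : H) ⟨_, hlH 1⟩ :=
    ⟨⟨fun t ↦ ⟨l t - N, hlH t⟩, by fun_prop⟩, rfl, rfl⟩
  have hl01 : Complex.exp (l 1) = Complex.exp (l 0) := by rw [hl, hl]; simp
  have hE : E ⟨_, hlH 0⟩ = E ⟨_, hlH 1⟩ := Subtype.ext (by simp [E, Complex.exp_sub, hl01])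
  have hF : ∀ x : I × I, s + Complex.exp (l x.2 - (x.1 : ℝ) * N) ∈ Y := by
    rintro ⟨u, t⟩
    refine hKY _ ?_ (by simp)
    have e : s + Complex.exp (l t - (u : ℝ) * N) =
        s + (Real.exp (-(u * N))) • ((γ t : ℂ) - s) := by
      rw [← hl, sub_eq_add_neg, Complex.exp_add, Complex.real_smul]; push_cast; ring
    rw [e]
    exact hK.add_smul_sub_mem hs (hγ t) ⟨(Real.exp_pos _).le, Real.exp_le_one_iff.2 (by
      have := u.2.1; simp only [Left.neg_nonpos_iff]; positivity)⟩
  let F : C(I × I, Y) :=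
    ⟨fun x ↦ ⟨s + Complex.exp (l x.2 - (x.1 : ℝ) * N), hF x⟩, by fun_prop⟩
  rw [c.val_loop_eq F γ ((δ.map E.continuous).cast rfl hE)
    (fun t ↦ Subtype.ext (by simp [F, hl])) (fun t ↦ Subtype.ext (by simp [F, E, δ]))
    (fun u ↦ Subtype.ext (by simp [F, Complex.exp_sub, hl01]))]
  have e4 : c.val ((δ.map E.continuous).cast rfl hE) = c.val (δ.map E.continuous) :=
    c.val_congr _ _ fun t ↦ rfl
  refine e4.trans ((hφ δ).trans ?_)
  obtain ⟨n, hn⟩ := Complex.exp_eq_exp_iff_exists_int.1 hl01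
  have e3 : φ ⟨_, hlH 1⟩ = ψ (l 0 - N + n * (2 * Real.pi * Complex.I)) := by
    have e5 : l 0 - N + n * (2 * Real.pi * Complex.I) = l 1 - N := by rw [hn]; ring
    rw [e5]; simp only [ψ, dif_pos (hlH 1)]
  rw [e3, hψ.int_mul n]
  simp only [ψ, dif_pos (hlH 0), sub_self]

/-- A cocycle on the complement of a finite set in the plane which vanishes on small circles is
exact. -/
theorem exactOn_convex (hY : Yᶜ.Finite)
    (hc : ∀ s ∉ Y, ∃ ρ > 0, ∀ ε : ℂ, ε ≠ 0 → ‖ε‖ < ρ → ∀ (p : Y) (γ : Path p p),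
      (∀ t : I, (γ t : ℂ) = s + ε * Complex.exp (2 * Real.pi * Complex.I * (t : ℝ))) →
        c.val γ = 0) (K : Set ℂ) (hK : Convex ℝ K) (hKo : IsOpen K) :
    c.ExactOn (Subtype.val ⁻¹' K) := by
  have hYo : IsOpen Y := by simpa using hY.isClosed.isOpen_compl
  have : LocallyPathConnectedSpace Y := hYo.locallyPathConnectedSpace
  induction hn : (K ∩ Yᶜ).ncard using Nat.strong_induction_on generalizing K with
  | _ n ih =>
  subst hn
  have hfin : (K ∩ Yᶜ).Finite := hY.subset inter_subset_right
  rcases (K ∩ Yᶜ).eq_empty_or_nonempty with h0 | ⟨s, hs⟩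
  · refine ExactOn.of_loops (hKo.preimage continuous_subtype_val) fun p γ hγ ↦ ?_
    refine c.val_eq_zero_of_range_subset_convex hK (fun z hz ↦ ?_) γ (fun t ↦ hγ ⟨t, rfl⟩)
    by_contra hzY
    exact h0.le ⟨hz, hzY⟩
  by_cases h1 : ∀ z ∈ K, z ≠ s → z ∈ Y
  · obtain ⟨ρ, hρ, h⟩ := hc s hs.2
    exact ExactOn.of_loops (hKo.preimage continuous_subtype_val) fun p γ hγ ↦
      c.val_eq_zero_of_punctured hK hKo hs.1 hs.2 h1 hρ h γ (fun t ↦ hγ ⟨t, rfl⟩)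
  push Not at h1
  obtain ⟨z, hzK, hzs, hzY⟩ := h1
  obtain ⟨f, a, b, ha, hb, hab⟩ : ∃ (f : ℂ →L[ℝ] ℝ) (a b : ℂ), a ∈ K ∩ Yᶜ ∧ b ∈ K ∩ Yᶜ ∧
      f a < f b := by
    have : ∃ (f : ℂ →L[ℝ] ℝ), f z ≠ f s := by
      by_contra! h
      exact hzs (Complex.ext (h Complex.reCLM) (h Complex.imCLM))
    obtain ⟨f, hf⟩ := this
    rcases hf.lt_or_gt with h | h
    exacts [⟨f, z, s, ⟨hzK, hzY⟩, hs, h⟩, ⟨f, s, z, hs, ⟨hzK, hzY⟩, h⟩]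
  obtain ⟨m, ⟨hm, hma⟩, hmin⟩ := Set.exists_min_image {x ∈ K ∩ Yᶜ | f a < f x} f
    (hfin.subset (sep_subset _ _)) ⟨b, hb, hab⟩
  have hl : ∀ v, IsOpen {x | f x < v} := fun v ↦ isOpen_lt f.continuous continuous_const
  have hg : ∀ v, IsOpen {x | v < f x} := fun v ↦ isOpen_lt continuous_const f.continuous
  have hl' : ∀ v, Convex ℝ {x | f x < v} := fun v ↦ convex_halfSpace_lt f.isLinear v
  have hg' : ∀ v, Convex ℝ {x | v < f x} := fun v ↦ convex_halfSpace_gt f.isLinear v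
  have hl1 : ((K ∩ {x | f x < f m}) ∩ Yᶜ).ncard < (K ∩ Yᶜ).ncard :=
    Set.ncard_lt_ncard ((Set.ssubset_iff_of_subset (inter_subset_inter_left _ inter_subset_left)).2
      ⟨m, hm, fun h ↦ lt_irrefl (f m) h.1.2⟩) hfin
  have hl2 : ((K ∩ {x | f a < f x}) ∩ Yᶜ).ncard < (K ∩ Yᶜ).ncard :=
    Set.ncard_lt_ncard ((Set.ssubset_iff_of_subset (inter_subset_inter_left _ inter_subset_left)).2
      ⟨a, ha, fun h ↦ lt_irrefl (f a) h.1.2⟩) hfin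
  have e1 := ih _ hl1 (K ∩ {x | f x < f m}) (hK.inter (hl' _)) (hKo.inter (hl _)) rfl
  have e2 := ih _ hl2 (K ∩ {x | f a < f x}) (hK.inter (hg' _)) (hKo.inter (hg _)) rfl
  refine (ExactOn.union ((hKo.inter (hl _)).preimage continuous_subtype_val)
    ((hKo.inter (hg _)).preimage continuous_subtype_val) ?_ e1 e2).mono ?_
  · rw [← preimage_inter, ← IsInducing.subtypeVal.isPreconnected_image,
      Subtype.image_preimage_coe, inter_eq_self_of_subset_right]
    · exact ((hK.inter (hl' _)).inter (hK.inter (hg' _))).isPreconnected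
    · rintro x ⟨⟨hxK, h1⟩, ⟨-, h2⟩⟩
      by_contra hxY
      exact (hmin x ⟨⟨hxK, hxY⟩, h2⟩).not_gt h1
  · intro x hx
    rcases lt_or_ge (f x) (f m) with h | h
    exacts [Or.inl ⟨hx, h⟩, Or.inr ⟨hx, hma.trans_le h⟩]

theorem val_eq_zero_of_circles (hY : Yᶜ.Finite)
    (hc : ∀ s ∉ Y, ∃ ρ > 0, ∀ ε : ℂ, ε ≠ 0 → ‖ε‖ < ρ → ∀ (p : Y) (γ : Path p p),
      (∀ t : I, (γ t : ℂ) = s + ε * Complex.exp (2 * Real.pi * Complex.I * (t : ℝ))) →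
        c.val γ = 0) {p : Y} (γ : Path p p) : c.val γ = 0 :=
  (c.exactOn_convex hY hc univ convex_univ isOpen_univ).val_eq_zero γ (by simp)

end PathCocycle

lemma sub_eq_sub_of_exp_comp_eq {Z : Type*} [TopologicalSpace Z] [PreconnectedSpace Z]
    {l m : Z → ℂ} (hl : Continuous l) (hm : Continuous m)
    (h : ∀ z, Complex.exp (l z) = Complex.exp (m z)) (a b : Z) : l a - l b = m a - m b := by
  have := Complex.isCoveringMap_exp.eq_of_comp_eq (g₁ := l) (g₂ := fun z ↦ m z + (l b - m b))
    hl (by fun_prop) (by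
      funext z
      refine Subtype.ext ?_
      simp [Complex.exp_add, Complex.exp_sub, h, Complex.exp_ne_zero]) b (by ring)
  rw [this]
  ring

namespace PathCocycle

variable {X : Type*} [TopologicalSpace X] (g : C(X, ℂ)) (hg : ∀ x, g x ≠ 0)

/-- The variation along paths of a continuous logarithm of a nonvanishing function. -/
noncomputable def logIncrement : PathCocycle X ℂ where
  val γ := (γ.exists_log g hg).choose 1 - (γ.exists_log g hg).choose 0
  val_trans {p q s} γ δ := by
    obtain ⟨l, hl⟩ : ∃ l : C(I, ℂ), l = (γ.exists_log g hg).choose := ⟨_, rfl⟩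
    obtain ⟨m, hm⟩ : ∃ l : C(I, ℂ), l = (δ.exists_log g hg).choose := ⟨_, rfl⟩
    obtain ⟨n, hn⟩ : ∃ l : C(I, ℂ), l = ((γ.trans δ).exists_log g hg).choose := ⟨_, rfl⟩
    have hl' := (γ.exists_log g hg).choose_spec
    have hm' := (δ.exists_log g hg).choose_spec
    have hn' := ((γ.trans δ).exists_log g hg).choose_spec
    rw [← hl] at hl' ⊢
    rw [← hm] at hm' ⊢
    rw [← hn] at hn' ⊢
    have e1 := sub_eq_sub_of_exp_comp_eq (Z := I)
      (l := fun t ↦ n ⟨t / 2, by constructor <;> linarith [t.2.1, t.2.2]⟩) (by fun_prop)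
      l.continuous (fun t ↦ by
        rw [hl', hn', Path.trans_apply, dif_pos (by have := t.2.2; simp only; linarith)]
        congr 2; apply Subtype.ext; simp only; ring) 1 0
    have e2 := sub_eq_sub_of_exp_comp_eq (Z := I)
      (l := fun t ↦ n ⟨(t + 1) / 2, by constructor <;> linarith [t.2.1, t.2.2]⟩) (by fun_prop)
      m.continuous (fun t ↦ by
        rw [hm', hn', Path.trans_apply]
        split_ifs with h
        · have ht : t = 0 := Subtype.ext (by
            have := t.2.1; simp only at h; simp only [Icc.coe_zero]; linarith)
          subst ht
          simp only [Icc.coe_zero]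
          norm_num
        · congr 2; apply Subtype.ext; simp only; ring) 1 0
    rw [← e1, ← e2]
    simp only [Icc.coe_one, Icc.coe_zero]
    norm_num
  val_homotopic {p q γ δ} h := by
    obtain ⟨l, hl⟩ : ∃ l : C(I, ℂ), l = (γ.exists_log g hg).choose := ⟨_, rfl⟩
    obtain ⟨m, hm⟩ : ∃ l : C(I, ℂ), l = (δ.exists_log g hg).choose := ⟨_, rfl⟩
    have hl' := (γ.exists_log g hg).choose_spec
    have hm' := (δ.exists_log g hg).choose_spec
    rw [← hl] at hl' ⊢
    rw [← hm] at hm' ⊢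
    obtain ⟨F⟩ := h
    let G : C(I × I, {z : ℂ // z ≠ 0}) := ⟨fun t ↦ ⟨g (F t), hg _⟩, by fun_prop⟩
    have : ContractibleSpace I := (convex_Icc (0 : ℝ) 1).contractibleSpace ⟨0, by simp⟩
    have : LocallyPathConnectedSpace I := (convex_Icc (0 : ℝ) 1).locallyPathConnectedSpace
    obtain ⟨k, ⟨-, hk⟩, -⟩ := Complex.isCoveringMap_exp.existsUnique_continuousMap_lifts
      G (0, 0) (Complex.log (g (F (0, 0))))
      (Subtype.ext (by simp [G, Complex.exp_log (hg _)]))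
    have hk' : ∀ t, Complex.exp (k t) = g (F t) := fun t ↦
      congrArg Subtype.val (congrFun hk t)
    rw [← sub_eq_sub_of_exp_comp_eq (Z := I) (l := fun t ↦ k (0, t)) (by fun_prop) l.continuous
      (fun t ↦ by rw [hl', hk']; simp) 1 0, ← sub_eq_sub_of_exp_comp_eq (Z := I)
      (l := fun t ↦ k (1, t)) (by fun_prop) m.continuous (fun t ↦ by rw [hm', hk']; simp) 1 0]
    have e0 := sub_eq_sub_of_exp_comp_eq (Z := I) (l := fun t ↦ k (t, 0)) (by fun_prop)
      (m := fun t ↦ 0 + k (0, 0)) (by fun_prop) (fun t ↦ by simp [hk']) 1 0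
    have e1 := sub_eq_sub_of_exp_comp_eq (Z := I) (l := fun t ↦ k (t, 1)) (by fun_prop)
      (m := fun t ↦ 0 + k (0, 1)) (by fun_prop) (fun t ↦ by simp [hk']) 1 0
    simp only [sub_self, sub_eq_zero] at e0 e1
    rw [e0, e1]

lemma logIncrement_val_eq {p q : X} (γ : Path p q) {l : I → ℂ} (hl : Continuous l)
    (h : ∀ t, Complex.exp (l t) = g (γ t)) : (logIncrement g hg).val γ = l 1 - l 0 :=
  sub_eq_sub_of_exp_comp_eq (Z := I) (by fun_prop) hl
    (fun t ↦ by rw [h, (γ.exists_log g hg).choose_spec]) 1 0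

lemma exp_logIncrement {p q : X} (γ : Path p q) :
    Complex.exp ((logIncrement g hg).val γ) = g q / g p := by
  obtain ⟨l, hl⟩ := γ.exists_log g hg
  rw [logIncrement_val_eq g hg γ l.continuous hl, Complex.exp_sub, hl, hl]
  simp

lemma exists_winding {p q : X} (γ : Path p q) : ∃ n : ℤ,
    n * (2 * Real.pi * Complex.I) =
      (logIncrement g hg).val γ - Complex.log (g q) + Complex.log (g p) := by
  have : Complex.exp ((logIncrement g hg).val γ - Complex.log (g q) + Complex.log (g p)) = 1 := by
    rw [Complex.exp_add, Complex.exp_sub, exp_logIncrement, Complex.exp_log (hg _),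
      Complex.exp_log (hg _)]
    field_simp [hg p, hg q]
  obtain ⟨n, hn⟩ := Complex.exp_eq_one_iff.1 this
  exact ⟨n, hn.symm⟩

/-- The winding number of a nonvanishing function along paths. On a path which is not a loop, it
is normalized by means of the principal branch of the logarithm. -/
noncomputable def winding : PathCocycle X ℤ where
  val γ := (exists_winding g hg γ).choose
  val_trans γ δ := by
    have h1 := (exists_winding g hg γ).choose_spec
    have h2 := (exists_winding g hg δ).choose_spec
    have h3 := (exists_winding g hg (γ.trans δ)).choose_spec
    have h4 := (logIncrement g hg).val_trans γ δ
    apply Int.cast_injective (α := ℂ)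
    apply mul_right_cancel₀ Complex.two_pi_I_ne_zero
    push_cast
    rw [add_mul, h1, h2, h3, h4]
    ring
  val_homotopic {_ _ γ δ} h := by
    apply Int.cast_injective (α := ℂ)
    apply mul_right_cancel₀ Complex.two_pi_I_ne_zero
    rw [(exists_winding g hg γ).choose_spec, (exists_winding g hg δ).choose_spec,
      val_homotopic _ h]

lemma winding_val_eq {p : X} (γ : Path p p) {l : I → ℂ} (hl : Continuous l)
    (h : ∀ t, Complex.exp (l t) = g (γ t)) {n : ℤ} (hn : l 1 - l 0 = n * (2 * Real.pi * Complex.I)) :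
    (winding g hg).val γ = n := by
  apply Int.cast_injective (α := ℂ)
  apply mul_right_cancel₀ Complex.two_pi_I_ne_zero
  refine ((exists_winding g hg γ).choose_spec).trans ?_
  rw [logIncrement_val_eq g hg γ hl h, hn]
  ring

end PathCocycle

namespace MvPolynomial

lemma IsHomogeneous.eval_smul_eq {ι R : Type*} [CommSemiring R] {F : MvPolynomial ι R} {d : ℕ}
    (hF : F.IsHomogeneous d) (s : R) (v : ι → R) : eval (s • v) F = s ^ d * eval v F := by
  rw [eval_eq, eval_eq, Finset.mul_sum]
  refine Finset.sum_congr rfl fun m hm ↦ ?_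
  have : m.degree = d := by
    rw [Finsupp.degree_eq_weight_one]; exact hF (mem_support_iff.1 hm)
  simp only [Pi.smul_apply, smul_eq_mul, mul_pow, Finset.prod_mul_distrib]
  rw [Finset.prod_pow_eq_pow_sum, ← Finsupp.degree_apply, this]
  ring

/-- The polynomial in one variable obtained by specializing the last two variables. -/
noncomputable def slice (F : MvPolynomial (Fin 3) ℂ) (y : Fin 2 → ℂ) : Polynomial ℂ :=
  (finSuccEquiv ℂ 2 F).map (eval y)

variable {F G : MvPolynomial (Fin 3) ℂ} {d : ℕ}

lemma eval_slice (F : MvPolynomial (Fin 3) ℂ) (y : Fin 2 → ℂ) (z : ℂ) :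
    (F.slice y).eval z = eval (Fin.cons z y : Fin 3 → ℂ) F :=
  (eval_eq_eval_mv_eval' y z F).symm

lemma slice_mul (F G : MvPolynomial (Fin 3) ℂ) (y : Fin 2 → ℂ) :
    (F * G).slice y = F.slice y * G.slice y := by
  simp [slice]

lemma slice_zero (hF : F.IsHomogeneous d) :
    F.slice 0 = Polynomial.C (eval ![1, 0, 0] F) * Polynomial.X ^ d := by
  refine Polynomial.funext fun z ↦ ?_
  rw [eval_slice]
  have h : (Fin.cons z 0 : Fin 3 → ℂ) = z • ![1, 0, 0] := by
    ext i; refine Fin.cases ?_ (fun j ↦ ?_) i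
    · simp
    · rw [Fin.cons_succ]; fin_cases j <;> simp
  rw [h, hF.eval_smul_eq, Polynomial.eval_mul, Polynomial.eval_C, Polynomial.eval_pow,
    Polynomial.eval_X, mul_comm]

lemma natDegree_finSuccEquiv_le (hF : F.IsHomogeneous d) :
    (finSuccEquiv ℂ 2 F).natDegree ≤ d := by
  refine Polynomial.natDegree_le_iff_coeff_eq_zero.2 fun i hi ↦ ?_
  by_contra h
  have := totalDegree_coeff_finSuccEquiv_add_le F i h
  have := hF.totalDegree_le
  omega

lemma coeff_finSuccEquiv_eq (hF : F.IsHomogeneous d) :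
    (finSuccEquiv ℂ 2 F).coeff d = C (eval ![1, 0, 0] F) := by
  have h0 : ((finSuccEquiv ℂ 2 F).coeff d).totalDegree = 0 := by
    by_cases h : (finSuccEquiv ℂ 2 F).coeff d = 0
    · simp [h]
    · have := totalDegree_coeff_finSuccEquiv_add_le F d h
      have := hF.totalDegree_le
      omega
  have h1 := congrArg (fun p ↦ p.coeff d) (slice_zero hF)
  rw [totalDegree_eq_zero_iff_eq_C] at h0
  rw [h0]
  simp only [slice, Polynomial.coeff_map, Polynomial.coeff_C_mul, Polynomial.coeff_X_pow_self,
    mul_one] at h1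
  rw [h0, eval_C] at h1
  rw [h1]

lemma natDegree_slice (hF : F.IsHomogeneous d) (h : eval ![1, 0, 0] F ≠ 0) (y : Fin 2 → ℂ) :
    (F.slice y).natDegree = d := by
  refine le_antisymm (Polynomial.natDegree_map_le.trans (natDegree_finSuccEquiv_le hF)) ?_
  refine Polynomial.le_natDegree_of_ne_zero ?_
  rwa [slice, Polynomial.coeff_map, coeff_finSuccEquiv_eq hF, eval_C]

lemma leadingCoeff_slice (hF : F.IsHomogeneous d) (h : eval ![1, 0, 0] F ≠ 0) (y : Fin 2 → ℂ) :
    (F.slice y).leadingCoeff = eval ![1, 0, 0] F := by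
  rw [Polynomial.leadingCoeff, natDegree_slice hF h, slice, Polynomial.coeff_map,
    coeff_finSuccEquiv_eq hF, eval_C]

lemma slice_ne_zero (hF : F.IsHomogeneous d) (h : eval ![1, 0, 0] F ≠ 0) (y : Fin 2 → ℂ) :
    F.slice y ≠ 0 := fun h0 ↦ h (by rw [← leadingCoeff_slice hF h y, h0]; simp)

lemma _root_.Polynomial.exists_bezout_derivative_of_squarefree {R : Type*} [CommRing R] [IsDomain R]
    [IsIntegrallyClosed R] [CharZero R] {P : Polynomial R} (hP : P.Monic) (hsq : Squarefree P) :
    ∃ (u v : Polynomial R) (a : R), a ≠ 0 ∧ u * P + v * P.derivative = Polynomial.C a := by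
  let K := FractionRing R
  have hinj : Function.Injective (algebraMap R K) := IsFractionRing.injective R K
  have hK : CharZero K := charZero_of_injective_algebraMap hinj
  have h1 : Squarefree (P.map (algebraMap R K)) := by
    intro q hq
    have hq0 : q ≠ 0 := by
      rintro rfl
      simp at hq
      exact (hP.map _).ne_zero hq
    obtain ⟨q', hq'⟩ := IsIntegrallyClosed.eq_map_mul_C_of_dvd K hP (dvd_of_mul_left_dvd hq)
    have hl : q.leadingCoeff ≠ 0 := by simpa using hq0
    have hm : q'.Monic := by
      have := congrArg Polynomial.leadingCoeff hq'
      rw [Polynomial.leadingCoeff_mul, Polynomial.leadingCoeff_C, mul_eq_right₀ hl,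
        Polynomial.leadingCoeff_map_of_injective hinj] at this
      exact hinj (by simpa using this)
    have : (q' * q').map (algebraMap R K) ∣ P.map (algebraMap R K) := by
      refine dvd_trans ?_ hq
      rw [Polynomial.map_mul, ← hq']
      exact mul_dvd_mul (dvd_mul_right _ _) (dvd_mul_right _ _)
    rw [Polynomial.map_dvd_map _ hinj (hm.mul hm)] at this
    have h2 := (hsq q' this).map (Polynomial.mapRingHom (algebraMap R K))
    rw [← hq']
    exact h2.mul (Polynomial.isUnit_C.2 hl.isUnit)
  obtain ⟨u, v, huv⟩ := PerfectField.separable_iff_squarefree.2 h1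
  obtain ⟨a, ha, hu⟩ := IsLocalization.integerNormalization_spec (nonZeroDivisors R) u
  obtain ⟨b, hb, hv⟩ := IsLocalization.integerNormalization_spec (nonZeroDivisors R) v
  refine ⟨Polynomial.C b * IsLocalization.integerNormalization (nonZeroDivisors R) u,
    Polynomial.C a * IsLocalization.integerNormalization (nonZeroDivisors R) v, a * b,
    mul_ne_zero (nonZeroDivisors.ne_zero ha) (nonZeroDivisors.ne_zero hb), ?_⟩
  apply Polynomial.map_injective _ hinj
  simp only [Polynomial.map_add, Polynomial.map_mul, Polynomial.map_C, hu, hv,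
    Polynomial.derivative_map] at huv ⊢
  rw [Algebra.smul_def a u, Algebra.smul_def b v]
  have e (x : R) : algebraMap R (Polynomial K) x = Polynomial.C (algebraMap R K x) := rfl
  rw [e, e, map_mul, map_mul]
  linear_combination Polynomial.C (algebraMap R K a) * Polynomial.C (algebraMap R K b) * huv

lemma eval_aeval_line (p : MvPolynomial (Fin 2) ℂ) (s t : ℂ) :
    (aeval ![Polynomial.C s, Polynomial.C s * Polynomial.X] p : Polynomial ℂ).eval t =
      eval (s • ![1, t]) p := by
  induction p using MvPolynomial.induction_on with
  | C a => simp
  | add p q hp hq => simp only [map_add, Polynomial.eval_add, hp, hq]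
  | mul_X p i hp =>
    rw [map_mul, Polynomial.eval_mul, hp, map_mul]
    fin_cases i <;> simp

lemma exists_finite_simple_roots (hF : F.IsHomogeneous d) (h : eval ![1, 0, 0] F ≠ 0)
    (hsq : Squarefree F) : ∃ D : Set ℂ, D.Finite ∧ ∀ t ∉ D, ∀ z, (F.slice ![1, t]).eval z = 0 →
      (F.slice ![1, t]).derivative.eval z ≠ 0 := by
  let R := MvPolynomial (Fin 2) ℂ
  let a := eval ![1, 0, 0] F
  let P : Polynomial R := Polynomial.C (C a⁻¹) * finSuccEquiv ℂ 2 F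
  have hPm : P.Monic := by
    refine Polynomial.monic_of_natDegree_le_of_coeff_eq_one d ?_ ?_
    · exact (Polynomial.natDegree_C_mul_le _ _).trans (natDegree_finSuccEquiv_le hF)
    · rw [Polynomial.coeff_C_mul, coeff_finSuccEquiv_eq hF, ← C_mul, inv_mul_cancel₀ h, C_1]
  have hPs : Squarefree P := by
    have h1 : Squarefree (finSuccEquiv ℂ 2 F) := by
      intro q hq
      have := map_dvd (finSuccEquiv ℂ 2).symm hq
      rw [map_mul, AlgEquiv.symm_apply_apply] at this
      simpa using (hsq _ this).map (finSuccEquiv ℂ 2)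
    have hu : IsUnit (Polynomial.C (C a⁻¹) : Polynomial R) :=
      Polynomial.isUnit_C.2 ((inv_ne_zero h).isUnit.map C)
    exact fun q hq ↦ h1 q ((hu.dvd_mul_left).1 hq)
  obtain ⟨u, v, δ, hδ, huv⟩ := Polynomial.exists_bezout_derivative_of_squarefree hPm hPs
  have key : ∀ y, eval y δ ≠ 0 → ∀ z, (F.slice y).eval z = 0 →
      (F.slice y).derivative.eval z ≠ 0 := by
    intro y hy z h0 h1
    apply hy
    have := congrArg (fun p ↦ (p.map (eval y)).eval z) huv
    have e1 : P.map (eval y) = Polynomial.C a⁻¹ * F.slice y := by simp [P, slice]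
    simp only [Polynomial.map_add, Polynomial.map_mul, ← Polynomial.derivative_map, e1,
      Polynomial.derivative_mul, Polynomial.eval_add, Polynomial.eval_mul, h0, h1,
      Polynomial.map_C, Polynomial.eval_C, Polynomial.derivative_C, Polynomial.eval_zero] at this
    rw [← this]; ring
  obtain ⟨y, hy⟩ : ∃ y, eval y (δ * X 0) ≠ 0 := by
    by_contra! hc
    exact mul_ne_zero hδ (X_ne_zero 0) (MvPolynomial.funext fun y ↦ by simpa using hc y)
  rw [eval_mul, eval_X] at hy
  have hs : y 0 ≠ 0 := right_ne_zero_of_mul hy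
  let q : Polynomial ℂ := aeval ![Polynomial.C (y 0), Polynomial.C (y 0) * Polynomial.X] δ
  have hq : ∀ t, q.eval t = eval (y 0 • ![1, t]) δ := by
    intro t
    simp only [q]
    exact eval_aeval_line _ _ _
  have hq0 : q ≠ 0 := by
    intro h0
    apply left_ne_zero_of_mul hy
    have := hq (y 1 / y 0)
    rw [h0, Polynomial.eval_zero] at this
    rw [this]
    congr 1
    congr 1
    ext i; fin_cases i <;> simp
    field_simp
  refine ⟨q.roots.toFinset, q.roots.toFinset.finite_toSet, fun t ht z h0 h1 ↦ ?_⟩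
  have e1 : (F.slice (y 0 • ![1, t])).comp (Polynomial.C (y 0) * Polynomial.X) =
      Polynomial.C (y 0 ^ d) * F.slice ![1, t] := by
    refine Polynomial.funext fun x ↦ ?_
    simp only [Polynomial.eval_comp, Polynomial.eval_mul, Polynomial.eval_C, Polynomial.eval_X,
      eval_slice]
    rw [← hF.eval_smul_eq]
    congr 1
    congr 1
    ext i; refine Fin.cases ?_ (fun j ↦ ?_) i
    · simp
    · simp only [Fin.cons_succ, Pi.smul_apply]
  refine key (y 0 • ![1, t]) (by rw [← hq]; simpa [hq0] using ht) (y 0 * z) ?_ ?_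
  · have := congrArg (Polynomial.eval z) e1
    simpa [Polynomial.eval_comp, h0] using this
  · have := congrArg (fun p ↦ p.derivative.eval z) e1
    simpa [Polynomial.derivative_comp, Polynomial.eval_comp, Polynomial.derivative_mul, h1, hs,
      Polynomial.derivative_pow] using this

lemma exists_root_bound (hF : F.IsHomogeneous d) (h : eval ![1, 0, 0] F ≠ 0) :
    ∃ B : ℝ, 0 < B ∧ ∀ y z, (F.slice y).eval z = 0 → ‖z‖ ≤ B * ‖y‖ := by
  have hcont : Continuous fun y : Fin 2 → ℂ ↦ eval (Fin.cons 1 y : Fin 3 → ℂ) F :=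
    (continuous_eval F).comp (by fun_prop)
  have h0 : eval (Fin.cons 1 (0 : Fin 2 → ℂ) : Fin 3 → ℂ) F ≠ 0 := by
    rw [← eval_slice, slice_zero hF]; simpa using h
  obtain ⟨δ, hδ, hb⟩ := Metric.eventually_nhds_iff.1 (hcont.continuousAt.eventually_ne h0)
  refine ⟨δ⁻¹, inv_pos.2 hδ, fun y z hz ↦ ?_⟩
  by_contra! hlt
  have hz0 : z ≠ 0 := by
    rintro rfl
    rw [norm_zero] at hlt
    have : 0 ≤ δ⁻¹ * ‖y‖ := by positivity
    linarith
  refine hb (y := z⁻¹ • y) ?_ ?_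
  · rw [dist_zero_right, norm_smul, norm_inv]
    have : 0 < ‖z‖ := norm_pos_iff.2 hz0
    rw [inv_mul_lt_iff₀ hδ] at hlt
    rw [inv_mul_lt_iff₀ this, mul_comm]
    exact hlt
  · have e : (Fin.cons 1 (z⁻¹ • y) : Fin 3 → ℂ) = z⁻¹ • (Fin.cons z y : Fin 3 → ℂ) := by
      ext i; refine Fin.cases ?_ (fun j ↦ ?_) i <;> simp [hz0]
    rw [e, hF.eval_smul_eq, ← eval_slice, hz, mul_zero]

/-- Simple roots of the slices extend to local holomorphic families of roots. -/
lemma exists_local_root {t₀ w₀ : ℂ} (h0 : (F.slice ![1, t₀]).eval w₀ = 0)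
    (h1 : (F.slice ![1, t₀]).derivative.eval w₀ ≠ 0) :
    ∃ φ : ℂ → ℂ, φ t₀ = w₀ ∧ (∀ᶠ t in 𝓝 t₀, DifferentiableAt ℂ φ t) ∧
      ∀ᶠ x : ℂ × ℂ in 𝓝 (t₀, w₀), (F.slice ![1, x.1]).eval x.2 = 0 ↔ x.2 = φ x.1 := by
  let g : ℂ × ℂ → ℂ := fun x ↦ eval (Fin.cons x.2 ![1, x.1] : Fin 3 → ℂ) F
  have hg : ∀ x, AnalyticAt ℂ g x := by
    intro x
    have := AnalyticAt.aeval_mvPolynomial (𝕜 := ℂ) (A := ℂ) (B := ℂ) (z := x)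
      (f := fun x : ℂ × ℂ ↦ (Fin.cons x.2 ![1, x.1] : Fin 3 → ℂ)) (fun i ↦ ?_) F
    · simpa only [aeval_eq_eval] using! this
    · refine Fin.cases ?_ (fun j ↦ ?_) i
      · simpa using! analyticAt_snd
      · fin_cases j
        · simpa using! analyticAt_const
        · simpa using! analyticAt_fst
  have hc : ContDiffAt ℂ 1 g (t₀, w₀) := (hg _).contDiffAt
  obtain ⟨g', hg'⟩ : ∃ g', g' = fderiv ℂ g (t₀, w₀) := ⟨_, rfl⟩
  have hd : g' (0, 1) = (F.slice ![1, t₀]).derivative.eval w₀ := by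
    have e1 : HasDerivAt (fun w : ℂ ↦ g (t₀, w)) (g' (0, 1)) w₀ :=
      (hg' ▸ (hg _).differentiableAt.hasFDerivAt).comp_hasDerivAt (x := w₀) (f := fun w ↦ (t₀, w))
        ((hasDerivAt_const _ _).prodMk (hasDerivAt_id _))
    refine e1.unique ?_
    have := (F.slice ![1, t₀]).hasDerivAt w₀
    simpa only [eval_slice] using! this
  have hinv : (g' ∘L .inr ℂ ℂ ℂ).IsInvertible := by
    refine ⟨ContinuousLinearEquiv.unitsEquivAut ℂ (Units.mk0 _ h1), ?_⟩
    ext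
    simp [← hd]
  have hg0 : g (t₀, w₀) = 0 := by simpa [g, eval_slice] using h0
  rw [hg'] at hinv
  refine ⟨hc.implicitFunction one_ne_zero hinv, hc.implicitFunction_apply_self one_ne_zero hinv,
    ?_, ?_⟩
  · filter_upwards [(hc.contDiffAt_implicitFunction one_ne_zero hinv).eventually (by simp)]
      with t ht using ht.differentiableAt one_ne_zero
  · filter_upwards [hc.eventually_apply_eq_iff_implicitFunction one_ne_zero hinv] with x hx
    rw [hg0] at hx
    rw [eval_slice, eq_comm (a := x.2)]
    exact hx

end MvPolynomial

lemma Differentiable.exists_polynomial_of_norm_le {h : ℂ → ℂ} (hh : Differentiable ℂ h) {C : ℝ}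
    {k : ℕ} (hb : ∀ t, ‖h t‖ ≤ C * (1 + ‖t‖) ^ k) :
    ∃ q : Polynomial ℂ, q.natDegree ≤ k ∧ ∀ t, h t = q.eval t := by
  have hC : 0 ≤ C := by simpa using (norm_nonneg _).trans (hb 0)
  have hz : ∀ n, k < n → iteratedDeriv n h 0 = 0 := by
    intro n hn
    have hle : ∀ R : ℝ, 1 ≤ R → ‖iteratedDeriv n h 0‖ ≤ n.factorial * (C * 2 ^ k) / R := by
      intro R hR
      have h0 : 0 < R := by linarith
      refine (Complex.norm_iteratedDeriv_le_of_forall_mem_sphere_norm_le n h0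
        hh.diffContOnCl (C := C * (2 * R) ^ k) fun z hz ↦ (hb z).trans ?_).trans ?_
      · have : ‖z‖ = R := by simpa using hz
        rw [this]
        gcongr
        linarith
      · rw [div_le_div_iff₀ (by positivity) h0, mul_pow]
        obtain ⟨m, rfl⟩ := Nat.exists_eq_add_of_lt hn
        have : R ^ (k + m + 1) = R ^ k * R * R ^ m := by ring
        rw [this]
        have h1 : 1 ≤ R ^ m := one_le_pow₀ hR
        calc _ = (k + m + 1).factorial * (C * 2 ^ k) * (R ^ k * R) * 1 := by ring
          _ ≤ (k + m + 1).factorial * (C * 2 ^ k) * (R ^ k * R) * R ^ m := by gcongr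
          _ = _ := by ring
    have hlim : Tendsto (fun R : ℝ ↦ n.factorial * (C * 2 ^ k) / R) atTop (𝓝 0) :=
      tendsto_const_nhds.div_atTop tendsto_id
    have := ge_of_tendsto hlim ((eventually_ge_atTop 1).mono hle)
    simpa using this
  refine ⟨∑ n ∈ Finset.range (k + 1), Polynomial.monomial n ((n.factorial : ℂ)⁻¹ *
    iteratedDeriv n h 0), ?_, fun t ↦ ?_⟩
  · refine Polynomial.natDegree_sum_le_of_forall_le _ _ fun n hn ↦
      (Polynomial.natDegree_monomial_le _).trans ?_
    simp at hn; omega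
  · rw [← Complex.taylorSeries_eq_of_entire' 0 t hh, tsum_eq_sum (s := Finset.range (k + 1)),
      Polynomial.eval_finsetSum]
    · simp
    · intro n hn
      rw [hz n (by simp at hn; omega)]
      simp

lemma exists_polynomial_of_norm_le_off_finite {h : ℂ → ℂ} {D : Set ℂ} (hD : D.Finite)
    (hh : ∀ t ∉ D, DifferentiableAt ℂ h t) {C : ℝ} {k : ℕ}
    (hb : ∀ t ∉ D, ‖h t‖ ≤ C * (1 + ‖t‖) ^ k) :
    ∃ q : Polynomial ℂ, q.natDegree ≤ k ∧ ∀ t ∉ D, h t = q.eval t := by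
  let H : ℂ → ℂ := fun t ↦ limUnder (𝓝[≠] t) h
  have hH : ∀ t ∉ D, H t = h t := fun t ht ↦
    ((hh t ht).continuousAt.tendsto.mono_left nhdsWithin_le_nhds).limUnder_eq
  obtain ⟨x, hx⟩ := hD.infinite_compl.nonempty
  have hC : 0 ≤ C := by
    have := (norm_nonneg _).trans (hb x hx)
    exact nonneg_of_mul_nonneg_left this (by positivity)
  have hHd : Differentiable ℂ H := by
    intro t
    by_cases ht : t ∈ D
    · let s : Set ℂ := (D \ {t})ᶜ ∩ Metric.ball t 1
      have hs : s ∈ 𝓝 t := inter_mem ((hD.subset sdiff_subset).isClosed.isOpen_compl.mem_nhds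
        (by simp)) (Metric.ball_mem_nhds t one_pos)
      have hsD : ∀ z ∈ s \ {t}, z ∉ D := fun z hz hzD ↦ hz.1.1 ⟨hzD, hz.2⟩
      have h1 := Complex.differentiableOn_update_limUnder_of_bddAbove (f := h) hs
        (fun z hz ↦ (hh z (hsD z hz)).differentiableWithinAt) ⟨C * (1 + (‖t‖ + 1)) ^ k, by
          rintro _ ⟨z, hz, rfl⟩
          refine (hb z (hsD z hz)).trans ?_
          have h2 : ‖z‖ ≤ ‖t‖ + 1 := by
            have h3 : ‖z - t‖ < 1 := by simpa [dist_eq_norm] using hz.1.2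
            have := norm_le_norm_add_norm_sub t z
            rw [norm_sub_rev] at this
            linarith
          gcongr⟩
      refine (h1.differentiableAt hs).congr_of_eventuallyEq ?_
      filter_upwards [hs] with z hz
      by_cases hzt : z = t
      · subst hzt; simp [H]
      · rw [Function.update_of_ne hzt, hH z (hsD z ⟨hz, hzt⟩)]
    · refine (hh t ht).congr_of_eventuallyEq ?_
      filter_upwards [hD.isClosed.isOpen_compl.mem_nhds ht] with z hz using hH z hz
  have hcl : IsClosed {t | ‖H t‖ ≤ C * (1 + ‖t‖) ^ k} :=
    isClosed_le hHd.continuous.norm (by fun_prop)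
  have hde : Dense Dᶜ := hD.countable.dense_compl ℝ
  have hbH : ∀ t, ‖H t‖ ≤ C * (1 + ‖t‖) ^ k := fun t ↦ by
    have := hcl.closure_subset_iff.2 (fun t ht ↦ by simpa [hH t ht] using hb t ht :
      Dᶜ ⊆ {t | ‖H t‖ ≤ C * (1 + ‖t‖) ^ k})
    exact this (hde t)
  obtain ⟨q, hq, hq'⟩ := hHd.exists_polynomial_of_norm_le hbH
  exact ⟨q, hq, fun t ht ↦ by rw [← hH t ht, hq']⟩

namespace MvPolynomial

variable {F : MvPolynomial (Fin 3) ℂ} {d : ℕ} {D : Set ℂ}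

/-- The roots of a slice. -/
noncomputable def sliceRoots (F : MvPolynomial (Fin 3) ℂ) (t : ℂ) : Finset ℂ :=
  (F.slice ![1, t]).roots.toFinset

lemma mem_sliceRoots (hF : F.IsHomogeneous d) (h : eval ![1, 0, 0] F ≠ 0) {t w : ℂ} :
    w ∈ F.sliceRoots t ↔ (F.slice ![1, t]).eval w = 0 := by
  simp [sliceRoots, slice_ne_zero hF h]

lemma nodup_roots_slice (hF : F.IsHomogeneous d) (h : eval ![1, 0, 0] F ≠ 0) {t : ℂ}
    (hs : ∀ z, (F.slice ![1, t]).eval z = 0 → (F.slice ![1, t]).derivative.eval z ≠ 0) :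
    (F.slice ![1, t]).roots.Nodup := by
  rw [Multiset.nodup_iff_count_le_one]
  intro z
  rw [Polynomial.count_roots]
  by_contra! hlt
  obtain ⟨h1, h2⟩ := (Polynomial.one_lt_rootMultiplicity_iff_isRoot (slice_ne_zero hF h _)).1 hlt
  exact hs z h1 h2

lemma card_sliceRoots (hF : F.IsHomogeneous d) (h : eval ![1, 0, 0] F ≠ 0) {t : ℂ}
    (hs : ∀ z, (F.slice ![1, t]).eval z = 0 → (F.slice ![1, t]).derivative.eval z ≠ 0) :
    (F.sliceRoots t).card = d := by
  rw [sliceRoots, Multiset.toFinset_card_of_nodup (nodup_roots_slice hF h hs),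
    IsAlgClosed.card_roots_eq_natDegree, natDegree_slice hF h]

lemma eval_eq_prod_sliceRoots (hF : F.IsHomogeneous d) (h : eval ![1, 0, 0] F ≠ 0) {t : ℂ}
    (hs : ∀ z, (F.slice ![1, t]).eval z = 0 → (F.slice ![1, t]).derivative.eval z ≠ 0) (z : ℂ) :
    eval (Fin.cons z ![1, t] : Fin 3 → ℂ) F =
      eval ![1, 0, 0] F * ∏ w ∈ F.sliceRoots t, (z - w) := by
  rw [← eval_slice]
  conv_lhs => rw [(IsAlgClosed.splits (F.slice ![1, t])).eq_prod_roots]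
  rw [leadingCoeff_slice hF h, Polynomial.eval_mul, Polynomial.eval_C, sliceRoots,
    Finset.prod, Multiset.toFinset_val, Multiset.dedup_eq_self.2 (nodup_roots_slice hF h hs),
    Polynomial.eval_multiset_prod, Multiset.map_map]
  simp

lemma exists_local_roots (hF : F.IsHomogeneous d) (h : eval ![1, 0, 0] F ≠ 0) (hD : D.Finite)
    (hs : ∀ t ∉ D, ∀ z, (F.slice ![1, t]).eval z = 0 → (F.slice ![1, t]).derivative.eval z ≠ 0)
    {T : ℂ → ℂ → Prop} (hT : ∀ t₀ ∉ D, ∀ w₀ ∈ F.sliceRoots t₀, ∀ᶠ x : ℂ × ℂ in 𝓝 (t₀, w₀),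
      x.2 ∈ F.sliceRoots x.1 → (T x.1 x.2 ↔ T t₀ w₀)) {t₀ : ℂ} (ht₀ : t₀ ∉ D) :
    ∃ φ : ℂ → ℂ → ℂ, (∀ w ∈ F.sliceRoots t₀, DifferentiableAt ℂ (φ w) t₀) ∧ ∀ᶠ t in 𝓝 t₀,
      F.sliceRoots t = (F.sliceRoots t₀).image (φ · t) ∧
      InjOn (φ · t) (F.sliceRoots t₀) ∧ ∀ w ∈ F.sliceRoots t₀, (T t (φ w t) ↔ T t₀ w) := by
  have : ∀ w : ℂ, ∃ φ : ℂ → ℂ, w ∈ F.sliceRoots t₀ → (φ t₀ = w ∧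
      (∀ᶠ t in 𝓝 t₀, DifferentiableAt ℂ φ t) ∧
      ∀ᶠ x : ℂ × ℂ in 𝓝 (t₀, w), (F.slice ![1, x.1]).eval x.2 = 0 ↔ x.2 = φ x.1) := by
    intro w
    by_cases hw : w ∈ F.sliceRoots t₀
    · have h0 := (mem_sliceRoots hF h).1 hw
      obtain ⟨φ, hφ⟩ := exists_local_root h0 (hs t₀ ht₀ w h0)
      exact ⟨φ, fun _ ↦ hφ⟩
    · exact ⟨0, fun h ↦ absurd h hw⟩
  choose φ hφ using this
  have hd : ∀ w ∈ F.sliceRoots t₀, DifferentiableAt ℂ (φ w) t₀ := fun w hw ↦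
    (hφ w hw).2.1.self_of_nhds
  have htend : ∀ w ∈ F.sliceRoots t₀, Tendsto (fun t ↦ (t, φ w t)) (𝓝 t₀) (𝓝 (t₀, w)) := by
    intro w hw
    have := (continuousAt_id (x := t₀)).prodMk (hd w hw).continuousAt
    rw [ContinuousAt, (hφ w hw).1] at this
    exact this
  have hroot : ∀ᶠ t in 𝓝 t₀, ∀ w ∈ F.sliceRoots t₀, φ w t ∈ F.sliceRoots t := by
    rw [Filter.eventually_all_finset]
    intro w hw
    filter_upwards [(htend w hw).eventually (hφ w hw).2.2] with t ht
    rw [mem_sliceRoots hF h]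
    exact ht.2 rfl
  have hTT : ∀ᶠ t in 𝓝 t₀, ∀ w ∈ F.sliceRoots t₀, φ w t ∈ F.sliceRoots t →
      (T t (φ w t) ↔ T t₀ w) := by
    rw [Filter.eventually_all_finset]
    intro w hw
    exact (htend w hw).eventually (hT t₀ ht₀ w hw)
  have hinj : ∀ᶠ t in 𝓝 t₀, ∀ w ∈ F.sliceRoots t₀, ∀ w' ∈ F.sliceRoots t₀, w ≠ w' →
      φ w t ≠ φ w' t := by
    rw [Filter.eventually_all_finset]
    intro w hw
    rw [Filter.eventually_all_finset]
    intro w' hw'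
    by_cases hww : w = w'
    · simp [hww]
    · have := ((hd w hw).sub (hd w' hw')).continuousAt.eventually_ne (y := 0)
        (by simpa [(hφ w hw).1, (hφ w' hw').1, sub_eq_zero] using hww)
      exact this.mono fun t ht _ ↦ sub_ne_zero.1 ht
  refine ⟨φ, hd, ?_⟩
  filter_upwards [hroot, hTT, hinj, hD.isClosed.isOpen_compl.mem_nhds ht₀] with t h1 h2 h3 h4
  have hi : InjOn (φ · t) (F.sliceRoots t₀) := fun w hw w' hw' e ↦ by
    by_contra hne
    exact h3 w hw w' hw' hne e
  refine ⟨(Finset.eq_of_subset_of_card_le (fun w hw ↦ ?_) ?_).symm, hi,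
    fun w hw ↦ h2 w hw (h1 w hw)⟩
  · obtain ⟨a, ha, rfl⟩ := Finset.mem_image.1 hw
    exact h1 a ha
  · rw [Finset.card_image_of_injOn hi, card_sliceRoots hF h (hs t h4),
      card_sliceRoots hF h (hs t₀ ht₀)]

lemma _root_.DifferentiableAt.coeff_prod_X_sub_C {ι : Type*} (S : Finset ι) (φ : ι → ℂ → ℂ) {t₀ : ℂ}
    (hφ : ∀ w ∈ S, DifferentiableAt ℂ (φ w) t₀) (k : ℕ) :
    DifferentiableAt ℂ (fun t ↦ (∏ w ∈ S, (Polynomial.X - Polynomial.C (φ w t))).coeff k) t₀ := by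
  classical
  induction S using Finset.induction_on generalizing k with
  | empty => simp
  | insert a S ha ih =>
    have ih' := ih fun w hw ↦ hφ w (Finset.mem_insert_of_mem hw)
    have h1 := hφ a (Finset.mem_insert_self _ _)
    simp only [Finset.prod_insert ha, mul_comm (Polynomial.X - _)]
    cases k with
    | zero =>
      simp only [Polynomial.mul_coeff_zero, Polynomial.coeff_sub, Polynomial.coeff_X_zero,
        Polynomial.coeff_C_zero, zero_sub]
      exact (ih' 0).mul h1.neg
    | succ k =>
      simp only [Polynomial.coeff_mul_X_sub_C]
      exact (ih' k).sub ((ih' (k + 1)).mul h1)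

lemma _root_.Set.Finite.isPreconnected_compl (hD : D.Finite) : IsPreconnected Dᶜ :=
  (hD.countable.isPathConnected_compl_of_one_lt_rank (by
    simp [Complex.rank_real_complex])).isConnected.isPreconnected

/-- A locally constant set of roots of the slices is cut out by a homogeneous polynomial. -/
lemma exists_homogeneous_of_locally_constant (hF : F.IsHomogeneous d) (h : eval ![1, 0, 0] F ≠ 0)
    (hD : D.Finite)
    (hs : ∀ t ∉ D, ∀ z, (F.slice ![1, t]).eval z = 0 → (F.slice ![1, t]).derivative.eval z ≠ 0)
    {T : ℂ → ℂ → Prop} [∀ t w, Decidable (T t w)]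
    (hT : ∀ t₀ ∉ D, ∀ w₀ ∈ F.sliceRoots t₀, ∀ᶠ x : ℂ × ℂ in 𝓝 (t₀, w₀),
      x.2 ∈ F.sliceRoots x.1 → (T x.1 x.2 ↔ T t₀ w₀)) :
    ∃ (m : ℕ) (H : MvPolynomial (Fin 3) ℂ), H.IsHomogeneous m ∧ ∀ t ∉ D,
      ((F.sliceRoots t).filter (T t)).card = m ∧ ∀ z : ℂ,
        eval (Fin.cons z ![1, t] : Fin 3 → ℂ) H =
          ∏ w ∈ (F.sliceRoots t).filter (T t), (z - w) := by
  classical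
  let S (t : ℂ) := (F.sliceRoots t).filter (T t)
  let G (t : ℂ) : Polynomial ℂ := ∏ w ∈ S t, (Polynomial.X - Polynomial.C w)
  have hloc : ∀ t₀ ∉ D, ∃ φ : ℂ → ℂ → ℂ, (∀ w ∈ S t₀, DifferentiableAt ℂ (φ w) t₀) ∧
      ∀ᶠ t in 𝓝 t₀, S t = (S t₀).image (φ · t) ∧ InjOn (φ · t) (S t₀) := by
    intro t₀ ht₀
    obtain ⟨φ, hφ, hφ'⟩ := exists_local_roots hF h hD hs hT ht₀
    refine ⟨φ, fun w hw ↦ hφ w (Finset.mem_filter.1 hw).1, ?_⟩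
    filter_upwards [hφ'] with t ⟨h1, h2, h3⟩
    refine ⟨?_, h2.mono fun w hw ↦ (Finset.mem_filter.1 hw).1⟩
    ext w
    simp only [S, h1, Finset.mem_filter, Finset.mem_image]
    constructor
    · rintro ⟨⟨a, ha, rfl⟩, hTa⟩
      exact ⟨a, ⟨ha, (h3 a ha).1 hTa⟩, rfl⟩
    · rintro ⟨a, ⟨ha, hTa⟩, rfl⟩
      exact ⟨⟨a, ha, rfl⟩, (h3 a ha).2 hTa⟩
  obtain ⟨x, hx⟩ := hD.infinite_compl.nonempty
  have hcard : ∀ t ∉ D, (S t).card = (S x).card := by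
    intro t ht
    refine hD.isPreconnected_compl.induction₂ (fun z w ↦ (S w).card = (S z).card) ?_
      (fun _ _ _ _ _ _ h1 h2 ↦ h2.trans h1) (fun _ _ _ _ h ↦ h.symm) hx ht
    intro t₀ ht₀
    obtain ⟨φ, -, hφ⟩ := hloc t₀ ht₀
    filter_upwards [nhdsWithin_le_nhds hφ] with t ⟨h1, h2⟩
    rw [h1, Finset.card_image_of_injOn h2]
  set m := (S x).card
  have hGm : ∀ t, (G t).Monic := fun t ↦ Polynomial.monic_prod_of_monic _ _ fun w _ ↦
    Polynomial.monic_X_sub_C w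
  have hGd : ∀ t ∉ D, (G t).natDegree = m := fun t ht ↦ by
    rw [← hcard t ht]; exact Polynomial.natDegree_finsetProd_X_sub_C_eq_card _ _
  obtain ⟨B, hB, hroots⟩ := exists_root_bound hF h
  have hcoef : ∀ k ≤ m, ∃ q : Polynomial ℂ, q.natDegree ≤ k ∧
      ∀ t ∉ D, (G t).coeff (m - k) = q.eval t := by
    intro k hk
    refine exists_polynomial_of_norm_le_off_finite hD (C := B ^ k * m.choose (m - k))
      (fun t₀ ht₀ ↦ ?_) (fun t ht ↦ ?_)
    · obtain ⟨φ, hφ, hφ'⟩ := hloc t₀ ht₀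
      refine (DifferentiableAt.coeff_prod_X_sub_C (S t₀) φ hφ (m - k)).congr_of_eventuallyEq ?_
      filter_upwards [hφ'] with t ⟨h1, h2⟩
      simp only [G]
      rw [h1, Finset.prod_image h2]
    · have := Polynomial.coeff_le_of_roots_le (p := G t) (f := RingHom.id ℂ)
        (B := B * (1 + ‖t‖)) (m - k) (hGm t) (IsAlgClosed.splits _) (fun z hz ↦ ?_)
      · rw [Polynomial.map_id, hGd t ht, Nat.sub_sub_self hk] at this
        refine this.trans (le_of_eq ?_)
        rw [mul_pow]
        ring
      · rw [Polynomial.map_id, Polynomial.roots_prod_X_sub_C] at hz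
        have hz' : z ∈ F.sliceRoots t := (Finset.mem_filter.1 hz).1
        refine (hroots _ z ((mem_sliceRoots hF h).1 hz')).trans ?_
        gcongr
        refine (pi_norm_le_iff_of_nonneg (by positivity)).2 fun i ↦ ?_
        fin_cases i <;> simp
  choose! q hq hq' using hcoef
  refine ⟨m, ∑ k ∈ Finset.range (m + 1), X 0 ^ (m - k) * ∑ j ∈ Finset.range (k + 1),
    C ((q k).coeff j) * (X 1 ^ (k - j) * X 2 ^ j), ?_, fun t ht ↦ ⟨hcard t ht, fun z ↦ ?_⟩⟩
  · refine IsHomogeneous.sum _ _ _ fun k hk ↦ ?_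
    have hk' : m = (m - k) + k := by simp at hk; omega
    conv => arg 2; rw [hk']
    refine (isHomogeneous_X_pow _ _).mul (IsHomogeneous.sum _ _ _ fun j hj ↦ ?_)
    have hj' : k = 0 + ((k - j) + j) := by simp at hj; omega
    conv => arg 2; rw [hj']
    exact (isHomogeneous_C _ _).mul ((isHomogeneous_X_pow _ _).mul (isHomogeneous_X_pow _ _))
  · have e1 : ∏ w ∈ S t, (z - w) = (G t).eval z := by
      simp [G, Polynomial.eval_prod]
    rw [e1, Polynomial.eval_eq_sum_range' (n := m + 1) (by rw [hGd t ht]; omega),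
      map_sum]
    conv_rhs => rw [← Finset.sum_range_reflect]
    refine Finset.sum_congr rfl fun k hk ↦ ?_
    have hk' : k ≤ m := by simp at hk; omega
    have e2 : m + 1 - 1 - k = m - k := by omega
    rw [e2, hq' k hk' t ht, Polynomial.eval_eq_sum_range' (n := k + 1) (by have := hq k hk'; omega)]
    simp only [map_mul, map_pow, eval_X, map_sum, eval_C]
    have e3 : (Fin.cons z ![1, t] : Fin 3 → ℂ) 1 = 1 := rfl
    have e4 : (Fin.cons z ![1, t] : Fin 3 → ℂ) 2 = t := rfl
    rw [e3, e4, Fin.cons_zero, mul_comm]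
    simp

lemma IsHomogeneous.eq_zero_of_eval_slice {A : MvPolynomial (Fin 3) ℂ} (hD : D.Finite)
    {m : ℕ} (hA : A.IsHomogeneous m)
    (h : ∀ t ∉ D, ∀ z : ℂ, eval (Fin.cons z ![1, t] : Fin 3 → ℂ) A = 0) : A = 0 := by
  classical
  set P : MvPolynomial (Fin 3) ℂ := X 1 * ∏ τ ∈ hD.toFinset, (X 2 - C τ * X 1) with hP
  have hP0 : P ≠ 0 := by
    refine mul_ne_zero (X_ne_zero _) (Finset.prod_ne_zero_iff.2 fun τ _ h0 ↦ ?_)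
    have := congrArg (eval ![0, 0, 1]) h0
    simp at this
  have : P * A = 0 := by
    refine MvPolynomial.funext fun v ↦ ?_
    rw [map_mul, map_zero]
    by_cases h1 : v 1 = 0
    · simp [hP, h1]
    by_cases h2 : v 2 / v 1 ∈ D
    · have : eval v P = 0 := by
        simp only [hP, map_mul, map_prod, map_sub, eval_X, eval_C]
        rw [Finset.prod_eq_zero (hD.mem_toFinset.2 h2), mul_zero]
        field_simp
        simp
      rw [this, zero_mul]
    · have e : v = v 1 • (Fin.cons (v 0 / v 1) ![1, v 2 / v 1] : Fin 3 → ℂ) := by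
        ext i
        fin_cases i <;> simp <;> field_simp
      rw [e, hA.eval_smul_eq, h _ h2, mul_zero, mul_zero]
  exact (mul_eq_zero.1 this).resolve_left hP0

/-- The set of smooth points on generic slices of an irreducible curve is connected. -/
lemma forall_or_forall_of_locally_constant (hF : F.IsHomogeneous d) (h : eval ![1, 0, 0] F ≠ 0)
    (hirr : Irreducible F) (hD : D.Finite)
    (hs : ∀ t ∉ D, ∀ z, (F.slice ![1, t]).eval z = 0 → (F.slice ![1, t]).derivative.eval z ≠ 0)
    {T : ℂ → ℂ → Prop}
    (hT : ∀ t₀ ∉ D, ∀ w₀ ∈ F.sliceRoots t₀, ∀ᶠ x : ℂ × ℂ in 𝓝 (t₀, w₀),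
      x.2 ∈ F.sliceRoots x.1 → (T x.1 x.2 ↔ T t₀ w₀)) :
    (∀ t ∉ D, ∀ w ∈ F.sliceRoots t, T t w) ∨ (∀ t ∉ D, ∀ w ∈ F.sliceRoots t, ¬ T t w) := by
  classical
  obtain ⟨m, H, hH, hHt⟩ := exists_homogeneous_of_locally_constant hF h hD hs hT
  obtain ⟨n, K, hK, hKt⟩ := exists_homogeneous_of_locally_constant (T := fun t w ↦ ¬ T t w) hF h hD
    hs fun t₀ h₀ w₀ hw₀ ↦ (hT t₀ h₀ w₀ hw₀).mono fun x hx hx' ↦ not_congr (hx hx')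
  obtain ⟨x, hx⟩ := hD.infinite_compl.nonempty
  have hmn : m + n = d := by
    rw [← (hHt x hx).1, ← (hKt x hx).1, Finset.card_filter_add_card_filter_not,
      card_sliceRoots hF h (hs x hx)]
  have hFHK : F = C (eval ![1, 0, 0] F) * H * K := by
    rw [← sub_eq_zero]
    refine IsHomogeneous.eq_zero_of_eval_slice hD (m := d) (hF.sub ?_) fun t ht z ↦ ?_
    · have := ((isHomogeneous_C (Fin 3) (eval ![1, 0, 0] F)).mul hH).mul hK
      rwa [zero_add, hmn] at this
    · rw [map_sub, map_mul, map_mul, eval_C, (hHt t ht).2, (hKt t ht).2, mul_assoc,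
        Finset.prod_filter_mul_prod_filter_not, eval_eq_prod_sliceRoots hF h (hs t ht), sub_self]
  have key : ∀ {P : MvPolynomial (Fin 3) ℂ} {k : ℕ}, P.IsHomogeneous k → IsUnit P → k = 0 := by
    intro P k hP hu
    have := hP.eval_smul_eq 0 (0 : Fin 3 → ℂ)
    by_contra hk
    rw [zero_smul, zero_pow hk, zero_mul] at this
    exact (hu.map (eval (0 : Fin 3 → ℂ))).ne_zero this
  rcases hirr.isUnit_or_isUnit hFHK with hu | hu
  · have hm := key hH (isUnit_of_mul_isUnit_right hu)
    right
    intro t ht w hw hTw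
    have := (hHt t ht).1
    rw [hm, Finset.card_eq_zero] at this
    exact Finset.notMem_empty _ (this ▸ Finset.mem_filter.2 ⟨hw, hTw⟩)
  · have hm := key hK hu
    left
    intro t ht w hw
    by_contra hTw
    have := (hKt t ht).1
    rw [hm, Finset.card_eq_zero] at this
    exact Finset.notMem_empty _ (this ▸ Finset.mem_filter.2 ⟨hw, hTw⟩)

end MvPolynomial

namespace MvPolynomial

/-- The set of points at which a polynomial does not vanish. -/
def nonvanishing {ι : Type*} (F : MvPolynomial ι ℂ) : Set (ι → ℂ) := {v | eval v F ≠ 0}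

@[simp]
lemma mem_nonvanishing {ι : Type*} {F : MvPolynomial ι ℂ} {v : ι → ℂ} :
    v ∈ F.nonvanishing ↔ eval v F ≠ 0 := Iff.rfl

lemma isOpen_nonvanishing {ι : Type*} (F : MvPolynomial ι ℂ) : IsOpen F.nonvanishing :=
  isOpen_ne_fun (continuous_eval F) continuous_const

end MvPolynomial

/-- The circle in the plane of points with last coordinates `(1, t)`. -/
noncomputable def sliceCircle (t w ε : ℂ) (τ : I) : Fin 3 → ℂ :=
  Fin.cons (w + ε * Complex.exp (2 * Real.pi * Complex.I * (τ : ℝ))) ![1, t]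

@[fun_prop]
lemma Continuous.sliceCircle {Z : Type*} [TopologicalSpace Z] {t w ε : Z → ℂ} {τ : Z → I}
    (ht : Continuous t) (hw : Continuous w) (hε : Continuous ε) (hτ : Continuous τ) :
    Continuous fun x ↦ sliceCircle (t x) (w x) (ε x) (τ x) := by
  unfold _root_.sliceCircle
  fun_prop

lemma sliceCircle_zero (t w ε : ℂ) : sliceCircle t w ε 0 = sliceCircle t w ε 1 := by
  simp [sliceCircle]

namespace PathCocycle

section Subset

variable {E A : Type*} [TopologicalSpace E] [AddCommGroup A] {Y : Set E} (c : PathCocycle ↥Y A)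

lemma val_loop_eq_of_forall_mem {g : I × I → E} (hg : Continuous g) (hY : ∀ x, g x ∈ Y)
    (h : ∀ s, g (s, 0) = g (s, 1)) {p q : Y} (γ₀ : Path p p) (γ₁ : Path q q)
    (h₀ : ∀ t, (γ₀ t : E) = g (0, t)) (h₁ : ∀ t, (γ₁ t : E) = g (1, t)) :
    c.val γ₀ = c.val γ₁ :=
  c.val_loop_eq ⟨fun x ↦ ⟨g x, hY x⟩, by fun_prop⟩ γ₀ γ₁ (fun t ↦ Subtype.ext (h₀ t).symm)
    (fun t ↦ Subtype.ext (h₁ t).symm) (fun s ↦ Subtype.ext (h s))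

lemma exists_loop_of_forall_mem {g : I → E} (hg : Continuous g) (hY : ∀ x, g x ∈ Y)
    (h : g 0 = g 1) : ∃ (p : Y) (γ : Path p p), ∀ t, (γ t : E) = g t :=
  ⟨⟨g 0, hY 0⟩, ⟨⟨fun t ↦ ⟨g t, hY t⟩, by fun_prop⟩, rfl, Subtype.ext h.symm⟩, fun _ ↦ rfl⟩

end Subset

variable {A : Type*} [AddCommGroup A] {F : MvPolynomial (Fin 3) ℂ} {d : ℕ} {D : Set ℂ}
  (c : PathCocycle ↥F.nonvanishing A)

/-- The cocycle `c` vanishes on all small circles around the roots of the slices over `(1, t)`,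
`t ∉ D`. -/
def VanishesOnCircles (D : Set ℂ) : Prop :=
  ∀ t ∉ D, ∀ w : ℂ, (F.slice ![1, t]).eval w = 0 → ∃ ρ > 0, ∀ ε : ℂ, ε ≠ 0 → ‖ε‖ < ρ →
    ∀ (p : F.nonvanishing) (γ : Path p p), (∀ τ, (γ τ : Fin 3 → ℂ) = sliceCircle t w ε τ) →
      c.val γ = 0

variable {c}

lemma VanishesOnCircles.val_eq_zero (hc : c.VanishesOnCircles D) (hF : F.IsHomogeneous d)
    (h : MvPolynomial.eval ![1, 0, 0] F ≠ 0) {t : ℂ} (ht : t ∉ D) {p : F.nonvanishing}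
    (γ : Path p p) (hγ : ∀ τ, Fin.tail (γ τ : Fin 3 → ℂ) = ![1, t]) : c.val γ = 0 := by
  let Y : Set ℂ := {z | (F.slice ![1, t]).eval z ≠ 0}
  have hY : Yᶜ.Finite := by
    refine ((F.slice ![1, t]).roots.toFinset.finite_toSet).subset fun z hz ↦ ?_
    simpa [MvPolynomial.slice_ne_zero hF h, Y] using hz
  let φ : C(Y, F.nonvanishing) := ⟨fun z ↦ ⟨Fin.cons z.1 ![1, t], by
    have := z.2
    rwa [mem_ofPred_eq, MvPolynomial.eval_slice] at this⟩, by fun_prop⟩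
  have hcons : ∀ τ, (γ τ : Fin 3 → ℂ) = Fin.cons ((γ τ : Fin 3 → ℂ) 0) ![1, t] := fun τ ↦ by
    rw [← hγ τ, Fin.cons_self_tail]
  have hmem : ∀ τ, (γ τ : Fin 3 → ℂ) 0 ∈ Y := fun τ ↦ by
    simp only [Y, mem_ofPred_eq]
    rw [MvPolynomial.eval_slice, ← hcons]
    exact (γ τ).2
  have hz : Continuous fun τ ↦ (γ τ : Fin 3 → ℂ) 0 :=
    (continuous_apply 0).comp (continuous_subtype_val.comp γ.continuous)
  let γ' : Path (⟨(p : Fin 3 → ℂ) 0, by simpa using hmem 0⟩ : Y) ⟨(p : Fin 3 → ℂ) 0, by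
      simpa using hmem 0⟩ := ⟨⟨fun τ ↦ ⟨(γ τ : Fin 3 → ℂ) 0, hmem τ⟩, hz.subtype_mk _⟩, by simp, by simp⟩
  have h1 : (c.comap φ).val γ' = 0 := by
    refine val_eq_zero_of_circles _ hY (fun s hs ↦ ?_) γ'
    obtain ⟨ρ, hρ, hρ'⟩ := hc t ht s (by simpa [Y] using hs)
    refine ⟨ρ, hρ, fun ε h0 hε q δ hδ ↦ hρ' ε h0 hε _ _ fun τ ↦ ?_⟩
    simp [φ, sliceCircle, hδ]
  rw [comap_val] at h1
  rw [← h1]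
  exact c.val_congr _ _ fun τ ↦ Subtype.ext (hcons τ)

lemma VanishesOnCircles.val_eq_zero_of_ne (hc : c.VanishesOnCircles D) (hF : F.IsHomogeneous d)
    (h : MvPolynomial.eval ![1, 0, 0] F ≠ 0) {y : Fin 2 → ℂ} (hy : y 0 ≠ 0) (hyD : y 1 / y 0 ∉ D)
    {p : F.nonvanishing} (γ : Path p p) (hγ : ∀ τ, Fin.tail (γ τ : Fin 3 → ℂ) = y) :
    c.val γ = 0 := by
  let g (x : I × I) : Fin 3 → ℂ := Complex.exp (-(((x.1 : ℝ) : ℂ) * Complex.log (y 0))) • (γ x.2 : Fin 3 → ℂ)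
  have hg : Continuous g := by fun_prop
  have hgY : ∀ x, g x ∈ F.nonvanishing := fun x ↦ by
    simp only [g, MvPolynomial.nonvanishing, mem_ofPred_eq]
    rw [hF.eval_smul_eq]
    exact mul_ne_zero (pow_ne_zero _ (Complex.exp_ne_zero _)) (γ x.2).2
  have hg01 : ∀ s, g (s, 0) = g (s, 1) := fun s ↦ by simp [g]
  obtain ⟨q, δ, hδ⟩ := exists_loop_of_forall_mem (g := fun τ ↦ g (1, τ)) (by fun_prop)
    (fun τ ↦ hgY _) (hg01 1)
  rw [c.val_loop_eq_of_forall_mem hg hgY hg01 γ δ (fun τ ↦ by simp [g]) hδ]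
  refine hc.val_eq_zero hF h hyD δ fun τ ↦ ?_
  rw [hδ]
  have e : Fin.tail (g (1, τ)) = (y 0)⁻¹ • Fin.tail (γ τ : Fin 3 → ℂ) := by
    ext i
    simp [g, Fin.tail, Complex.exp_neg, Complex.exp_log hy]
  rw [e, hγ]
  ext i
  fin_cases i
  · simp [hy]
  · simp [div_eq_inv_mul]

lemma VanishesOnCircles.val_eq_zero_of_fiber (hc : c.VanishesOnCircles D) (hD : D.Finite)
    (hF : F.IsHomogeneous d) (h : MvPolynomial.eval ![1, 0, 0] F ≠ 0) {y : Fin 2 → ℂ}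
    {p : F.nonvanishing} (γ : Path p p) (hγ : ∀ τ, Fin.tail (γ τ : Fin 3 → ℂ) = y) :
    c.val γ = 0 := by
  have hz : Continuous fun τ ↦ (γ τ : Fin 3 → ℂ) 0 :=
    (continuous_apply 0).comp (continuous_subtype_val.comp γ.continuous)
  have htube : ∀ᶠ y' in 𝓝 y, ∀ τ ∈ (univ : Set I),
      (Fin.cons ((γ τ : Fin 3 → ℂ) 0) y' : Fin 3 → ℂ) ∈ F.nonvanishing := by
    refine isCompact_univ.eventually_forall_of_forall_eventually fun τ _ ↦ ?_
    have hcont : Continuous fun x : (Fin 2 → ℂ) × I ↦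
      (Fin.cons ((γ x.2 : Fin 3 → ℂ) 0) x.1 : Fin 3 → ℂ) :=
      (hz.comp continuous_snd).finCons continuous_fst
    refine hcont.continuousAt.preimage_mem_nhds (F.isOpen_nonvanishing.mem_nhds ?_)
    simp only
    rw [← hγ τ, Fin.cons_self_tail]
    exact (γ τ).2
  obtain ⟨r, hr, hball⟩ := Metric.eventually_nhds_iff_ball.1 htube
  obtain ⟨a, ha0, ha⟩ : ∃ a : ℂ, a ≠ 0 ∧ a ∈ Metric.ball (y 0) r := by
    obtain ⟨a, ha, ha'⟩ := (dense_compl_singleton (0 : ℂ)).exists_mem_open Metric.isOpen_ball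
      ⟨y 0, Metric.mem_ball_self hr⟩
    exact ⟨a, ha, ha'⟩
  obtain ⟨b, hbD, hb⟩ : ∃ b : ℂ, b / a ∉ D ∧ b ∈ Metric.ball (y 1) r := by
    have hfin : ((fun b ↦ b / a) ⁻¹' D).Finite :=
      hD.preimage (fun x _ y _ hxy ↦ by simpa [ha0, div_left_inj'] using hxy)
    obtain ⟨b, hb, hb'⟩ := (hfin.countable.dense_compl ℂ).exists_mem_open Metric.isOpen_ball
      ⟨y 1, Metric.mem_ball_self hr⟩
    exact ⟨b, hb, hb'⟩
  have hy' : ![a, b] ∈ Metric.ball y r := by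
    rw [Metric.mem_ball, dist_pi_lt_iff hr]
    intro i
    fin_cases i
    · exact ha
    · exact hb
  let g (x : I × I) : Fin 3 → ℂ :=
    Fin.cons ((γ x.2 : Fin 3 → ℂ) 0) (y + (x.1 : ℝ) • (![a, b] - y))
  have hg : Continuous g := (hz.comp continuous_snd).finCons (by fun_prop)
  have hgY : ∀ x, g x ∈ F.nonvanishing := fun x ↦ by
    refine hball _ ?_ _ (mem_univ _)
    have := (convex_ball y r).add_smul_sub_mem (Metric.mem_ball_self hr) hy' x.1.2
    exact this
  have hg01 : ∀ s, g (s, 0) = g (s, 1) := fun s ↦ by simp [g]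
  obtain ⟨q, δ, hδ⟩ := exists_loop_of_forall_mem (g := fun τ ↦ g (1, τ)) (by fun_prop)
    (fun τ ↦ hgY _) (hg01 1)
  rw [c.val_loop_eq_of_forall_mem hg hgY hg01 γ δ (fun τ ↦ by
    simp only [g, Set.Icc.coe_zero, zero_smul, add_zero]
    rw [← hγ τ, Fin.cons_self_tail]) hδ]
  refine hc.val_eq_zero_of_ne hF h (y := ![a, b]) ha0 hbD δ fun τ ↦ ?_
  rw [hδ]
  simp [g]

end PathCocycle

namespace PathCocycle

variable {A : Type*} [AddCommGroup A] {F : MvPolynomial (Fin 3) ℂ} {d : ℕ} {D : Set ℂ}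
  {c : PathCocycle ↥F.nonvanishing A}

lemma _root_.MvPolynomial.exists_fiber_path (hF : F.IsHomogeneous d)
    (h : MvPolynomial.eval ![1, 0, 0] F ≠ 0) {u v : F.nonvanishing}
    (huv : Fin.tail (u : Fin 3 → ℂ) = Fin.tail (v : Fin 3 → ℂ)) :
    ∃ γ : Path u v, ∀ τ, Fin.tail (γ τ : Fin 3 → ℂ) = Fin.tail (v : Fin 3 → ℂ) := by
  set y := Fin.tail (v : Fin 3 → ℂ) with hy
  have hfin : {z : ℂ | (F.slice y).eval z = 0}.Finite := by
    refine ((F.slice y).roots.toFinset.finite_toSet).subset fun z hz ↦ ?_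
    simpa [MvPolynomial.slice_ne_zero hF h] using hz
  have hu : (Fin.cons ((u : Fin 3 → ℂ) 0) y : Fin 3 → ℂ) = u := by rw [← huv, Fin.cons_self_tail]
  have hv : (Fin.cons ((v : Fin 3 → ℂ) 0) y : Fin 3 → ℂ) = v := by rw [hy, Fin.cons_self_tail]
  have hpc := hfin.countable.isPathConnected_compl_of_one_lt_rank (by
    simp [Complex.rank_real_complex])
  have hj := hpc.joinedIn ((u : Fin 3 → ℂ) 0)
    (by rw [mem_compl_iff, mem_ofPred_eq, MvPolynomial.eval_slice, hu]; exact u.2)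
    ((v : Fin 3 → ℂ) 0)
    (by rw [mem_compl_iff, mem_ofPred_eq, MvPolynomial.eval_slice, hv]; exact v.2)
  refine ⟨⟨⟨fun τ ↦ ⟨Fin.cons (hj.somePath τ) y, ?_⟩, ?_⟩, ?_, ?_⟩, fun τ ↦ ?_⟩
  · have := hj.somePath_mem τ
    rwa [mem_compl_iff, mem_ofPred_eq, MvPolynomial.eval_slice] at this
  · exact (hj.somePath.continuous.finCons continuous_const).subtype_mk _
  · exact Subtype.ext (by simpa using hu)
  · exact Subtype.ext (by simpa using hv)
  · rfl

theorem VanishesOnCircles.val_loop_eq_zero (hc : c.VanishesOnCircles D) (hD : D.Finite)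
    (hF : F.IsHomogeneous d) (h : MvPolynomial.eval ![1, 0, 0] F ≠ 0)
    {p : F.nonvanishing} (γ : Path p p) : c.val γ = 0 := by
  obtain ⟨B, hB, hroot⟩ := MvPolynomial.exists_root_bound hF h
  let R (y : Fin 2 → ℂ) : ℂ := ((B * ‖y‖ + 1 : ℝ) : ℂ)
  have hR : Continuous R := by fun_prop
  have hRmem : ∀ y, (Fin.cons (R y) y : Fin 3 → ℂ) ∈ F.nonvanishing := fun y ↦ by
    simp only [MvPolynomial.nonvanishing, mem_ofPred_eq]
    rw [← MvPolynomial.eval_slice]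
    intro h0
    have h1 := hroot y _ h0
    rw [Complex.norm_real, Real.norm_of_nonneg (by positivity)] at h1
    linarith
  let ψ : C(Fin 2 → ℂ, F.nonvanishing) := ⟨fun y ↦ ⟨Fin.cons (R y) y, hRmem y⟩,
    Continuous.subtype_mk (hR.finCons (continuous_id (X := Fin 2 → ℂ))) hRmem⟩
  let π (v : F.nonvanishing) : Fin 2 → ℂ := Fin.tail (v : Fin 3 → ℂ)
  have hπ : Continuous π := continuous_pi fun i ↦
    (continuous_apply i.succ).comp continuous_subtype_val
  have hπψ : ∀ y, π (ψ y) = y := fun y ↦ by simp [π, ψ]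
  obtain ⟨Ψ, hΨ⟩ := (c.comap ψ).exists_primitive_of_simplyConnected
  have hfib : ∀ v : F.nonvanishing, ∃ γ : Path (ψ (π v)) v,
      ∀ τ, Fin.tail (γ τ : Fin 3 → ℂ) = π v := fun v ↦ MvPolynomial.exists_fiber_path hF h (hπψ _)
  choose fp hfp using hfib
  have huniq : ∀ {u v : F.nonvanishing} (γ δ : Path u v) (y : Fin 2 → ℂ),
      (∀ τ, Fin.tail (γ τ : Fin 3 → ℂ) = y) → (∀ τ, Fin.tail (δ τ : Fin 3 → ℂ) = y) →
      c.val γ = c.val δ := by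
    intro u v γ δ y hγ hδ
    have := hc.val_eq_zero_of_fiber hD hF h (γ.trans δ.symm) (y := y) (fun τ ↦ by
      have hmem : (γ.trans δ.symm) τ ∈ range γ ∪ range δ := by
        rw [← Path.symm_range δ, ← Path.trans_range]; exact ⟨τ, rfl⟩
      rcases hmem with ⟨s, hs⟩ | ⟨s, hs⟩
      · rw [← hs, hγ]
      · rw [← hs, hδ])
    rwa [c.val_trans, c.val_symm, ← sub_eq_add_neg, sub_eq_zero] at this
  let Φ (v : F.nonvanishing) : A := Ψ (π v) + c.val (fp v)
  have hprim : c.IsLocalPrimitive Φ univ := by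
    intro v₀ _
    let G (v : F.nonvanishing) (τ : I) : Fin 3 → ℂ :=
      Fin.cons ((fp v₀ τ : Fin 3 → ℂ) 0 + (1 - (τ : ℝ)) * (R (π v) - R (π v₀)) +
        (τ : ℝ) * ((v : Fin 3 → ℂ) 0 - (v₀ : Fin 3 → ℂ) 0)) (π v)
    have hG : Continuous fun x : F.nonvanishing × I ↦ G x.1 x.2 := by
      have h1 : Continuous fun τ ↦ (fp v₀ τ : Fin 3 → ℂ) 0 :=
        (continuous_apply 0).comp (continuous_subtype_val.comp (fp v₀).continuous)
      have h2 : Continuous fun v : F.nonvanishing ↦ (v : Fin 3 → ℂ) 0 :=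
        (continuous_apply 0).comp continuous_subtype_val
      refine Continuous.finCons ?_ (hπ.comp continuous_fst)
      refine ((h1.comp continuous_snd).add (.mul (by fun_prop) ?_)).add (.mul (by fun_prop) ?_)
      · exact (hR.comp (hπ.comp continuous_fst)).sub continuous_const
      · exact (h2.comp continuous_fst).sub continuous_const
    have hG0 : ∀ v, G v 0 = ψ (π v) := fun v ↦ by
      simp [G, ψ]
    have hG1 : ∀ v, G v 1 = v := fun v ↦ by
      simp [G, π]
    have htube : ∀ᶠ v in 𝓝 v₀, ∀ τ ∈ (univ : Set I), G v τ ∈ F.nonvanishing := by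
      refine isCompact_univ.eventually_forall_of_forall_eventually fun τ _ ↦ ?_
      refine hG.continuousAt.preimage_mem_nhds (F.isOpen_nonvanishing.mem_nhds ?_)
      have : G v₀ τ = fp v₀ τ := by
        simp only [G, sub_self, mul_zero, add_zero]
        have := Fin.cons_self_tail (fp v₀ τ : Fin 3 → ℂ)
        rwa [hfp v₀ τ] at this
      simp only [this]
      exact (fp v₀ τ).2
    refine ⟨_, htube, fun {p q} γ hγ ↦ ?_⟩
    have hmem : ∀ s τ, G (γ s) τ ∈ F.nonvanishing := fun s τ ↦ hγ ⟨s, rfl⟩ τ (mem_univ _)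
    let H : C(I × I, F.nonvanishing) := ⟨fun x ↦ ⟨G (γ x.1) x.2, hmem _ _⟩,
      (hG.comp ((γ.continuous.comp continuous_fst).prodMk continuous_snd)).subtype_mk _⟩
    let γ₀ : Path (ψ (π p)) p := ⟨H.comp ⟨fun τ ↦ (0, τ), by fun_prop⟩,
      Subtype.ext (by simpa [H] using hG0 p), Subtype.ext (by simpa [H] using hG1 p)⟩
    let γ₁ : Path (ψ (π q)) q := ⟨H.comp ⟨fun τ ↦ (1, τ), by fun_prop⟩,
      Subtype.ext (by simpa [H] using hG0 q), Subtype.ext (by simpa [H] using hG1 q)⟩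
    have hsq := c.val_square H γ₀ γ₁ ((γ.map hπ).map ψ.continuous) γ (fun _ ↦ rfl) (fun _ ↦ rfl)
      (fun s ↦ Subtype.ext (hG0 _)) (fun s ↦ Subtype.ext (hG1 _))
    have e0 : c.val γ₀ = c.val (fp p) := huniq _ _ (π p) (fun τ ↦ by simp [γ₀, H, G]) (hfp p)
    have e1 : c.val γ₁ = c.val (fp q) := huniq _ _ (π q) (fun τ ↦ by simp [γ₁, H, G]) (hfp q)
    rw [← comap_val, hΨ, e0, e1] at hsq
    simp only [Φ]
    rw [eq_sub_iff_add_eq'.2 hsq]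
    abel
  rw [hprim.val_eq γ (subset_univ _), sub_self]

end PathCocycle

lemma norm_exp_two_pi_I_mul (τ : ℝ) : ‖Complex.exp (2 * Real.pi * Complex.I * τ)‖ = 1 := by
  have : (2 * Real.pi * Complex.I * τ : ℂ) = ((2 * Real.pi * τ : ℝ) : ℂ) * Complex.I := by
    push_cast; ring
  rw [this, Complex.norm_exp_ofReal_mul_I]

namespace PathCocycle

variable {A : Type*} [AddCommGroup A] {F : MvPolynomial (Fin 3) ℂ} {d : ℕ} {D : Set ℂ}
  {c : PathCocycle ↥F.nonvanishing A}

variable (c) in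
/-- `c` takes the value `a` on all sufficiently small circles around `(w, 1, t)`. -/
def IsMeridianValue (t w : ℂ) (a : A) : Prop :=
  ∀ᶠ ε in 𝓝[≠] (0 : ℂ), ∃ (p : F.nonvanishing) (γ : Path p p),
    (∀ τ, (γ τ : Fin 3 → ℂ) = sliceCircle t w ε τ) ∧ c.val γ = a

lemma IsMeridianValue.unique {t w : ℂ} {a b : A} (ha : c.IsMeridianValue t w a)
    (hb : c.IsMeridianValue t w b) : a = b := by
  obtain ⟨ε, ⟨p, γ, hγ, rfl⟩, ⟨q, δ, hδ, rfl⟩⟩ := (ha.and hb).exists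
  exact c.val_congr γ δ fun τ ↦ Subtype.ext ((hγ τ).trans (hδ τ).symm)

lemma exists_isMeridianValue_eventually (c : PathCocycle ↥F.nonvanishing A) {t₀ w₀ : ℂ}
    (h0 : (F.slice ![1, t₀]).eval w₀ = 0) (h1 : (F.slice ![1, t₀]).derivative.eval w₀ ≠ 0) :
    ∃ a, ∀ᶠ x : ℂ × ℂ in 𝓝 (t₀, w₀), (F.slice ![1, x.1]).eval x.2 = 0 →
      c.IsMeridianValue x.1 x.2 a := by
  obtain ⟨φ, hφ0, hφd, hφ⟩ := MvPolynomial.exists_local_root h0 h1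
  obtain ⟨r, hr, hball⟩ := Metric.eventually_nhds_iff_ball.1 hφ
  have hφc : ∀ᶠ t in 𝓝 t₀, dist (φ t) w₀ < r / 4 := by
    have := hφd.self_of_nhds.continuousAt.tendsto
    rw [hφ0] at this
    exact this.eventually (Metric.ball_mem_nhds w₀ (by positivity))
  obtain ⟨δ', hδ', hδ'b⟩ := Metric.eventually_nhds_iff_ball.1 hφc
  set δ := min δ' r with hδ
  have hδ0 : 0 < δ := lt_min hδ' hr
  have hmem : ∀ t z, t ∈ Metric.ball t₀ δ → dist z w₀ < r → z ≠ φ t →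
      (Fin.cons z ![1, t] : Fin 3 → ℂ) ∈ F.nonvanishing := by
    intro t z ht hz hzt h
    rw [← MvPolynomial.eval_slice] at h
    refine hzt ((hball (t, z) ?_).1 h)
    rw [← ball_prod_same]
    exact ⟨Metric.ball_subset_ball (min_le_right _ _) ht, hz⟩
  have hroot : ∀ t ∈ Metric.ball t₀ δ, ‖φ t - w₀‖ < r / 4 := fun t ht ↦ by
    rw [← dist_eq_norm]; exact hδ'b t (Metric.ball_subset_ball (min_le_left _ _) ht)
  have hcirc : ∀ t ∈ Metric.ball t₀ δ, ∀ w : ℂ, ‖w - w₀‖ < r / 4 → ∀ ε : ℂ, ‖ε‖ ≤ r / 2 →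
      (w = φ t ∧ ε ≠ 0 ∨ ‖ε‖ = r / 2) → ∀ τ, sliceCircle t w ε τ ∈ F.nonvanishing := by
    intro t ht w hw ε hε hor τ
    set e := ε * Complex.exp (2 * Real.pi * Complex.I * (τ : ℝ)) with he
    have hen : ‖e‖ = ‖ε‖ := by rw [he, norm_mul, norm_exp_two_pi_I_mul, mul_one]
    refine hmem t _ ht ?_ ?_
    · rw [dist_eq_norm]
      calc ‖w + e - w₀‖ = ‖(w - w₀) + e‖ := by ring_nf
        _ ≤ ‖w - w₀‖ + ‖e‖ := norm_add_le _ _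
        _ < r := by linarith
    · intro heq
      have h2 : e = (φ t - w₀) - (w - w₀) := by rw [← heq]; ring
      rcases hor with ⟨hwt, hε0⟩ | hεr
      · rw [hwt, sub_self, ← norm_eq_zero, hen, norm_eq_zero] at h2
        exact hε0 h2
      · have := norm_sub_le (φ t - w₀) (w - w₀)
        rw [← h2, hen, hεr] at this
        have := hroot t ht
        linarith
  have hr2 : ‖((r / 2 : ℝ) : ℂ)‖ = r / 2 := by
    rw [Complex.norm_real, Real.norm_of_nonneg (by positivity)]
  obtain ⟨p₀, γ₀, hγ₀⟩ := exists_loop_of_forall_mem (Y := F.nonvanishing)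
    (g := fun τ ↦ sliceCircle t₀ w₀ ((r / 2 : ℝ) : ℂ) τ) (by fun_prop)
    (hcirc t₀ (Metric.mem_ball_self hδ0) w₀ (by simpa using by positivity) _ hr2.le (.inr hr2))
    (sliceCircle_zero _ _ _)
  refine ⟨c.val γ₀, ?_⟩
  filter_upwards [Metric.ball_mem_nhds (t₀, w₀) (lt_min hδ0 (by positivity : 0 < r / 4))]
    with ⟨t, w⟩ hx hxr
  rw [← ball_prod_same] at hx
  have ht : t ∈ Metric.ball t₀ δ := Metric.ball_subset_ball (min_le_left _ _) hx.1
  have hw : ‖w - w₀‖ < r / 4 := by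
    rw [← dist_eq_norm]; exact Metric.ball_subset_ball (min_le_right _ _) hx.2
  have hwt : w = φ t := by
    refine (hball (t, w) ?_).1 hxr
    rw [← ball_prod_same]
    refine ⟨Metric.ball_subset_ball (min_le_right _ _) ht, ?_⟩
    rw [Metric.mem_ball, dist_eq_norm]
    linarith
  have hsmall : ∀ᶠ ε in 𝓝[≠] (0 : ℂ), ‖ε‖ < r / 2 := nhdsWithin_le_nhds (by
    have := Metric.ball_mem_nhds (0 : ℂ) (by positivity : 0 < r / 2)
    simpa [Metric.ball, dist_eq_norm] using this)
  filter_upwards [hsmall, self_mem_nhdsWithin] with ε hε hε0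
  obtain ⟨p, γ, hγ⟩ := exists_loop_of_forall_mem (Y := F.nonvanishing)
    (g := fun τ ↦ sliceCircle t w ε τ) (by fun_prop)
    (hcirc t ht w hw ε hε.le (.inl ⟨hwt, hε0⟩)) (sliceCircle_zero _ _ _)
  obtain ⟨q, η, hη⟩ := exists_loop_of_forall_mem (Y := F.nonvanishing)
    (g := fun τ ↦ sliceCircle t w ((r / 2 : ℝ) : ℂ) τ) (by fun_prop)
    (hcirc t ht w hw _ hr2.le (.inr hr2)) (sliceCircle_zero _ _ _)
  refine ⟨p, γ, hγ, ?_⟩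
  have hε0' : ε ≠ 0 := hε0
  have hr0 : ((r / 2 : ℝ) : ℂ) ≠ 0 := by exact_mod_cast (by positivity : r / 2 ≠ 0)
  rw [c.val_loop_eq_of_forall_mem (g := fun x ↦ sliceCircle t w
      (Complex.exp (Complex.log ε + ((x.1 : ℝ) : ℂ) * (Complex.log ((r / 2 : ℝ) : ℂ) - Complex.log ε))) x.2)
      (by fun_prop) (fun x ↦ hcirc t ht w hw _ ?_ (.inl ⟨hwt, Complex.exp_ne_zero _⟩) _)
      (fun s ↦ sliceCircle_zero _ _ _) γ η (fun τ ↦ by simp [Complex.exp_log hε0', hγ])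
      (fun τ ↦ by
        rw [hη]
        simp only [Set.Icc.coe_one, Complex.ofReal_one, one_mul, add_sub_cancel]
        rw [Complex.exp_log hr0]),
    c.val_loop_eq_of_forall_mem (g := fun x ↦ sliceCircle (t + ((x.1 : ℝ) : ℂ) * (t₀ - t))
      (w + ((x.1 : ℝ) : ℂ) * (w₀ - w)) ((r / 2 : ℝ) : ℂ) x.2) (by fun_prop)
      (fun x ↦ hcirc _ ?_ _ ?_ _ hr2.le (.inr hr2) _) (fun s ↦ sliceCircle_zero _ _ _) η γ₀
      (fun τ ↦ by simp [hη]) (fun τ ↦ by rw [hγ₀]; simp)]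
  · have := (convex_ball t₀ δ).add_smul_sub_mem ht (Metric.mem_ball_self hδ0) x.1.2
    simpa using this
  · have := (convex_ball w₀ (r / 4)).add_smul_sub_mem (by simpa [dist_eq_norm] using hw : w ∈ _)
      (Metric.mem_ball_self (by positivity)) x.1.2
    simpa [dist_eq_norm] using this
  · rw [Complex.norm_exp]
    rw [← Real.le_log_iff_exp_le (by positivity)]
    have hl : Real.log ‖ε‖ ≤ Real.log (r / 2) :=
      Real.log_le_log (norm_pos_iff.2 hε0') hε.le
    have e : (Complex.log ε + ((x.1 : ℝ) : ℂ) * (Complex.log ((r / 2 : ℝ) : ℂ) - Complex.log ε)).re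
        = Real.log ‖ε‖ + (x.1 : ℝ) * (Real.log (r / 2) - Real.log ‖ε‖) := by
      rw [Complex.add_re, Complex.re_ofReal_mul, Complex.sub_re, Complex.log_re, Complex.log_re, hr2]
    rw [e]
    nlinarith [x.1.2.1, x.1.2.2]

end PathCocycle

namespace MvPolynomial

variable {F G : MvPolynomial (Fin 3) ℂ} {d : ℕ} {D : Set ℂ}

lemma slice_simple_root_of_mul {H : MvPolynomial (Fin 3) ℂ} (hFG : F = G * H) {y : Fin 2 → ℂ} {z : ℂ}
    (hF : (F.slice y).derivative.eval z ≠ 0) (hG : (G.slice y).eval z = 0) :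
    (G.slice y).derivative.eval z ≠ 0 ∧ (H.slice y).eval z ≠ 0 := by
  rw [hFG, slice_mul, Polynomial.derivative_mul, Polynomial.eval_add, Polynomial.eval_mul,
    Polynomial.eval_mul, hG, zero_mul, add_zero] at hF
  exact mul_ne_zero_iff.1 hF

lemma sliceRoots_nonempty (hG : G.IsHomogeneous d) (hd : 1 ≤ d) (h : eval ![1, 0, 0] G ≠ 0) (t : ℂ) :
    ∃ w, w ∈ G.sliceRoots t := by
  obtain ⟨w, hw⟩ := IsAlgClosed.exists_root (G.slice ![1, t]) (by
    rw [Polynomial.degree_eq_natDegree (slice_ne_zero hG h _), natDegree_slice hG h]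
    exact_mod_cast (by omega : d ≠ 0))
  exact ⟨w, (mem_sliceRoots hG h).2 hw⟩

/-- A cocycle takes the same value on all meridians of an irreducible component. -/
lemma exists_isMeridianValue {A : Type*} [AddCommGroup A] (c : PathCocycle ↥F.nonvanishing A)
    (hs : ∀ t ∉ D, ∀ z, (F.slice ![1, t]).eval z = 0 → (F.slice ![1, t]).derivative.eval z ≠ 0)
    (hD : D.Finite) {H : MvPolynomial (Fin 3) ℂ} (hFG : F = G * H) (hG : G.IsHomogeneous d)
    (hd : 1 ≤ d) (hirr : Irreducible G) (h : eval ![1, 0, 0] G ≠ 0) :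
    ∃ a, ∀ t ∉ D, ∀ w, (G.slice ![1, t]).eval w = 0 → c.IsMeridianValue t w a := by
  have hroot : ∀ {y z}, (G.slice y).eval z = 0 → (F.slice y).eval z = 0 := fun h0 ↦ by
    rw [hFG, slice_mul, Polynomial.eval_mul, h0, zero_mul]
  have hsG : ∀ t ∉ D, ∀ z, (G.slice ![1, t]).eval z = 0 →
      (G.slice ![1, t]).derivative.eval z ≠ 0 := fun t ht z hz ↦
    (slice_simple_root_of_mul hFG (hs t ht z (hroot hz)) hz).1
  obtain ⟨t₁, ht₁⟩ := hD.infinite_compl.nonempty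
  obtain ⟨w₁, hw₁⟩ := sliceRoots_nonempty hG hd h t₁
  have hw₁' := hroot ((mem_sliceRoots hG h).1 hw₁)
  obtain ⟨a, ha⟩ := PathCocycle.exists_isMeridianValue_eventually c hw₁' (hs _ ht₁ _ hw₁')
  refine ⟨a, ?_⟩
  have hloc : ∀ t₀ ∉ D, ∀ w₀ ∈ G.sliceRoots t₀, ∀ᶠ x : ℂ × ℂ in 𝓝 (t₀, w₀),
      x.2 ∈ G.sliceRoots x.1 → (c.IsMeridianValue x.1 x.2 a ↔ c.IsMeridianValue t₀ w₀ a) := by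
    intro t₀ ht₀ w₀ hw₀
    have hw₀' := hroot ((mem_sliceRoots hG h).1 hw₀)
    obtain ⟨b, hb⟩ := PathCocycle.exists_isMeridianValue_eventually c hw₀' (hs _ ht₀ _ hw₀')
    have hb0 := hb.self_of_nhds hw₀'
    filter_upwards [hb] with x hx hxG
    have hx' := hx (hroot ((mem_sliceRoots hG h).1 hxG))
    constructor
    · intro hxa
      rw [hxa.unique hx']
      exact hb0
    · intro h0
      rw [h0.unique hb0]
      exact hx'
  rcases forall_or_forall_of_locally_constant (T := fun t w ↦ c.IsMeridianValue t w a) hG h hirr hD hsG hloc with hT | hT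
  · exact fun t ht w hw ↦ hT t ht w ((mem_sliceRoots hG h).2 hw)
  · exact absurd (ha.self_of_nhds hw₁') (hT t₁ ht₁ w₁ hw₁)

end MvPolynomial

namespace PathCocycle

open MvPolynomial in
lemma isMeridianValue_winding {F P : MvPolynomial (Fin 3) ℂ} {t w : ℂ} (hF : F.slice ![1, t] ≠ 0)
    (g : C(F.nonvanishing, ℂ)) (hg : ∀ v, g v ≠ 0) (hgP : ∀ v, g v = eval (v : Fin 3 → ℂ) P)
    {q : Polynomial ℂ} {k : ℕ} (hP : P.slice ![1, t] = (Polynomial.X - Polynomial.C w) ^ k * q)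
    (hq : q.eval w ≠ 0) : (winding g hg).IsMeridianValue t w (k : ℤ) := by
  have h1 : ∀ᶠ z in 𝓝 w, q.eval z / q.eval w ∈ Complex.slitPlane := by
    have hc : Continuous fun z ↦ q.eval z / q.eval w := by fun_prop
    refine hc.continuousAt.preimage_mem_nhds (Complex.isOpen_slitPlane.mem_nhds ?_)
    simp [hq]
  have h2 : ∀ᶠ z in 𝓝 w, z ≠ w → (F.slice ![1, t]).eval z ≠ 0 := by
    have hfin : {z : ℂ | (F.slice ![1, t]).eval z = 0 ∧ z ≠ w}.Finite := by
      refine ((F.slice ![1, t]).roots.toFinset.finite_toSet).subset fun z hz ↦ ?_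
      simpa [hF] using hz.1
    filter_upwards [hfin.isClosed.isOpen_compl.mem_nhds (by simp : w ∈ _)] with z hz hzw h0
    exact hz ⟨h0, hzw⟩
  obtain ⟨ρ, hρ, hball⟩ := Metric.eventually_nhds_iff_ball.1 (h1.and h2)
  have hsmall : ∀ᶠ ε in 𝓝[≠] (0 : ℂ), ‖ε‖ < ρ := nhdsWithin_le_nhds (by
    have := Metric.ball_mem_nhds (0 : ℂ) hρ
    simpa [Metric.ball, dist_eq_norm] using this)
  filter_upwards [hsmall, self_mem_nhdsWithin] with ε hε hε0
  have hε0' : ε ≠ 0 := hε0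
  have hb : ∀ τ : I, w + ε * Complex.exp (2 * Real.pi * Complex.I * (τ : ℝ)) ∈ Metric.ball w ρ := by
    intro τ
    rw [Metric.mem_ball, dist_eq_norm, add_sub_cancel_left, norm_mul, norm_exp_two_pi_I_mul, mul_one]
    exact hε
  obtain ⟨p, γ, hγ⟩ := exists_loop_of_forall_mem (Y := F.nonvanishing)
    (g := fun τ ↦ sliceCircle t w ε τ) (by fun_prop) (fun τ ↦ by
      have := (hball _ (hb τ)).2 (by simpa using hε0')
      rwa [eval_slice] at this) (sliceCircle_zero _ _ _)
  refine ⟨p, γ, hγ, winding_val_eq g hg γ (l := fun τ ↦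
    k * (Complex.log ε + 2 * Real.pi * Complex.I * (τ : ℝ)) + (Complex.log (q.eval w) + Complex.log
      (q.eval (w + ε * Complex.exp (2 * Real.pi * Complex.I * (τ : ℝ))) / q.eval w)))
      ?_ (fun τ ↦ ?_) ?_⟩
  · refine (by fun_prop : Continuous _).add (continuous_const.add ?_)
    refine Continuous.clog (by fun_prop) fun τ ↦ (hball _ (hb τ)).1
  · rw [hgP, hγ, sliceCircle, ← eval_slice, hP, Complex.exp_add, Complex.exp_nat_mul,
      Complex.exp_add, Complex.exp_log hε0', Complex.exp_add, Complex.exp_log hq, Complex.exp_log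
        (Complex.slitPlane_ne_zero (hball _ (hb τ)).1)]
    simp only [Polynomial.eval_mul, Polynomial.eval_pow, Polynomial.eval_sub,
      Polynomial.eval_X, Polynomial.eval_C, add_sub_cancel_left]
    rw [mul_div_cancel₀ _ hq]
  · simp
    ring

section Main

variable {r : ℕ} (fs : Fin r → MvPolynomial (Fin 3) ℂ)

/-- The map defined by one of the factors of a product, on the set where the product does not
vanish. -/
noncomputable def factorMap (i : Fin r) : C((∏ i, fs i).nonvanishing, ℂ) :=
  ⟨fun v ↦ MvPolynomial.eval (v : Fin 3 → ℂ) (fs i),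
    (MvPolynomial.continuous_eval _).comp continuous_subtype_val⟩

lemma factorMap_ne_zero (i : Fin r) (v : (∏ i, fs i).nonvanishing) : factorMap fs i v ≠ 0 := by
  have := v.2
  simp only [MvPolynomial.nonvanishing, mem_ofPred_eq, map_prod, Finset.prod_ne_zero_iff] at this
  exact this i (Finset.mem_univ _)

/-- The winding number of a factor. -/
noncomputable def factorWinding (i : Fin r) : PathCocycle ↥(∏ i, fs i).nonvanishing ℤ :=
  winding (factorMap fs i) (factorMap_ne_zero fs i)

variable {A : Type*} [AddCommGroup A]

/-- The difference of a cocycle and an integral combination of winding numbers. -/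
noncomputable def subWinding (c : PathCocycle ↥(∏ i, fs i).nonvanishing A) (a : Fin r → A) :
    PathCocycle ↥(∏ i, fs i).nonvanishing A where
  val γ := c.val γ - ∑ i, (factorWinding fs i).val γ • a i
  val_trans γ δ := by
    simp only [val_trans, add_smul, Finset.sum_add_distrib]
    abel
  val_homotopic h := by
    rw [c.val_homotopic h]
    simp only [val_homotopic _ h]

variable {fs} {dg : Fin r → ℕ}

open MvPolynomial in
lemma isMeridianValue_factorWinding (hhom : ∀ i, (fs i).IsHomogeneous (dg i))
    (h : ∀ i, eval ![1, 0, 0] (fs i) ≠ 0) {t w : ℂ} {i : Fin r}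
    (hw : ((fs i).slice ![1, t]).eval w = 0)
    (hs : ((∏ i, fs i).slice ![1, t]).derivative.eval w ≠ 0) (j : Fin r) :
    (factorWinding fs j).IsMeridianValue t w (if j = i then 1 else 0) := by
  classical
  have hF : (∏ i, fs i).slice ![1, t] ≠ 0 := slice_ne_zero (IsHomogeneous.prod _ _ _ fun i _ ↦ hhom i)
    (by rw [map_prod]; exact Finset.prod_ne_zero_iff.2 fun i _ ↦ h i) _
  have hsi := slice_simple_root_of_mul (Finset.mul_prod_erase _ fs (Finset.mem_univ i)).symm hs hw
  split_ifs with hji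
  · subst hji
    obtain ⟨q, hq⟩ := Polynomial.dvd_iff_isRoot.2 hw
    have := isMeridianValue_winding hF (factorMap fs j) (factorMap_ne_zero fs j) (P := fs j)
      (k := 1) (q := q) (w := w) (fun _ ↦ rfl) (by rw [hq, pow_one]) (fun h0 ↦ hsi.1 (by
        rw [hq, Polynomial.derivative_mul]
        simp [h0]))
    exact this
  · have := isMeridianValue_winding hF (factorMap fs j) (factorMap_ne_zero fs j) (P := fs j)
      (k := 0) (q := (fs j).slice ![1, t]) (w := w) (fun _ ↦ rfl) (by rw [pow_zero, one_mul])
      (fun h0 ↦ hsi.2 (by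
        rw [← Finset.mul_prod_erase (Finset.univ.erase i) fs
          (Finset.mem_erase.2 ⟨hji, Finset.mem_univ j⟩), slice_mul, Polynomial.eval_mul, h0, zero_mul]))
    exact this

lemma isMeridianValue_subWinding {c : PathCocycle ↥(∏ i, fs i).nonvanishing A} {a : Fin r → A}
    {t w : ℂ} {b : A} {n : Fin r → ℤ} (hb : c.IsMeridianValue t w b)
    (hn : ∀ i, (factorWinding fs i).IsMeridianValue t w (n i)) :
    (subWinding fs c a).IsMeridianValue t w (b - ∑ i, n i • a i) := by
  filter_upwards [hb, eventually_all.2 hn] with ε ⟨p, γ, hγ, h1⟩ h2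
  refine ⟨p, γ, hγ, ?_⟩
  have : ∀ i, (factorWinding fs i).val γ = n i := fun i ↦ by
    obtain ⟨q, δ, hδ, h3⟩ := h2 i
    rw [← h3]
    exact val_congr _ _ _ fun τ ↦ Subtype.ext ((hγ τ).trans (hδ τ).symm)
  simp only [subWinding, h1, this]

lemma IsMeridianValue.exists_radius {F : MvPolynomial (Fin 3) ℂ} {c : PathCocycle ↥F.nonvanishing A}
    {t w : ℂ} {a : A} (h : c.IsMeridianValue t w a) : ∃ ρ > 0, ∀ ε : ℂ, ε ≠ 0 → ‖ε‖ < ρ →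
    ∀ (p : F.nonvanishing) (γ : Path p p), (∀ τ, (γ τ : Fin 3 → ℂ) = sliceCircle t w ε τ) →
      c.val γ = a := by
  rw [IsMeridianValue, eventually_nhdsWithin_iff, Metric.eventually_nhds_iff_ball] at h
  obtain ⟨ρ, hρ, h⟩ := h
  refine ⟨ρ, hρ, fun ε h0 hε p γ hγ ↦ ?_⟩
  obtain ⟨q, δ, hδ, rfl⟩ := h ε (by simpa [dist_eq_norm] using hε) h0
  exact val_congr _ _ _ fun τ ↦ Subtype.ext ((hγ τ).trans (hδ τ).symm)

end Main

end PathCocycle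

namespace MvPolynomial

lemma isPathConnected_nonvanishing {ι : Type*} [Finite ι] {F : MvPolynomial ι ℂ} (hF : F ≠ 0) :
    IsPathConnected F.nonvanishing := by
  rw [isPathConnected_iff]
  constructor
  · by_contra hne
    refine hF (MvPolynomial.funext fun v ↦ ?_)
    by_contra hv
    exact hne ⟨v, by simpa using hv⟩
  · intro u hu v hv
    let p : Polynomial ℂ := aeval (fun i ↦ Polynomial.C (u i) + Polynomial.X * Polynomial.C (v i - u i)) F
    have hp : ∀ s : ℂ, p.eval s = eval (fun i ↦ u i + s * (v i - u i)) F := fun s ↦ by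
      have := MvPolynomial.map_aeval (fun i ↦ Polynomial.C (u i) + Polynomial.X * Polynomial.C (v i - u i))
        (Polynomial.evalRingHom s) F
      rw [← Polynomial.coe_evalRingHom, this, MvPolynomial.coe_eval₂Hom]
      simp only [map_add, map_mul, Polynomial.coe_evalRingHom, Polynomial.eval_C, Polynomial.eval_X]
      rw [eval, coe_eval₂Hom]
      congr 1
      ext z
      simp
    have h0 : p.eval 0 ≠ 0 := by simpa only [hp, zero_mul, add_zero, mem_nonvanishing] using hu
    have h1 : p.eval 1 ≠ 0 := by simpa only [hp, one_mul, add_sub_cancel, mem_nonvanishing] using hv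
    have hp0 : p ≠ 0 := fun h ↦ h0 (by simp [h])
    have hfin : {z : ℂ | p.eval z = 0}.Finite := by
      refine (p.roots.toFinset.finite_toSet).subset fun z hz ↦ ?_
      simpa [hp0] using hz
    have hpc := hfin.countable.isPathConnected_compl_of_one_lt_rank (by
      simp [Complex.rank_real_complex])
    have hj := hpc.joinedIn 0 h0 1 h1
    refine ⟨⟨⟨fun τ i ↦ u i + hj.somePath τ * (v i - u i), by fun_prop⟩, by simp, by simp⟩,
      fun τ ↦ ?_⟩
    have := hj.somePath_mem τ
    rw [mem_compl_iff, mem_ofPred_eq, hp] at this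
    exact this

end MvPolynomial

namespace PathCocycle

open MvPolynomial

variable {r : ℕ}

/-- The first homology of the complement of the affine cone `∏ fs = 0` is freely generated by
classes dual to the winding numbers of the factors `fs`. -/
def HasMeridianBasis (fs : Fin r → MvPolynomial (Fin 3) ℂ) : Prop :=
  (∀ {A : Type} [AddCommGroup A] (c : PathCocycle ↥(∏ i, fs i).nonvanishing A),
    ∃ a : Fin r → A, ∀ {p : ↥(∏ i, fs i).nonvanishing} (γ : Path p p),
      c.val γ = ∑ i, (factorWinding fs i).val γ • a i) ∧
  ∀ i, ∃ (p : ↥(∏ i, fs i).nonvanishing) (γ : Path p p), ∀ j,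
    (factorWinding fs j).val γ = if j = i then 1 else 0

variable {fs : Fin r → MvPolynomial (Fin 3) ℂ} {dg : Fin r → ℕ}

theorem hasMeridianBasis_of_eval_ne_zero (hsf : Squarefree (∏ i, fs i))
    (hirr : ∀ i, Irreducible (fs i)) (hhom : ∀ i, (fs i).IsHomogeneous (dg i))
    (hdeg : ∀ i, 1 ≤ dg i) (h : ∀ i, eval ![1, 0, 0] (fs i) ≠ 0) : HasMeridianBasis fs := by
  classical
  have hF : (∏ i, fs i).IsHomogeneous (∑ i, dg i) := IsHomogeneous.prod _ _ _ fun i _ ↦ hhom i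
  have hF0 : eval ![1, 0, 0] (∏ i, fs i) ≠ 0 := by
    rw [map_prod]; exact Finset.prod_ne_zero_iff.2 fun i _ ↦ h i
  obtain ⟨D, hD, hs⟩ := exists_finite_simple_roots hF hF0 hsf
  have hroot : ∀ {y z} i, ((fs i).slice y).eval z = 0 → ((∏ i, fs i).slice y).eval z = 0 := by
    intro y z i h0
    rw [← Finset.mul_prod_erase _ fs (Finset.mem_univ i), slice_mul, Polynomial.eval_mul, h0, zero_mul]
  constructor
  · intro A _ c
    choose a ha using fun i ↦ exists_isMeridianValue c hs hD
      (Finset.mul_prod_erase _ fs (Finset.mem_univ i)).symm (hhom i) (hdeg i) (hirr i) (h i)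
    refine ⟨a, fun {p} γ ↦ ?_⟩
    have hc : (subWinding fs c a).VanishesOnCircles D := by
      intro t ht w hw
      obtain ⟨i, hi⟩ : ∃ i, ((fs i).slice ![1, t]).eval w = 0 := by
        rw [eval_slice, map_prod, Finset.prod_eq_zero_iff] at hw
        obtain ⟨i, -, hi⟩ := hw
        exact ⟨i, by rwa [eval_slice]⟩
      have := isMeridianValue_subWinding (a := a) (ha i t ht w hi)
        (isMeridianValue_factorWinding hhom h hi (hs t ht w hw))
      simpa using this.exists_radius
    have := hc.val_loop_eq_zero hD hF hF0 γ
    exact sub_eq_zero.1 this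
  · intro i
    obtain ⟨t, ht⟩ := hD.infinite_compl.nonempty
    obtain ⟨w, hw⟩ := sliceRoots_nonempty (hhom i) (hdeg i) (h i) t
    have hw := (mem_sliceRoots (hhom i) (h i)).1 hw
    have hW := isMeridianValue_factorWinding hhom h hw (hs t ht w (hroot i hw))
    obtain ⟨ε, hε⟩ := (eventually_all.2 hW).exists
    obtain ⟨p, γ, hγ, h1⟩ := hε i
    refine ⟨p, γ, fun j ↦ ?_⟩
    obtain ⟨q, δ, hδ, h2⟩ := hε j
    rw [← h2]
    exact val_congr _ _ _ fun τ ↦ Subtype.ext ((hγ τ).trans (hδ τ).symm)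

lemma winding_val_eq_winding {X Y : Type*} [TopologicalSpace X] [TopologicalSpace Y]
    (g : C(X, ℂ)) (hg : ∀ x, g x ≠ 0) (g' : C(Y, ℂ)) (hg' : ∀ x, g' x ≠ 0) {p : X} {q : Y}
    (γ : Path p p) (δ : Path q q) (h : ∀ τ, g (γ τ) = g' (δ τ)) :
    (winding g hg).val γ = (winding g' hg').val δ := by
  obtain ⟨l, hl⟩ := δ.exists_log g' hg'
  obtain ⟨n, hn⟩ := exists_winding g' hg' δ
  rw [logIncrement_val_eq g' hg' δ l.continuous hl, sub_add_cancel] at hn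
  rw [winding_val_eq g hg γ l.continuous (fun τ ↦ (hl τ).trans (h τ).symm) hn.symm,
    winding_val_eq g' hg' δ l.continuous hl hn.symm]

lemma HasMeridianBasis.transfer {gs : Fin r → MvPolynomial (Fin 3) ℂ} (h : HasMeridianBasis gs)
    (L : (Fin 3 → ℂ) ≃ₜ (Fin 3 → ℂ)) (hL : ∀ i v, eval v (gs i) = eval (L v) (fs i)) :
    HasMeridianBasis fs := by
  have hP : ∀ v, eval v (∏ i, gs i) = eval (L v) (∏ i, fs i) := fun v ↦ by
    simp only [map_prod, hL]
  have hmem : ∀ v : (∏ i, gs i).nonvanishing, L v ∈ (∏ i, fs i).nonvanishing := fun v ↦ by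
    rw [mem_nonvanishing, ← hP]; exact v.2
  have hmem' : ∀ v : (∏ i, fs i).nonvanishing, L.symm v ∈ (∏ i, gs i).nonvanishing := fun v ↦ by
    rw [mem_nonvanishing, hP, L.apply_symm_apply]; exact v.2
  let κ : C((∏ i, gs i).nonvanishing, (∏ i, fs i).nonvanishing) :=
    ⟨fun v ↦ ⟨L v, hmem v⟩, (L.continuous.comp continuous_subtype_val).subtype_mk hmem⟩
  let κ' : C((∏ i, fs i).nonvanishing, (∏ i, gs i).nonvanishing) :=
    ⟨fun v ↦ ⟨L.symm v, hmem' v⟩, (L.symm.continuous.comp continuous_subtype_val).subtype_mk hmem'⟩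
  constructor
  · intro A _ c
    obtain ⟨a, ha⟩ := h.1 (c.comap κ)
    refine ⟨a, fun {p} γ ↦ ?_⟩
    have h1 := ha (γ.map κ'.continuous)
    rw [comap_val, c.val_congr _ γ (fun τ ↦ Subtype.ext (by simp [κ, κ']))] at h1
    rw [h1]
    refine Finset.sum_congr rfl fun i _ ↦ ?_
    congr 1
    refine winding_val_eq_winding _ _ _ _ _ _ fun τ ↦ ?_
    simp [factorMap, κ', hL]
  · intro i
    obtain ⟨p, γ, hγ⟩ := h.2 i
    refine ⟨_, γ.map κ.continuous, fun j ↦ ?_⟩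
    rw [← hγ]
    refine winding_val_eq_winding _ _ _ _ _ _ fun τ ↦ ?_
    simp [factorMap, κ, hL]

theorem hasMeridianBasis (hsf : Squarefree (∏ i, fs i))
    (hirr : ∀ i, Irreducible (fs i)) (hhom : ∀ i, (fs i).IsHomogeneous (dg i))
    (hdeg : ∀ i, 1 ≤ dg i) : HasMeridianBasis fs := by
  obtain ⟨e, he0, he⟩ : ∃ e : Fin 3 → ℂ, e 0 ≠ 0 ∧ ∀ i, eval e (fs i) ≠ 0 := by
    by_contra! hne
    have : X 0 * ∏ i, fs i = 0 := MvPolynomial.funext fun v ↦ by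
      rw [map_mul, eval_X, map_prod, map_zero]
      by_cases hv : v 0 = 0
      · rw [hv, zero_mul]
      · obtain ⟨i, hi⟩ := hne v hv
        rw [Finset.prod_eq_zero (Finset.mem_univ i) hi, mul_zero]
    exact mul_ne_zero (X_ne_zero _) hsf.ne_zero this
  let τ : Fin 3 → MvPolynomial (Fin 3) ℂ :=
    ![C (e 0) * X 0, C (e 1) * X 0 + X 1, C (e 2) * X 0 + X 2]
  let τ' : Fin 3 → MvPolynomial (Fin 3) ℂ :=
    ![C (e 0)⁻¹ * X 0, X 1 - C (e 1 * (e 0)⁻¹) * X 0, X 2 - C (e 2 * (e 0)⁻¹) * X 0]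
  have hC : (C (e 0) * C (e 0)⁻¹ : MvPolynomial (Fin 3) ℂ) = 1 := by
    rw [← C_mul, mul_inv_cancel₀ he0, C_1]
  let Φ : MvPolynomial (Fin 3) ℂ ≃ₐ[ℂ] MvPolynomial (Fin 3) ℂ :=
    AlgEquiv.ofAlgHom (aeval τ) (aeval τ')
      (by
        ext1 i
        fin_cases i
        · simp [τ, τ', algebraMap_eq]
          linear_combination X 0 * hC
        · simp [τ, τ', algebraMap_eq]
          linear_combination (-(C (e 1) * X 0)) * hC
        · simp [τ, τ', algebraMap_eq]
          linear_combination (-(C (e 2) * X 0)) * hC)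
      (by
        ext1 i
        fin_cases i
        · simp [τ, τ', algebraMap_eq]
          linear_combination X 0 * hC
        · simp [τ, τ', algebraMap_eq]
          ring
        · simp [τ, τ', algebraMap_eq]
          ring)
  let L : (Fin 3 → ℂ) ≃ₜ (Fin 3 → ℂ) :=
    { toFun := fun v ↦ ![e 0 * v 0, e 1 * v 0 + v 1, e 2 * v 0 + v 2]
      invFun := fun v ↦ ![(e 0)⁻¹ * v 0, v 1 - e 1 * (e 0)⁻¹ * v 0, v 2 - e 2 * (e 0)⁻¹ * v 0]
      left_inv := fun v ↦ by ext i; fin_cases i <;> simp <;> field_simp <;> ring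
      right_inv := fun v ↦ by ext i; fin_cases i <;> simp <;> field_simp <;> ring
      continuous_toFun := by
        refine continuous_pi fun i ↦ ?_
        fin_cases i <;> simp <;> fun_prop
      continuous_invFun := by
        refine continuous_pi fun i ↦ ?_
        fin_cases i <;> simp <;> fun_prop }
  have hΦ : ∀ P v, eval v (Φ P) = eval (L v) P := by
    intro P v
    have e1 : Φ P = aeval τ P := rfl
    rw [e1, ← MvPolynomial.coe_aeval_eq_eval, ← MvPolynomial.coe_aeval_eq_eval]
    change ((aeval v).comp (aeval τ)) P = aeval (L v) P
    congr 1
    ext i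
    fin_cases i <;> simp [τ, L]
  have hτ : ∀ i, (τ i).IsHomogeneous 1 := by
    have h1 : ∀ a i, (C a * X i : MvPolynomial (Fin 3) ℂ).IsHomogeneous 1 := fun a i ↦ by
      simpa using (isHomogeneous_C (Fin 3) a).mul (isHomogeneous_X ℂ i)
    intro i
    fin_cases i
    · exact h1 _ _
    · exact (h1 _ _).add (isHomogeneous_X _ _)
    · exact (h1 _ _).add (isHomogeneous_X _ _)
  refine HasMeridianBasis.transfer (gs := fun i ↦ Φ (fs i)) ?_ L fun i v ↦ hΦ _ _
  refine hasMeridianBasis_of_eval_ne_zero (dg := dg) ?_ (fun i ↦ ?_) (fun i ↦ ?_) hdeg fun i ↦ ?_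
  · rw [← map_prod]
    intro P hP
    have := hsf (Φ.symm P) (by
      rw [← map_mul]
      exact (map_dvd Φ.symm hP).trans (by simp))
    simpa using this.map Φ
  · exact (MulEquiv.irreducible_iff Φ).2 (hirr i)
  · have := (hhom i).aeval τ hτ
    rw [one_mul] at this
    exact this
  · rw [hΦ]
    have hLe : L ![1, 0, 0] = e := by
      funext j
      fin_cases j <;> simp [L]
    rw [hLe]
    exact he i

end PathCocycle

namespace PathCocycle

variable {X Y A B : Type*} [TopologicalSpace X] [TopologicalSpace Y] [AddCommGroup A]
  [AddCommGroup B]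

/-- Integral linear combinations of integral cocycles, viewed in a quotient of `ℤ^r`. -/
def combine {r : ℕ} (w : Fin r → PathCocycle X ℤ) (φ : (Fin r → ℤ) →+ A) : PathCocycle X A where
  val γ := φ fun i ↦ (w i).val γ
  val_trans γ δ := by
    rw [← map_add]
    congr 1
    funext i
    exact (w i).val_trans γ δ
  val_homotopic h := by
    congr 1
    funext i
    exact (w i).val_homotopic h

/-- The projection `π` has the path lifting property, and its fibers are path connected. -/
structure LiftsPaths (π : C(X, Y)) : Prop where
  surjective : Function.Surjective π
  exists_fiber_path : ∀ p q, π p = π q → ∃ φ : Path p q, ∀ t, π (φ t) = π p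
  exists_lift : ∀ {P Q : Y} (γ : Path P Q) (p : X), π p = P →
    ∃ (q : X) (δ : Path p q), ∀ t, π (δ t) = γ t
  exists_lift_homotopic : ∀ {P Q : Y} {γ₀ γ₁ : Path P Q}, γ₀.Homotopic γ₁ →
    ∃ (p q : X) (δ₀ δ₁ : Path p q), δ₀.Homotopic δ₁ ∧ (∀ t, π (δ₀ t) = γ₀ t) ∧
      ∀ t, π (δ₁ t) = γ₁ t

/-- A cocycle is compatible with `π` if it does not distinguish the lifts of a path. -/
def IsCompatible (c : PathCocycle X A) (π : C(X, Y)) : Prop :=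
  ∀ {p q p' q' : X} (α : Path p q) (β : Path p' q') (φ : Path p p') (ψ : Path q q'),
    (∀ t, π (α t) = π (β t)) → (∀ t, π (φ t) = π p) → (∀ t, π (ψ t) = π q) →
    c.val α + c.val ψ = c.val φ + c.val β

lemma IsCompatible.exists_descent {c : PathCocycle X A} {π : C(X, Y)} (hc : c.IsCompatible π)
    (hπ : LiftsPaths π) :
    ∃ b : PathCocycle Y A, ∀ {p : X} (α : Path p p), b.val (α.map π.continuous) = c.val α := by
  choose e he using hπ.surjective
  have hex : ∀ {P Q : Y} (γ : Path P Q), ∃ a, ∀ {p q : X} (δ : Path p q) (φ : Path (e P) p)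
      (ψ : Path (e Q) q), (∀ t, π (δ t) = γ t) → (∀ t, π (φ t) = P) → (∀ t, π (ψ t) = Q) →
      a = c.val φ + c.val δ - c.val ψ := fun {P Q} γ ↦ by
    obtain ⟨q₀, δ₀, hδ₀⟩ := hπ.exists_lift γ (e P) (he P)
    have hq₀ : π q₀ = Q := by simpa using hδ₀ 1
    obtain ⟨ψ₀, hψ₀⟩ := hπ.exists_fiber_path (e Q) q₀ ((he Q).trans hq₀.symm)
    refine ⟨c.val δ₀ - c.val ψ₀, fun {p q} δ φ ψ hδ hφ hψ ↦ ?_⟩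
    have := hc δ₀ δ φ (ψ₀.symm.trans ψ) (fun t ↦ (hδ₀ t).trans (hδ t).symm)
      (fun t ↦ (hφ t).trans (he P).symm) (fun t ↦ by
        rw [Path.trans_apply, hq₀]
        split_ifs
        · exact (hψ₀ _).trans (he Q)
        · exact hψ _)
    rw [c.val_trans, c.val_symm] at this
    rw [← this]
    abel
  choose b hb using @hex
  refine ⟨⟨b, fun {P Q S} γ δ ↦ ?_, fun {P Q γ₀ γ₁} h ↦ ?_⟩, fun {p} α ↦ ?_⟩
  · obtain ⟨q, γ', hγ'⟩ := hπ.exists_lift γ (e P) (he P)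
    have hq : π q = Q := by simpa using hγ' 1
    obtain ⟨s, δ', hδ'⟩ := hπ.exists_lift δ q hq
    have hs : π s = S := by simpa using hδ' 1
    obtain ⟨φ, hφ⟩ := hπ.exists_fiber_path (e Q) q ((he Q).trans hq.symm)
    obtain ⟨ψ, hψ⟩ := hπ.exists_fiber_path (e S) s ((he S).trans hs.symm)
    have hr : ∀ t, π ((Path.refl (e P)) t) = P := fun t ↦ he P
    rw [he] at hφ hψ
    rw [hb (γ.trans δ) (γ'.trans δ') (Path.refl _) ψ (fun t ↦ by
        simp only [Path.trans_apply]
        split_ifs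
        · exact hγ' _
        · exact hδ' _) hr hψ,
      hb γ γ' (Path.refl _) φ hγ' hr hφ, hb δ δ' φ ψ hδ' hφ hψ, c.val_trans, c.val_refl]
    abel
  · obtain ⟨p, q, δ₀, δ₁, hδ, h₀, h₁⟩ := hπ.exists_lift_homotopic h
    have hp : π p = P := by simpa using h₀ 0
    have hq : π q = Q := by simpa using h₀ 1
    obtain ⟨φ, hφ⟩ := hπ.exists_fiber_path (e P) p ((he P).trans hp.symm)
    obtain ⟨ψ, hψ⟩ := hπ.exists_fiber_path (e Q) q ((he Q).trans hq.symm)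
    rw [he] at hφ hψ
    rw [hb γ₀ δ₀ φ ψ h₀ hφ hψ, hb γ₁ δ₁ φ ψ h₁ hφ hψ, c.val_homotopic hδ]
  · obtain ⟨φ, hφ⟩ := hπ.exists_fiber_path (e (π p)) p (he _)
    rw [he] at hφ
    refine (hb (α.map π.continuous) α φ φ (fun t ↦ rfl) hφ hφ).trans ?_
    abel

section Universal

open Path.Homotopic (Quotient)

variable {x₀ : Y}

/-- The class of a loop in the abelianized fundamental group. -/
noncomputable def loopClass (γ : Path.Homotopic.Quotient x₀ x₀) :
    Additive (Abelianization (FundamentalGroup Y x₀)) :=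
  Additive.ofMul (Abelianization.of (FundamentalGroup.fromPath γ))

lemma loopClass_trans (γ δ : Path.Homotopic.Quotient x₀ x₀) :
    loopClass (γ.trans δ) = loopClass γ + loopClass δ := by
  rw [add_comm]
  exact congrArg Additive.ofMul (map_mul Abelianization.of (FundamentalGroup.fromPath δ)
    (FundamentalGroup.fromPath γ))

lemma loopClass_surjective : Function.Surjective fun γ : Path x₀ x₀ ↦
    loopClass (Path.Homotopic.Quotient.mk γ) := fun x ↦ by
  obtain ⟨g, hg⟩ := QuotientGroup.mk_surjective x.toMul
  obtain ⟨γ, hγ⟩ := Path.Homotopic.Quotient.mk_surjective (FundamentalGroup.toPath g)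
  refine ⟨γ, ?_⟩
  simp only [hγ]
  exact congrArg Additive.ofMul hg

lemma exists_universal [PathConnectedSpace Y] (x₀ : Y) :
    ∃ u : PathCocycle Y (Additive (Abelianization (FundamentalGroup Y x₀))),
      ∀ γ : Path x₀ x₀, u.val γ = loopClass (Path.Homotopic.Quotient.mk γ) := by
  let e (p : Y) : Path.Homotopic.Quotient x₀ p :=
    Path.Homotopic.Quotient.mk (PathConnectedSpace.somePath x₀ p)
  refine ⟨⟨fun {p q} γ ↦ loopClass (((e p).trans (Path.Homotopic.Quotient.mk γ)).trans (e q).symm),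
    fun {p q s} γ δ ↦ ?_, fun {p q γ δ} h ↦ ?_⟩, fun γ ↦ ?_⟩
  · rw [← loopClass_trans]
    congr 1
    rw [Path.Homotopic.Quotient.mk_trans]
    simp only [Path.Homotopic.Quotient.trans_assoc]
    rw [← Path.Homotopic.Quotient.trans_assoc (e q).symm (e q),
      Path.Homotopic.Quotient.symm_trans, Path.Homotopic.Quotient.refl_trans]
  · rw [Path.Homotopic.Quotient.eq.2 h]
  · show loopClass _ = _
    have : loopClass ((e x₀).trans (e x₀).symm) = 0 := by
      rw [Path.Homotopic.Quotient.trans_symm]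
      exact congrArg Additive.ofMul (map_one Abelianization.of)
    rw [loopClass_trans] at this
    rw [loopClass_trans, loopClass_trans, add_right_comm, this, zero_add]

/-- A cocycle defines a homomorphism on the abelianized fundamental group. -/
lemma exists_hom (c : PathCocycle Y A) (x₀ : Y) :
    ∃ φ : Additive (Abelianization (FundamentalGroup Y x₀)) →+ A,
      ∀ γ : Path x₀ x₀, φ (loopClass (Path.Homotopic.Quotient.mk γ)) = c.val γ := by
  let ev : Path.Homotopic.Quotient x₀ x₀ → A :=
    _root_.Quotient.lift (fun γ : Path x₀ x₀ ↦ c.val γ) (fun _ _ h ↦ c.val_homotopic h)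
  have hev : ∀ γ : Path x₀ x₀, ev (Path.Homotopic.Quotient.mk γ) = c.val γ := fun γ ↦ rfl
  have hmul : ∀ γ δ, ev (γ.trans δ) = ev γ + ev δ := fun γ δ ↦ by
    induction γ using Path.Homotopic.Quotient.ind with | mk γ =>
    induction δ using Path.Homotopic.Quotient.ind with | mk δ =>
    rw [← Path.Homotopic.Quotient.mk_trans, hev, hev, hev, c.val_trans]
  let ψ : FundamentalGroup Y x₀ →* Multiplicative A :=
    { toFun := fun γ ↦ Multiplicative.ofAdd (ev γ.toPath)
      map_one' := congrArg Multiplicative.ofAdd (c.val_refl x₀)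
      map_mul' := fun γ δ ↦ by
        rw [← ofAdd_add, add_comm]
        exact congrArg Multiplicative.ofAdd (hmul δ.toPath γ.toPath) }
  exact ⟨MonoidHom.toAdditiveLeft (Abelianization.lift ψ), fun γ ↦
    congrArg Multiplicative.toAdd (Abelianization.lift_apply_of ψ _)⟩

/-- If the first homology of `X` is freely generated by classes dual to the cocycles `w`, and the
loops in the fibers of `π : X → Y` are multiples of a class `d`, then the first homology of `Y` is
the quotient by `d`. -/
theorem nonempty_addEquiv_of_liftsPaths {X Y : Type} [TopologicalSpace X] [TopologicalSpace Y]
    [PathConnectedSpace X] {π : C(X, Y)} (hπ : LiftsPaths π) {r : ℕ}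
    {w : Fin r → PathCocycle X ℤ} {d : Fin r → ℤ}
    (hw : ∀ {A : Type} [AddCommGroup A] (c : PathCocycle X A), ∃ a : Fin r → A,
      ∀ {p : X} (γ : Path p p), c.val γ = ∑ i, (w i).val γ • a i)
    (hw' : ∀ i, ∃ (p : X) (γ : Path p p), ∀ j, (w j).val γ = if j = i then 1 else 0)
    (hd : (combine w (QuotientAddGroup.mk' (AddSubgroup.zmultiples d))).IsCompatible π)
    (hd' : ∃ (p : X) (γ : Path p p), (∀ t, π (γ t) = π p) ∧ ∀ i, (w i).val γ = d i) (x₀ : Y) :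
    Nonempty (Additive (Abelianization (FundamentalGroup Y x₀)) ≃+
      (Fin r → ℤ) ⧸ AddSubgroup.zmultiples d) := by
  have : PathConnectedSpace Y := hπ.surjective.pathConnectedSpace π.continuous
  obtain ⟨b, hb⟩ := hd.exists_descent hπ
  obtain ⟨φ, hφ⟩ := b.exists_hom x₀
  obtain ⟨u, hu⟩ := exists_universal x₀
  obtain ⟨a, ha⟩ := hw (u.comap π)
  refine ⟨AddEquiv.ofBijective φ ⟨(injective_iff_map_eq_zero φ).2 fun x hx ↦ ?_, fun y ↦ ?_⟩⟩
  · obtain ⟨γ, rfl⟩ := loopClass_surjective x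
    obtain ⟨p, hp⟩ := hπ.surjective x₀
    obtain ⟨q, δ, hδ⟩ := hπ.exists_lift γ p hp
    have hq : π q = x₀ := by simpa using hδ 1
    obtain ⟨ψ, hψ⟩ := hπ.exists_fiber_path q p (hq.trans hp.symm)
    have key : ∀ {B : Type} [AddCommGroup B] (c : PathCocycle Y B),
        c.val ((δ.trans ψ).map π.continuous) = c.val γ := fun c ↦ by
      rw [Path.map_trans, c.val_trans, c.val_congr (δ.map π.continuous) γ hδ,
        c.val_congr (ψ.map π.continuous) (Path.refl (π q)) hψ, c.val_refl, add_zero]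
    simp only [hφ, ← key b, hb] at hx
    obtain ⟨n, hn⟩ := AddSubgroup.mem_zmultiples_iff.1 ((QuotientAddGroup.eq_zero_iff _).1 hx)
    have hn : ∀ i, (w i).val (δ.trans ψ) = n * d i := fun i ↦ by
      rw [← congrFun hn i]; simp
    have h0 : ∑ i, d i • a i = 0 := by
      obtain ⟨p, γ, hγ, hγd⟩ := hd'
      simp only [← hγd, ← ha, comap_val]
      rw [u.val_congr (γ.map π.continuous) (Path.refl (π p)) hγ, u.val_refl]
    have := ha (δ.trans ψ)
    rw [comap_val, key u, hu] at this
    simp only [this, hn, mul_smul, ← Finset.smul_sum, h0, smul_zero]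
  · induction y using QuotientAddGroup.induction_on with | H y =>
    have : ∀ i, ∃ x, φ x = QuotientAddGroup.mk' (AddSubgroup.zmultiples d) (Pi.single i 1) :=
        fun i ↦ by
      obtain ⟨p, γ, hγ⟩ := hw' i
      let η := PathConnectedSpace.somePath x₀ (π p)
      refine ⟨loopClass (Path.Homotopic.Quotient.mk ((η.trans (γ.map π.continuous)).trans η.symm)), ?_⟩
      rw [hφ, b.val_trans, b.val_trans, b.val_symm, hb, add_right_comm, add_neg_cancel,
        zero_add]
      refine congrArg (QuotientAddGroup.mk' (AddSubgroup.zmultiples d)) (funext fun j ↦ ?_)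
      rw [hγ, Pi.single_apply]
    choose x hx using this
    refine ⟨∑ i, y i • x i, ?_⟩
    simp only [map_sum, map_zsmul, hx]
    simp only [← map_zsmul, ← map_sum]
    refine congrArg (QuotientAddGroup.mk' (AddSubgroup.zmultiples d)) (funext fun j ↦ ?_)
    simp [Finset.sum_apply, Pi.single_apply]

end Universal

end PathCocycle

namespace MvPolynomial

variable {F : MvPolynomial (Fin 3) ℂ} {d : ℕ}

lemma IsHomogeneous.ne_zero_of_mem (hF : F.IsHomogeneous d) (hd : d ≠ 0) {v : Fin 3 → ℂ}
    (hv : v ∈ F.nonvanishing) : v ≠ 0 := by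
  rintro rfl
  apply hv
  have := hF.eval_smul_eq 0 0
  rwa [zero_smul, zero_pow hd, zero_mul] at this

lemma IsHomogeneous.smul_mem_nonvanishing (hF : F.IsHomogeneous d) {a : ℂ} (ha : a ≠ 0)
    {v : Fin 3 → ℂ} (hv : v ∈ F.nonvanishing) : a • v ∈ F.nonvanishing := by
  rw [mem_nonvanishing, hF.eval_smul_eq]
  exact mul_ne_zero (pow_ne_zero _ ha) hv

lemma IsHomogeneous.mk_mem_curveComplement (hF : F.IsHomogeneous d) {v : Fin 3 → ℂ} (h0 : v ≠ 0)
    (hv : v ∈ F.nonvanishing) : Projectivization.mk ℂ v h0 ∈ curveComplement F := by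
  intro w hw h
  obtain ⟨a, rfl⟩ := (Projectivization.mk_eq_mk_iff' ℂ _ _ hw h0).1 h
  exact hF.smul_mem_nonvanishing (by rintro rfl; simp at hw) hv

/-- The projection from the complement of the affine cone over a plane curve to the complement
of the curve. -/
noncomputable def coneProj (hF : F.IsHomogeneous d) (hd : d ≠ 0) :
    C(F.nonvanishing, curveComplement F) where
  toFun v := ⟨Projectivization.mk ℂ v (hF.ne_zero_of_mem hd v.2), hF.mk_mem_curveComplement _ v.2⟩
  continuous_toFun := by
    have h : Continuous (Projectivization.mk' ℂ : {v : Fin 3 → ℂ // v ≠ 0} → _) :=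
      continuous_quotient_mk'
    have hmem : ∀ v : F.nonvanishing, (v : Fin 3 → ℂ) ≠ 0 := fun v ↦ hF.ne_zero_of_mem hd v.2
    exact (h.comp (continuous_subtype_val.subtype_mk hmem)).subtype_mk _

variable (hF : F.IsHomogeneous d) (hd : d ≠ 0)

lemma coneProj_eq_iff {v w : F.nonvanishing} :
    coneProj hF hd v = coneProj hF hd w ↔ ∃ a : ℂ, a ≠ 0 ∧ a • (w : Fin 3 → ℂ) = v := by
  refine Subtype.ext_iff.trans ((Projectivization.mk_eq_mk_iff' ℂ _ _ _ _).trans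
    ⟨fun ⟨a, ha⟩ ↦ ⟨a, ?_, ha⟩, fun ⟨a, _, ha⟩ ↦ ⟨a, ha⟩⟩)
  rintro rfl
  exact hF.ne_zero_of_mem hd v.2 (by rw [← ha, zero_smul])

lemma coneProj_surjective : Function.Surjective (coneProj hF hd) := by
  rintro ⟨P, hP⟩
  induction P using Projectivization.ind with | h v hv =>
  exact ⟨⟨v, hP v hv rfl⟩, rfl⟩

lemma isOpen_of_isOpen_coneProj_preimage {s : Set (curveComplement F)}
    (hs : IsOpen (coneProj hF hd ⁻¹' s)) : IsOpen s := by
  have h1 : IsOpen ((Subtype.val : F.nonvanishing → _) '' (coneProj hF hd ⁻¹' s)) :=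
    F.isOpen_nonvanishing.isOpenMap_subtype_val _ hs
  have hq : IsQuotientMap (Projectivization.mk' ℂ : {v : Fin 3 → ℂ // v ≠ 0} → _) :=
    isQuotientMap_quotient_mk'
  have h2 : IsOpen ((Subtype.val : curveComplement F → _) '' s) := by
    rw [← hq.isOpen_preimage]
    convert h1.preimage (continuous_subtype_val (p := fun v : Fin 3 → ℂ ↦ v ≠ 0)) using 1
    ext ⟨v, hv⟩
    constructor
    · rintro ⟨⟨P, hP⟩, hPs, rfl⟩
      exact ⟨⟨v, hP v hv rfl⟩, hPs, rfl⟩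
    · rintro ⟨⟨w, hw⟩, hws, rfl⟩
      exact ⟨_, hws, rfl⟩
  have h3 : IsOpen ((Subtype.val : curveComplement F → _) ⁻¹' (Subtype.val '' s)) :=
    h2.preimage continuous_subtype_val
  rwa [preimage_image_eq _ Subtype.val_injective] at h3

lemma coneProj_exists_fiber_path (v w : F.nonvanishing) (h : coneProj hF hd v = coneProj hF hd w) :
    ∃ φ : Path v w, ∀ t, coneProj hF hd (φ t) = coneProj hF hd v := by
  obtain ⟨a, ha, hav⟩ := (coneProj_eq_iff hF hd).1 h.symm
  have hmem : ∀ t : I, Complex.exp ((t : ℝ) * Complex.log a) • (v : Fin 3 → ℂ) ∈ F.nonvanishing :=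
    fun t ↦ hF.smul_mem_nonvanishing (Complex.exp_ne_zero _) v.2
  refine ⟨⟨⟨fun t ↦ ⟨_, hmem t⟩, Continuous.subtype_mk (by fun_prop) hmem⟩, Subtype.ext (by simp),
    Subtype.ext (by simp [Complex.exp_log ha, hav])⟩, fun t ↦ ?_⟩
  exact (coneProj_eq_iff hF hd).2 ⟨_, Complex.exp_ne_zero _, rfl⟩

/-- The Milnor fiber of a homogeneous polynomial. -/
def milnorFiber (F : MvPolynomial (Fin 3) ℂ) : Set (Fin 3 → ℂ) := {v | eval v F = 1}

lemma mem_milnorFiber {v : Fin 3 → ℂ} : v ∈ F.milnorFiber ↔ eval v F = 1 := Iff.rfl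

lemma milnorFiber_subset : F.milnorFiber ⊆ F.nonvanishing := fun v hv ↦ by
  rw [mem_nonvanishing, mem_milnorFiber.1 hv]; exact one_ne_zero

/-- The projection of the Milnor fiber to the complement of the curve. -/
noncomputable def milnorProj : C(F.milnorFiber, curveComplement F) :=
  (coneProj hF hd).comp ⟨inclusion milnorFiber_subset, continuous_inclusion _⟩

lemma isQuotientMap_milnorProj : IsQuotientMap (milnorProj hF hd) := by
  have hn : ∀ v : F.nonvanishing, ∃ n : F.nonvanishing → F.milnorFiber,
      ContinuousAt n v ∧ ∀ w, milnorProj hF hd (n w) = coneProj hF hd w := fun v ↦ by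
    have hv := mem_nonvanishing.1 v.2
    let μ (w : F.nonvanishing) : ℂ := Complex.exp
      (-((Complex.log (eval (w : Fin 3 → ℂ) F / eval (v : Fin 3 → ℂ) F) +
        Complex.log (eval (v : Fin 3 → ℂ) F)) / d))
    have hμ : ∀ w, μ w • (w : Fin 3 → ℂ) ∈ F.milnorFiber := fun w ↦ by
      have hw := mem_nonvanishing.1 w.2
      rw [mem_milnorFiber, hF.eval_smul_eq, ← Complex.exp_nat_mul, mul_neg,
        mul_div_cancel₀ _ (Nat.cast_ne_zero.2 hd), Complex.exp_neg, Complex.exp_add,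
        Complex.exp_log (div_ne_zero hw hv), Complex.exp_log hv, div_mul_cancel₀ _ hv,
        inv_mul_cancel₀ hw]
    refine ⟨fun w ↦ ⟨_, hμ w⟩, ?_, fun w ↦ ?_⟩
    · refine ContinuousAt.codRestrict (h1 := hμ) ?_
      have h1 : Continuous fun w : F.nonvanishing ↦
          eval (w : Fin 3 → ℂ) F / eval (v : Fin 3 → ℂ) F :=
        ((continuous_eval F).comp continuous_subtype_val).div_const _
      have h2 : ContinuousAt (fun w : F.nonvanishing ↦
          Complex.log (eval (w : Fin 3 → ℂ) F / eval (v : Fin 3 → ℂ) F)) v :=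
        h1.continuousAt.clog (by rw [div_self hv]; exact Complex.one_mem_slitPlane)
      exact ((h2.add continuousAt_const).div_const _).neg.cexp.smul
        continuous_subtype_val.continuousAt
    · exact (coneProj_eq_iff hF hd).2 ⟨_, Complex.exp_ne_zero _, rfl⟩
  refine ⟨isCoinducing_iff.2 fun s ↦ ⟨fun hs ↦ ?_, fun hs ↦ hs.preimage (map_continuous _)⟩,
    fun P ↦ ?_⟩
  · refine isOpen_of_isOpen_coneProj_preimage hF hd (isOpen_iff_mem_nhds.2 fun v hv ↦ ?_)
    obtain ⟨n, hn, hnp⟩ := hn v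
    filter_upwards [hn.preimage_mem_nhds (hs.mem_nhds
      (show milnorProj hF hd (n v) ∈ s by rw [hnp]; exact hv))] with w hw
    change coneProj hF hd w ∈ s
    rw [← hnp]
    exact hw
  · obtain ⟨v, rfl⟩ := coneProj_surjective hF hd P
    obtain ⟨n, -, hnp⟩ := hn v
    exact ⟨n v, hnp v⟩

lemma isCoveringMap_milnorProj : IsCoveringMap (milnorProj hF hd) := by
  have : NeZero d := ⟨hd⟩
  have hmem : ∀ (ζ : rootsOfUnity d ℂ) (v : F.milnorFiber),
      ((ζ : ℂˣ) : ℂ) • (v : Fin 3 → ℂ) ∈ F.milnorFiber := fun ζ v ↦ by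
    have h : ((ζ : ℂˣ) : ℂ) ^ d = 1 := (mem_rootsOfUnity' d _).1 ζ.2
    rw [mem_milnorFiber, hF.eval_smul_eq, h, one_mul]
    exact v.2
  let act : MulAction (rootsOfUnity d ℂ) F.milnorFiber :=
    { smul := fun ζ v ↦ ⟨_, hmem ζ v⟩
      one_smul := fun v ↦ Subtype.ext (one_smul ℂ (v : Fin 3 → ℂ))
      mul_smul := fun ζ ξ v ↦ Subtype.ext
        (mul_smul ((ζ : ℂˣ) : ℂ) ((ξ : ℂˣ) : ℂ) (v : Fin 3 → ℂ)) }
  have hact : ∀ (ζ : rootsOfUnity d ℂ) (v : F.milnorFiber),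
      ((ζ • v : F.milnorFiber) : Fin 3 → ℂ) = ((ζ : ℂˣ) : ℂ) • (v : Fin 3 → ℂ) := fun _ _ ↦ rfl
  have : ContinuousConstSMul (rootsOfUnity d ℂ) F.milnorFiber :=
    ⟨fun ζ ↦ (continuous_subtype_val.const_smul ((ζ : ℂˣ) : ℂ)).subtype_mk (hmem ζ)⟩
  have hclosed : IsClosed F.milnorFiber := isClosed_eq (continuous_eval F) continuous_const
  have : LocallyCompactSpace F.milnorFiber := hclosed.isClosedEmbedding_subtypeVal.locallyCompactSpace
  have : IsCancelSMul (rootsOfUnity d ℂ) F.milnorFiber :=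
    { right_cancel' := fun ζ ξ v h ↦ by
        have h := congrArg Subtype.val h
        rw [hact, hact] at h
        exact Subtype.ext (Units.ext (smul_left_injective ℂ
          (hF.ne_zero_of_mem hd (milnorFiber_subset v.2)) h)) }
  refine ((isQuotientMap_milnorProj hF hd).isQuotientCoveringMap_of_properlyDiscontinuousSMul
    (G := rootsOfUnity d ℂ) fun {v w} ↦ ?_).isCoveringMap
  refine (coneProj_eq_iff hF hd).trans ⟨fun ⟨a, ha, h⟩ ↦ ?_, fun ⟨ζ, h⟩ ↦
    ⟨((ζ : ℂˣ) : ℂ), Units.ne_zero _, congrArg Subtype.val h⟩⟩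
  have had : a ^ d = 1 := by
    have := congrArg (fun x ↦ eval x F) h
    change eval (a • (w : Fin 3 → ℂ)) F = eval (v : Fin 3 → ℂ) F at this
    rwa [hF.eval_smul_eq, mem_milnorFiber.1 v.2, mem_milnorFiber.1 w.2, mul_one] at this
  exact ⟨⟨Units.mk0 a ha, Units.ext (by simpa using had)⟩, Subtype.ext h⟩

lemma liftsPaths_coneProj : PathCocycle.LiftsPaths (coneProj hF hd) where
  surjective := coneProj_surjective hF hd
  exists_fiber_path := coneProj_exists_fiber_path hF hd
  exists_lift {P Q} γ p hp := by
    have hcov := isCoveringMap_milnorProj hF hd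
    obtain ⟨e, he⟩ := (isQuotientMap_milnorProj hF hd).surjective P
    obtain ⟨a, ha, hae⟩ := (coneProj_eq_iff hF hd).1 (hp.trans he.symm)
    obtain ⟨Γ, hΓ, hΓ0⟩ := hcov.exists_path_lifts (γ : C(I, curveComplement F)) e (by simp [he])
    have hmem : ∀ t, a • (Γ t : Fin 3 → ℂ) ∈ F.nonvanishing := fun t ↦
      hF.smul_mem_nonvanishing ha (milnorFiber_subset (Γ t).2)
    refine ⟨⟨_, hmem 1⟩, ⟨⟨fun t ↦ ⟨_, hmem t⟩, Continuous.subtype_mk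
      ((continuous_subtype_val.comp Γ.continuous).const_smul a) hmem⟩, Subtype.ext ?_, rfl⟩,
      fun t ↦ ?_⟩
    · simp only [hΓ0]
      exact hae
    · rw [← show milnorProj hF hd (Γ t) = γ t from congrFun hΓ t]
      exact (coneProj_eq_iff hF hd).2 ⟨a, ha, rfl⟩
  exists_lift_homotopic {P Q γ₀ γ₁} h := by
    have hcov := isCoveringMap_milnorProj hF hd
    obtain ⟨e, he⟩ := (isQuotientMap_milnorProj hF hd).surjective P
    have h₀ : (γ₀ : C(I, curveComplement F)) 0 = milnorProj hF hd e := by simp [he]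
    have h₁ : (γ₁ : C(I, curveComplement F)) 0 = milnorProj hF hd e := by simp [he]
    have h' : (γ₀ : C(I, curveComplement F)).HomotopicRel (γ₁ : C(I, curveComplement F)) {0, 1} := h
    let ι : C(F.milnorFiber, F.nonvanishing) :=
      ⟨inclusion milnorFiber_subset, continuous_inclusion _⟩
    let δ₀ : Path e (hcov.liftPath γ₀ e h₀ 1) :=
      ⟨hcov.liftPath γ₀ e h₀, hcov.liftPath_zero γ₀ e h₀, rfl⟩
    let δ₁ : Path e (hcov.liftPath γ₀ e h₀ 1) :=
      ⟨hcov.liftPath γ₁ e h₁, hcov.liftPath_zero γ₁ e h₁,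
        (hcov.liftPath_apply_one_eq_of_homotopicRel h' e h₀ h₁).symm⟩
    have hδ : δ₀.Homotopic δ₁ := hcov.homotopicRel_liftPath h' e h₀ h₁
    exact ⟨_, _, δ₀.map ι.continuous, δ₁.map ι.continuous, hδ.map ι,
      congrFun (hcov.liftPath_lifts γ₀ e h₀), congrFun (hcov.liftPath_lifts γ₁ e h₁)⟩

end MvPolynomial

namespace MvPolynomial

variable {F : MvPolynomial (Fin 3) ℂ} {d : ℕ} (hF : F.IsHomogeneous d) (hd : d ≠ 0)

open scoped ComplexOrder in
lemma exists_log_ratio (α β : C(I, F.nonvanishing))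
    (h : ∀ t, coneProj hF hd (α t) = coneProj hF hd (β t)) :
    ∃ l : C(I, ℂ), ∀ t, Complex.exp (l t) • (α t : Fin 3 → ℂ) = β t := by
  have h0 : ∀ t, star (α t : Fin 3 → ℂ) ⬝ᵥ (α t : Fin 3 → ℂ) ≠ 0 := fun t ↦ by
    rw [Ne, dotProduct_star_self_eq_zero]
    exact hF.ne_zero_of_mem hd (α t).2
  have hα : Continuous fun t ↦ (α t : Fin 3 → ℂ) := continuous_subtype_val.comp α.continuous
  have hβ : Continuous fun t ↦ (β t : Fin 3 → ℂ) := continuous_subtype_val.comp β.continuous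
  let μ : C(I, ℂ) := ⟨fun t ↦ (star (α t : Fin 3 → ℂ) ⬝ᵥ (β t : Fin 3 → ℂ)) /
    (star (α t : Fin 3 → ℂ) ⬝ᵥ (α t : Fin 3 → ℂ)),
    (hα.star.dotProduct hβ).div (hα.star.dotProduct hα) h0⟩
  have hμ : ∀ t, ∃ a : ℂ, a ≠ 0 ∧ μ t = a ∧ a • (α t : Fin 3 → ℂ) = β t := fun t ↦ by
    obtain ⟨a, ha, hab⟩ := (coneProj_eq_iff hF hd).1 (h t).symm
    refine ⟨a, ha, ?_, hab⟩
    simp only [μ, ContinuousMap.coe_mk, ← hab, dotProduct_smul, smul_eq_mul]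
    exact mul_div_cancel_right₀ a (h0 t)
  obtain ⟨l, hl⟩ := Path.exists_log (⟨ContinuousMap.id I, rfl, rfl⟩ : Path (0 : I) 1) μ fun t ↦ by
    obtain ⟨a, ha, hab, -⟩ := hμ t
    rwa [hab]
  refine ⟨l, fun t ↦ ?_⟩
  obtain ⟨a, ha, hab, h⟩ := hμ t
  rw [hl, ← h, ← hab]
  rfl

end MvPolynomial

namespace PathCocycle

open MvPolynomial

variable {r : ℕ} {fs : Fin r → MvPolynomial (Fin 3) ℂ} {dg : Fin r → ℕ} {d : ℕ}
  (hhom : ∀ i, (fs i).IsHomogeneous (dg i)) (hF : (∏ i, fs i).IsHomogeneous d) (hd : d ≠ 0)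

include hhom in
lemma factorWinding_val_of_exp {p : ↥(∏ i, fs i).nonvanishing} (φ : Path p p) (l : C(I, ℂ))
    (hl : ∀ t, Complex.exp (l t) • (p : Fin 3 → ℂ) = φ t) {n : ℤ}
    (hn : l 1 - l 0 = n * (2 * Real.pi * Complex.I)) (i : Fin r) :
    (factorWinding fs i).val φ = n * dg i := by
  refine winding_val_eq _ _ φ
    (l := fun t ↦ dg i * l t + Complex.log (factorMap fs i p)) (by fun_prop) (fun t ↦ ?_) ?_
  · rw [Complex.exp_add, Complex.exp_log (factorMap_ne_zero fs i p), Complex.exp_nat_mul]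
    change _ = eval (φ t : Fin 3 → ℂ) (fs i)
    rw [← hl, (hhom i).eval_smul_eq]
    rfl
  · push_cast
    linear_combination (dg i : ℂ) * hn

include hhom in
lemma exists_factorWinding_val_eq {p : ↥(∏ i, fs i).nonvanishing} (φ : Path p p)
    (hφ : ∀ t, coneProj hF hd (φ t) = coneProj hF hd p) :
    ∃ n : ℤ, ∀ i, (factorWinding fs i).val φ = n * dg i := by
  obtain ⟨l, hl⟩ := exists_log_ratio hF hd (.const I p) φ fun t ↦ (hφ t).symm
  have h1 : Complex.exp (l 1) = Complex.exp (l 0) := by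
    refine smul_left_injective ℂ (hF.ne_zero_of_mem hd p.2) ?_
    have h0 : Complex.exp (l 0) • (p : Fin 3 → ℂ) = p :=
      (hl 0).trans (congrArg Subtype.val φ.source)
    have h1 : Complex.exp (l 1) • (p : Fin 3 → ℂ) = p :=
      (hl 1).trans (congrArg Subtype.val φ.target)
    exact h1.trans h0.symm
  obtain ⟨n, hn⟩ := Complex.exp_eq_exp_iff_exists_int.1 h1
  exact ⟨n, factorWinding_val_of_exp hhom φ l hl (by rw [hn]; ring)⟩

include hhom in
lemma exists_factorWinding_val_eq_degree (p : ↥(∏ i, fs i).nonvanishing) :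
    ∃ φ : Path p p, (∀ t, coneProj hF hd (φ t) = coneProj hF hd p) ∧
      ∀ i, (factorWinding fs i).val φ = dg i := by
  let l : C(I, ℂ) := ⟨fun t ↦ 2 * Real.pi * Complex.I * (t : ℝ), by fun_prop⟩
  have hmem : ∀ t : I, Complex.exp (l t) • (p : Fin 3 → ℂ) ∈ (∏ i, fs i).nonvanishing :=
    fun t ↦ hF.smul_mem_nonvanishing (Complex.exp_ne_zero _) p.2
  let φ : Path p p := ⟨⟨fun t ↦ ⟨_, hmem t⟩, Continuous.subtype_mk (by fun_prop) hmem⟩,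
    Subtype.ext (by simp [l]), Subtype.ext (by simp [l])⟩
  refine ⟨φ, fun t ↦ (coneProj_eq_iff hF hd).2 ⟨_, Complex.exp_ne_zero _, rfl⟩, fun i ↦ ?_⟩
  rw [factorWinding_val_of_exp hhom φ l (fun t ↦ rfl) (n := 1) (by simp [l]) i, one_mul]

include hhom in
lemma isCompatible_combine_factorWinding :
    (combine (factorWinding fs) (QuotientAddGroup.mk' (AddSubgroup.zmultiples
      fun i ↦ (dg i : ℤ)))).IsCompatible (coneProj hF hd) := by
  set c := combine (factorWinding fs) (QuotientAddGroup.mk' (AddSubgroup.zmultiples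
      fun i ↦ (dg i : ℤ)))
  have hloop : ∀ {p} (φ : Path p p), (∀ t, coneProj hF hd (φ t) = coneProj hF hd p) →
      c.val φ = 0 := fun {p} φ hφ ↦ by
    obtain ⟨n, hn⟩ := exists_factorWinding_val_eq hhom hF hd φ hφ
    refine (QuotientAddGroup.eq_zero_iff _).2 (AddSubgroup.mem_zmultiples_iff.2 ⟨n, ?_⟩)
    funext i
    simp [hn]
  have hfib : ∀ {p q} (φ ψ : Path p q), (∀ t, coneProj hF hd (φ t) = coneProj hF hd p) →
      (∀ t, coneProj hF hd (ψ t) = coneProj hF hd p) → c.val φ = c.val ψ := fun φ ψ hφ hψ ↦ by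
    have := hloop (φ.trans ψ.symm) fun t ↦ by
      rw [Path.trans_apply]
      split_ifs
      · exact hφ _
      · exact hψ _
    rwa [c.val_trans, c.val_symm, add_neg_eq_zero] at this
  intro p q p' q' α β φ ψ hαβ hφ hψ
  obtain ⟨l, hl⟩ := exists_log_ratio hF hd α β hαβ
  have hmem : ∀ x : I × I, Complex.exp ((x.1 : ℝ) * l x.2) • (α x.2 : Fin 3 → ℂ) ∈
      (∏ i, fs i).nonvanishing :=
    fun x ↦ hF.smul_mem_nonvanishing (Complex.exp_ne_zero _) (α x.2).2
  have hcont : Continuous fun x : I × I ↦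
      Complex.exp ((x.1 : ℝ) * l x.2) • (α x.2 : Fin 3 → ℂ) := by
    have : Continuous fun x : I × I ↦ (α x.2 : Fin 3 → ℂ) :=
      continuous_subtype_val.comp (α.continuous.comp continuous_snd)
    fun_prop
  let S : C(I × I, (∏ i, fs i).nonvanishing) := ⟨fun x ↦ ⟨_, hmem x⟩, hcont.subtype_mk hmem⟩
  have hS : ∀ x, coneProj hF hd (S x) = coneProj hF hd (α x.2) := fun x ↦
    (coneProj_eq_iff hF hd).2 ⟨_, Complex.exp_ne_zero _, rfl⟩
  have h0 : ∀ t, S (0, t) = α t := fun t ↦ Subtype.ext (by simp [S])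
  have h1 : ∀ t, S (1, t) = β t := fun t ↦ Subtype.ext (by
    simpa [S] using hl t)
  let φ' : Path p p' := ⟨S.comp ((ContinuousMap.id I).prodMk (.const I 0)),
    (h0 0).trans α.source, (h1 0).trans β.source⟩
  let ψ' : Path q q' := ⟨S.comp ((ContinuousMap.id I).prodMk (.const I 1)),
    (h0 1).trans α.target, (h1 1).trans β.target⟩
  rw [hfib φ φ' hφ fun t ↦ (hS _).trans (congrArg _ α.source),
    hfib ψ ψ' hψ fun t ↦ (hS _).trans (congrArg _ α.target)]
  exact c.val_square S α β φ' ψ' h0 h1 (fun t ↦ rfl) fun t ↦ rfl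

/-- The first homology of the complement of a plane curve is the quotient of `ℤ^r` by the vector
of degrees of the components. -/
theorem nonempty_addEquiv_quotient (hr : 1 ≤ r) (hsf : Squarefree (∏ i, fs i))
    (hirr : ∀ i, Irreducible (fs i)) (hhom : ∀ i, (fs i).IsHomogeneous (dg i))
    (hdeg : ∀ i, 1 ≤ dg i) (x₀ : ↥(curveComplement (∏ i, fs i))) :
    Nonempty (Additive (Abelianization (FundamentalGroup ↥(curveComplement (∏ i, fs i)) x₀)) ≃+
      (Fin r → ℤ) ⧸ AddSubgroup.zmultiples fun i ↦ (dg i : ℤ)) := by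
  have hF : (∏ i, fs i).IsHomogeneous (∑ i, dg i) := IsHomogeneous.prod _ _ _ fun i _ ↦ hhom i
  have hd : ∑ i, dg i ≠ 0 := fun h ↦ by
    have := (Finset.sum_eq_zero_iff.1 h) ⟨0, hr⟩ (Finset.mem_univ _)
    have := hdeg ⟨0, hr⟩
    omega
  have hpc := isPathConnected_nonvanishing (F := ∏ i, fs i) hsf.ne_zero
  have : PathConnectedSpace (∏ i, fs i).nonvanishing := isPathConnected_iff_pathConnectedSpace.1 hpc
  obtain ⟨h1, h2⟩ := hasMeridianBasis hsf hirr hhom hdeg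
  obtain ⟨p, hp⟩ := hpc.nonempty
  exact nonempty_addEquiv_of_liftsPaths (liftsPaths_coneProj hF hd) h1 h2
    (isCompatible_combine_factorWinding hhom hF hd)
    ⟨⟨p, hp⟩, exists_factorWinding_val_eq_degree hhom hF hd _⟩ x₀

end PathCocycle

lemma Finset.exists_sum_mul_eq_one {ι : Type*} (s : Finset ι) (u : ι → ℕ) (hu : s.gcd u = 1) :
    ∃ a : ι → ℤ, ∑ i ∈ s, a i * u i = 1 := by
  have h : Ideal.span (Set.range fun i : s ↦ (u i : ℤ)) = ⊤ := by
    obtain ⟨m, hm⟩ := (IsPrincipalIdealRing.principal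
      (Ideal.span (Set.range fun i : s ↦ (u i : ℤ)))).principal
    have hdvd : m.natAbs ∣ s.gcd u := Finset.dvd_gcd fun i hi ↦ by
      have : (u i : ℤ) ∈ Submodule.span ℤ {m} := hm ▸ Ideal.subset_span ⟨⟨i, hi⟩, rfl⟩
      exact Int.natAbs_dvd_natAbs.2 (Ideal.mem_span_singleton.1 this)
    rw [hu, Nat.dvd_one, ← Int.isUnit_iff_natAbs_eq] at hdvd
    rw [hm]
    exact Ideal.span_singleton_eq_top.2 hdvd
  obtain ⟨a, ha⟩ := Ideal.mem_span_range_iff_exists_fun.1 ((Ideal.eq_top_iff_one _).1 h)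
  classical
  refine ⟨fun i ↦ if hi : i ∈ s then a ⟨i, hi⟩ else 0, ?_⟩
  rw [← ha, ← Finset.sum_coe_sort]
  simp

lemma nonempty_quotient_zmultiples_addEquiv {r : ℕ} (hr : 1 ≤ r) (dg : Fin r → ℕ) :
    Nonempty ((Fin r → ℤ) ⧸ AddSubgroup.zmultiples (fun i ↦ (dg i : ℤ)) ≃+
      (Fin (r - 1) → ℤ) × ZMod (Finset.univ.gcd dg)) := by
  obtain ⟨u, hu, hu1⟩ := Finset.extract_gcd dg ⟨⟨0, hr⟩, Finset.mem_univ _⟩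
  obtain ⟨a, ha⟩ := Finset.univ.exists_sum_mul_eq_one u hu1
  set g := Finset.univ.gcd dg
  let w : Fin r → ℤ := fun i ↦ u i
  let ψ : (Fin r → ℤ) →ₗ[ℤ] ℤ := ∑ i, a i • LinearMap.proj i
  have hψ : ψ w = 1 := by simpa [ψ, w] using ha
  have hψw : ∀ m : ℤ, ψ (m • w) = m := fun m ↦ by rw [map_smul, hψ, smul_eq_mul, mul_one]
  have hdg : (fun i ↦ (dg i : ℤ)) = (g : ℤ) • w := by
    funext i
    simp [w, hu i (Finset.mem_univ i)]
  have hsurj : Function.Surjective ψ := fun m ↦ ⟨m • w, hψw m⟩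
  have hrank : Module.finrank ℤ ψ.ker = r - 1 := by
    have := ψ.ker.finrank_quotient_add_finrank
    rw [(ψ.quotKerEquivOfSurjective hsurj).finrank_eq, Module.finrank_self,
      Module.finrank_fin_fun] at this
    lia
  let e : ψ.ker ≃ₗ[ℤ] (Fin (r - 1) → ℤ) := (Module.finBasisOfFinrankEq ℤ ψ.ker hrank).equivFun
  let π : (Fin r → ℤ) →ₗ[ℤ] ψ.ker :=
    (LinearMap.id - ψ.smulRight w).codRestrict ψ.ker fun n ↦ by
      rw [LinearMap.mem_ker, LinearMap.sub_apply, map_sub]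
      exact sub_eq_zero.2 (hψw (ψ n)).symm
  have hπ : ∀ n, (π n : Fin r → ℤ) = n - ψ n • w := fun n ↦ rfl
  let θ : (Fin r → ℤ) →+ (Fin (r - 1) → ℤ) × ZMod g :=
    (e.toLinearMap ∘ₗ π).toAddMonoidHom.prod ((Int.castAddHom (ZMod g)).comp ψ.toAddMonoidHom)
  have hθ : ∀ n, θ n = (e (π n), ((ψ n : ℤ) : ZMod g)) := fun n ↦ rfl
  have hθsurj : Function.Surjective θ := by
    rintro ⟨x, y⟩
    obtain ⟨m, rfl⟩ := ZMod.intCast_surjective y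
    have hker : ψ (e.symm x) = 0 := (e.symm x).2
    have h1 : ψ (e.symm x + m • w) = m := by rw [map_add, hker, hψw, zero_add]
    refine ⟨e.symm x + m • w, ?_⟩
    rw [hθ, h1]
    congr 1
    rw [← e.eq_symm_apply]
    refine Subtype.ext ?_
    rw [hπ, h1, add_sub_cancel_right]
  have hθker : θ.ker = AddSubgroup.zmultiples fun i ↦ (dg i : ℤ) := by
    ext n
    rw [AddMonoidHom.mem_ker, hθ, Prod.mk_eq_zero, e.map_eq_zero_iff, ← Subtype.coe_inj, hπ,
      ZMod.intCast_zmod_eq_zero_iff_dvd, hdg, AddSubgroup.mem_zmultiples_iff]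
    constructor
    · rintro ⟨hn, k, hk⟩
      refine ⟨k, ?_⟩
      rw [sub_eq_zero.1 hn, hk, smul_smul, mul_comm]
    · rintro ⟨k, rfl⟩
      have h1 : ψ (k • (g : ℤ) • w) = k * g := by rw [smul_smul, hψw]
      rw [h1]
      refine ⟨?_, dvd_mul_left _ _⟩
      rw [smul_smul, sub_self]
      rfl
  rw [← hθker]
  exact ⟨QuotientAddGroup.quotientKerEquivOfSurjective θ hθsurj⟩

end

/-- For a reduced projective plane curve `C = C¹ ∪ ⋯ ∪ C^r` defined by a
squarefree homogeneous polynomial `f = f₁ ⋯ f_r` with pairwise non-associated irreducible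
homogeneous factors of degrees `d₁, …, d_r`, the first homology of the complement, i.e. the
abelianization of its fundamental group, is `ℤ^{r-1} × ℤ/gcd(d₁,…,d_r)ℤ`. -/
theorem homology_of_curve_complement (r : ℕ) (hr : 1 ≤ r)
    (f : MvPolynomial (Fin 3) ℂ) (hsf : Squarefree f)
    (fs : Fin r → MvPolynomial (Fin 3) ℂ) (dg : Fin r → ℕ)
    (hirr : ∀ i, Irreducible (fs i))
    (hhom : ∀ i, (fs i).IsHomogeneous (dg i))
    (hdeg : ∀ i, 1 ≤ dg i)
    (hassoc : ∀ i j, i ≠ j → ¬ Associated (fs i) (fs j))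
    (hfact : f = ∏ i, fs i)
    (x₀ : ↥(curveComplement f)) :
    Nonempty (Abelianization (FundamentalGroup ↥(curveComplement f) x₀) ≃*
      Multiplicative ((Fin (r - 1) → ℤ) × ZMod (Finset.univ.gcd dg))) := by
  subst hfact
  obtain ⟨e⟩ := PathCocycle.nonempty_addEquiv_quotient hr hsf hirr hhom hdeg x₀
  obtain ⟨e'⟩ := nonempty_quotient_zmultiples_addEquiv hr dg
  exact ⟨AddEquiv.toMultiplicativeRight (e.trans e')⟩
end
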